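/- Assume the sequence (b_h) is constant with value b (b ≠ 0). Then F_{0,2} = Σ_{h≥0} b/F_{k·2^h} is an algebraic number, while the family consisting of all q_{μ,r} (r ≥ 2, 1 ≤ μ ≤ d(r)−1), all F_{ℓ,r} with (ℓ,r) ≠ (0,2), and all L_{ℓ,r} (ℓ ∈ ℤ, r ≥ 2) is algebraically independent over ℚ. -/

import Mathlib

noncomputable section

/-- The Lucas numbers: `L 0 = 2`, `L 1 = 1`, `L (n+2) = L n + L (n+1)`. -/
def lucasNum : ℕ → ℕ
  | 0 => 2
  | 1 => 1
  | n + 2 => lucasNum n + lucasNum (n + 1)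

/-- `d` is an integer `≥ 2` which is not a perfect power. -/
def NotPerfectPower (d : ℕ) : Prop := 2 ≤ d ∧ ∀ a n : ℕ, 2 ≤ n → d ≠ a ^ n

/-- The golden ratio `(1+√5)/2`, as a complex number. -/
def goldenRatioC : ℂ := (1 + Real.sqrt 5) / 2

/-- Index set for the numbers `q_{μ,r}`: pairs `(μ, r)` with `r ≥ 2` and
`1 ≤ μ ≤ d(r) - 1`, where `r = d(r)^j` with `d(r)` not a perfect power. -/
def QIdx : Type :=
  {p : ℕ × ℕ // ∃ d j : ℕ, NotPerfectPower d ∧ 1 ≤ j ∧ p.2 = d ^ j ∧ 1 ≤ p.1 ∧ p.1 ≤ d - 1}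

/-- Index set for the numbers `F_{ℓ,r}` with `(ℓ,r) ≠ (0,2)`. -/
def FIdx' : Type := {p : ℤ × ℕ // 2 ≤ p.2 ∧ p ≠ (0, 2)}

/-- Index set for the numbers `L_{ℓ,r}`: pairs `(ℓ, r)` with `ℓ ∈ ℤ`, `r ≥ 2`. -/
def FLIdx : Type := {p : ℤ × ℕ // 2 ≤ p.2}

theorem Polynomial.signVariations_lt_card_support {P : Polynomial ℝ} (hP : P ≠ 0) :
    P.signVariations < P.support.card := by
  induction h : P.support.card using Nat.strong_induction_on generalizing P with
  | _ n ih =>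
    subst h
    by_cases h0 : P.eraseLead = 0
    · have h1 : P = monomial P.natDegree P.leadingCoeff := by
        have := P.eraseLead_add_monomial_natDegree_leadingCoeff
        rw [h0, zero_add] at this
        exact this.symm
      have h2 : P.signVariations = 0 := by
        rw [h1]; exact signVariations_monomial _ _
      rw [h2]
      exact Finset.card_pos.mpr (Polynomial.support_nonempty.mpr hP)
    · have hlt : P.eraseLead.support.card < P.support.card := eraseLead_support_card_lt hP
      have := ih _ hlt h0 rfl
      have h3 := signVariations_le_eraseLead_succ (P := P)
      omega

/-- A real combination of `t` exponentials with distinct positive bases has fewer than `t`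
zeros among the natural numbers. -/
theorem card_zeros_exponential_sum_lt {ι : Type*} [Fintype ι] {e : ι → ℝ} (he : ∀ i, 0 < e i)
    (hinj : Function.Injective e) {c : ι → ℝ} (hc : c ≠ 0) {Z : Finset ℕ}
    (hZ : ∀ j ∈ Z, ∑ i, c i * e i ^ j = 0) : Z.card < Fintype.card ι := by
  classical
  by_contra! hcard
  obtain ⟨Z', hZ', hcard'⟩ := Finset.exists_subset_card_eq hcard
  have eqv : ι ≃ Z' := Fintype.equivOfCardEq (by simp [hcard'])
  let M : Matrix ι ι ℝ := fun i l => e i ^ (eqv l : ℕ)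
  have h1 : Matrix.vecMul c M = 0 := by
    funext l
    simpa [Matrix.vecMul, dotProduct, M] using hZ _ (hZ' (eqv l).2)
  have hdet : M.det = 0 := Matrix.exists_vecMul_eq_zero_iff.mp ⟨c, hc, h1⟩
  obtain ⟨b, hb, hMb⟩ := Matrix.exists_mulVec_eq_zero_iff.mpr hdet
  let P : Polynomial ℝ := ∑ l, Polynomial.monomial (eqv l : ℕ) (b l)
  have hcoeff : ∀ l, P.coeff (eqv l) = b l := by
    intro l
    simp only [P, Polynomial.finsetSum_coeff, Polynomial.coeff_monomial]
    rw [Finset.sum_eq_single l]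
    · simp
    · intro l' _ hl'
      rw [if_neg]
      intro h
      exact hl' (eqv.injective (Subtype.ext h))
    · simp
  have hP : P ≠ 0 := by
    intro h
    apply hb
    funext l
    rw [← hcoeff l, h]; simp
  have hsupp : P.support.card ≤ Fintype.card ι := by
    have : P.support ⊆ Z' := by
      intro n hn
      by_contra hnZ
      apply Polynomial.mem_support_iff.mp hn
      simp only [P, Polynomial.finsetSum_coeff, Polynomial.coeff_monomial]
      refine Finset.sum_eq_zero fun l _ => if_neg ?_
      rintro rfl
      exact hnZ (eqv l).2
    calc _ ≤ _ := Finset.card_le_card this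
      _ = _ := hcard'
  have hroot : ∀ i, P.eval (e i) = 0 := by
    intro i
    have := congrFun hMb i
    simp only [Matrix.mulVec, dotProduct, M, Pi.zero_apply] at this
    simp only [P, Polynomial.eval_finsetSum, Polynomial.eval_monomial]
    rw [← this]
    exact Finset.sum_congr rfl fun _ _ => mul_comm _ _
  have hcount : Fintype.card ι ≤ P.roots.countP (0 < ·) := by
    rw [Multiset.countP_eq_card_filter]
    have hsub : (Finset.univ.image e).val ≤ P.roots.filter (0 < ·) := by
      rw [Multiset.le_iff_subset (Finset.nodup _)]
      intro x hx
      simp only [Finset.mem_val, Finset.mem_image, Finset.mem_univ, true_and] at hx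
      obtain ⟨i, rfl⟩ := hx
      simp [hP, hroot i, he i]
    have := Multiset.card_le_card hsub
    rwa [Finset.card_val, Finset.card_image_of_injective _ hinj, Finset.card_univ] at this
  have h2 := P.roots_countP_pos_le_signVariations
  have h3 := Polynomial.signVariations_lt_card_support hP
  omega

section ComparablePowers

open Filter Topology

theorem exists_comparable_powers {ι : Type*} [Fintype ι] [Nonempty ι] {q : ι → ℕ}
    (hq : ∀ i, 2 ≤ q i)
    (hind : ∀ i j, i ≠ j → ∀ a b, 0 < a → 0 < b → q i ^ a ≠ q j ^ b) :
    ∃ C : ℝ, 1 ≤ C ∧ ∀ D : Finset (ι → ℤ), 0 ∉ D → ∃ η : ℝ, 0 < η ∧ ∀ B : ℕ,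
      ∃ (n : ι → ℕ) (T : ℝ), B ≤ T ∧ (∀ i, B ≤ n i) ∧
        (∀ i, (q i : ℝ) ^ n i ≤ T ∧ T ≤ C * (q i : ℝ) ^ n i) ∧
        ∀ c ∈ D, η * T ≤ |∑ i, (c i : ℝ) * (q i : ℝ) ^ n i| := by
  classical
  obtain ⟨i₀⟩ := ‹Nonempty ι›
  set Q : ℝ := ∑ i, (q i : ℝ) with hQ
  have hqQ : ∀ i, (q i : ℝ) ≤ Q := fun i =>
    Finset.single_le_sum (f := fun i => (q i : ℝ)) (fun _ _ => by positivity) (Finset.mem_univ i)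
  have hq0 : ∀ i, (0 : ℝ) < q i := fun i => by
    have := hq i
    positivity
  have hq2 : ∀ i, (2 : ℝ) ≤ q i := fun i => by exact_mod_cast hq i
  have hQ2 : 2 ≤ Q := (hq2 i₀).trans (hqQ i₀)
  refine ⟨4 * Q, by linarith, fun D hD => ?_⟩
  let ν : ℕ → ι → ℕ := fun k i => Nat.log (q i) (2 ^ k)
  let y : ℕ → ι → ℝ := fun k i => (q i : ℝ) ^ ν k i / 2 ^ k
  have hνX : ∀ k i, (q i : ℝ) ^ ν k i = y k i * 2 ^ k := fun k i => by simp [y]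
  have hy1 : ∀ k i, y k i ≤ 1 := by
    intro k i
    simp only [y]
    rw [div_le_one (by positivity)]
    exact_mod_cast Nat.pow_log_le_self (q i) (pow_ne_zero k two_ne_zero)
  have hyQ : ∀ k i, 1 / Q ≤ y k i := by
    intro k i
    have h1 : (2 : ℝ) ^ k ≤ (q i : ℝ) ^ (ν k i + 1) := by
      exact_mod_cast (Nat.lt_pow_succ_log_self (hq i) (2 ^ k)).le
    simp only [y]
    rw [div_le_div_iff₀ (by linarith) (by positivity), one_mul]
    calc (2 : ℝ) ^ k ≤ (q i : ℝ) ^ ν k i * q i := by rw [← pow_succ]; exact h1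
      _ ≤ (q i : ℝ) ^ ν k i * Q := by gcongr; exact hqQ i
  obtain ⟨ys, hys, φ, hφ, hlim⟩ := (isCompact_Icc (a := fun _ : ι => 1 / Q)
    (b := fun _ : ι => (1 : ℝ))).tendsto_subseq (x := y) (fun k => ⟨hyQ k, hy1 k⟩)
  have hlimi : ∀ i, Tendsto (fun k => y (φ k) i) atTop (𝓝 (ys i)) := tendsto_pi_nhds.mp hlim
  have hyspos : ∀ i, 0 < ys i := fun i => lt_of_lt_of_le (by positivity) (hys.1 i)
  let E : ℕ → ι → ℝ := fun k i => (q i : ℝ) ^ (ν (φ (k + 1)) i - ν (φ k) i)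
  have hypos : ∀ k i, 0 < y k i := fun k i => lt_of_lt_of_le (by positivity) (hyQ k i)
  have hνmono : ∀ k i, ν (φ k) i ≤ ν (φ (k + 1)) i := fun k i =>
    Nat.log_mono_right (Nat.pow_le_pow_right two_pos (hφ.monotone k.le_succ))
  have hE : ∀ k i, E k i = 2 ^ (φ (k + 1) - φ k) * (y (φ (k + 1)) i / y (φ k) i) := by
    intro k i
    have h1 : (q i : ℝ) ^ ν (φ k) i * E k i = (q i : ℝ) ^ ν (φ (k + 1)) i := by
      simp only [E]; rw [← pow_add, Nat.add_sub_cancel' (hνmono k i)]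
    have h2 : (2 : ℝ) ^ φ (k + 1) = 2 ^ φ k * 2 ^ (φ (k + 1) - φ k) := by
      rw [← pow_add, Nat.add_sub_cancel' (hφ.monotone k.le_succ)]
    rw [hνX, hνX, h2] at h1
    have := hypos (φ k) i
    have h3 : (0 : ℝ) < 2 ^ φ k := by positivity
    field_simp
    apply mul_left_cancel₀ h3.ne'
    linear_combination h1
  have hratio : ∀ i, Tendsto (fun k => y (φ (k + 1)) i / y (φ k) i) atTop (𝓝 1) := by
    intro i
    have := ((hlimi i).comp (tendsto_add_atTop_nat 1)).div (hlimi i) (hyspos i).ne'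
    rwa [div_self (hyspos i).ne'] at this
  have hrel : ∀ i, Tendsto (fun k => E k i / E k i₀) atTop (𝓝 1) := by
    intro i
    have h := (hratio i).div (hratio i₀) one_ne_zero
    rw [div_one] at h
    refine h.congr fun k => ?_
    simp only [Pi.div_apply]
    rw [hE, hE, mul_div_mul_left]
    positivity
  set J := D.card * Fintype.card ι + 1 with hJ
  have hev1 : ∀ᶠ k in atTop, ∀ i, ∀ j ∈ Finset.range J,
      1 / 2 < (E k i / E k i₀) ^ j ∧ (E k i / E k i₀) ^ j < 2 := by
    rw [eventually_all]
    intro i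
    rw [Finset.eventually_all]
    intro j _
    have h := (hrel i).pow j
    rw [one_pow] at h
    exact (h.eventually_const_lt (by norm_num)).and (h.eventually_lt_const (by norm_num))
  have hev2 : ∀ᶠ k in atTop, ∀ i, 1 / 2 < y (φ (k + 1)) i / y (φ k) i := by
    rw [eventually_all]
    exact fun i => (hratio i).eventually_const_lt (by norm_num)
  obtain ⟨k₀, hk1, hk2⟩ := (hev1.and hev2).exists
  set e : ι → ℝ := E k₀ with he
  have he0 : ∀ i, 0 < e i := fun i => pow_pos (hq0 i) _
  have he1 : ∀ i, 1 < e i := by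
    intro i
    rw [he, hE]
    have h1 : (2 : ℝ) ^ 1 ≤ 2 ^ (φ (k₀ + 1) - φ k₀) := by
      apply pow_le_pow_right₀ (by norm_num)
      have := hφ (Nat.lt_succ_self k₀)
      simp only [Nat.succ_eq_add_one] at this
      omega
    have := hk2 i
    nlinarith
  set m : ι → ℕ := fun i => ν (φ (k₀ + 1)) i - ν (φ k₀) i with hm
  have hem : ∀ i, e i = (q i : ℝ) ^ m i := fun i => rfl
  have hmpos : ∀ i, 0 < m i := by
    intro i
    rw [Nat.pos_iff_ne_zero]
    intro h
    have := he1 i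
    rw [hem, h, pow_zero] at this
    exact lt_irrefl _ this
  have hinj : Function.Injective e := by
    intro i j hij
    by_contra hne
    rw [hem, hem] at hij
    exact hind i j hne _ _ (hmpos i) (hmpos j) (by exact_mod_cast hij)
  obtain ⟨j, hjJ, hj⟩ : ∃ j ∈ Finset.range J, ∀ c ∈ D,
      ∑ i, ((c i : ℝ) * ys i) * e i ^ j ≠ 0 := by
    by_contra! hcon
    choose! c hc hc0 using hcon
    obtain ⟨d, hd, hcard⟩ := Finset.exists_lt_card_fiber_of_mul_lt_card_of_maps_to hc
      (n := Fintype.card ι) (by simp [hJ])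
    refine absurd (card_zeros_exponential_sum_lt he0 hinj (c := fun i => (d i : ℝ) * ys i) ?_
      (Z := {x ∈ Finset.range J | c x = d}) ?_) (by omega)
    · intro h
      apply hD
      have : d = 0 := by
        funext i
        have := congrFun h i
        simpa [(hyspos i).ne'] using this
      exact this ▸ hd
    · intro x hx
      rw [Finset.mem_filter] at hx
      rw [← hc0 x hx.1, hx.2]
  obtain ⟨η₁, hη₁, hηpos⟩ : ∃ η₁ : ℝ, (∀ c ∈ D, η₁ < |∑ i, ((c i : ℝ) * ys i) * e i ^ j|) ∧
      0 < η₁ := by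
    have h1 : ∀ᶠ η₁ in 𝓝[>] (0 : ℝ), ∀ c ∈ D, η₁ < |∑ i, ((c i : ℝ) * ys i) * e i ^ j| := by
      rw [Finset.eventually_all]
      intro c hc
      filter_upwards [Ioo_mem_nhdsGT (abs_pos.mpr (hj c hc))] with x hx using hx.2
    exact (h1.and self_mem_nhdsWithin).exists
  refine ⟨η₁ / (2 * e i₀ ^ j), by have := he0 i₀; positivity, fun B => ?_⟩
  have hev3 : ∀ᶠ k in atTop, ∀ c ∈ D, η₁ < |∑ i, ((c i : ℝ) * y (φ k) i) * e i ^ j| := by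
    rw [Finset.eventually_all]
    intro c hc
    have : Tendsto (fun k => |∑ i, ((c i : ℝ) * y (φ k) i) * e i ^ j|) atTop
        (𝓝 |∑ i, ((c i : ℝ) * ys i) * e i ^ j|) :=
      (tendsto_finsetSum _ fun i _ => ((hlimi i).const_mul _).mul_const _).abs
    exact this.eventually_const_lt (hη₁ c hc)
  have hev4 : ∀ᶠ k in atTop, ∀ i, q i ^ B ≤ 2 ^ φ k := by
    rw [eventually_all]
    intro i
    filter_upwards [eventually_ge_atTop (q i ^ B)] with k hk
    exact hk.trans ((hφ.le_apply).trans (Nat.lt_two_pow_self).le)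
  obtain ⟨k, hk3, hk4⟩ := (hev3.and hev4).exists
  have hpow : ∀ i, (q i : ℝ) ^ (ν (φ k) i + j * m i) = 2 ^ φ k * (y (φ k) i * e i ^ j) := by
    intro i
    rw [pow_add, hνX, hem, ← pow_mul, mul_comm j]
    ring
  have hX : (0 : ℝ) < 2 ^ φ k := by positivity
  have hcmp : ∀ i, e i ^ j < 2 * e i₀ ^ j ∧ e i₀ ^ j < 2 * e i ^ j := by
    intro i
    have h := hk1 i j hjJ
    have h0 : 0 < e i₀ ^ j := pow_pos (he0 i₀) _
    rw [div_pow, lt_div_iff₀ h0, div_lt_iff₀ h0] at h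
    constructor <;> linarith [h.1, h.2]
  refine ⟨fun i => ν (φ k) i + j * m i, 2 * 2 ^ φ k * e i₀ ^ j, ?_, ?_, ?_, ?_⟩
  · have h1 : (B : ℝ) ≤ 2 ^ φ k := by
      have h2 : B < q i₀ ^ B := Nat.lt_pow_self (hq i₀)
      exact_mod_cast h2.le.trans (hk4 i₀)
    have h2 : 1 ≤ e i₀ ^ j := one_le_pow₀ (he1 i₀).le
    nlinarith
  · intro i
    exact (Nat.le_log_of_pow_le (hq i) (hk4 i)).trans (Nat.le_add_right _ _)
  · intro i
    rw [hpow]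
    have h1 := hy1 (φ k) i
    have h2 := hyQ (φ k) i
    have h3 := hcmp i
    have h4 : 0 < e i ^ j := pow_pos (he0 i) _
    constructor
    · calc 2 ^ φ k * (y (φ k) i * e i ^ j) ≤ 2 ^ φ k * (1 * (2 * e i₀ ^ j)) := by
            gcongr
            exact h3.1.le
        _ = _ := by ring
    · calc 2 * 2 ^ φ k * e i₀ ^ j ≤ 2 * 2 ^ φ k * (2 * e i ^ j) := by
            gcongr
            exact h3.2.le
        _ = 4 * Q * (2 ^ φ k * (1 / Q * e i ^ j)) := by field_simp; ring
        _ ≤ _ := by gcongr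
  · intro c hc
    have h := hk3 c hc
    have h0 : 0 < e i₀ ^ j := pow_pos (he0 i₀) _
    have h1 : ∑ i, (c i : ℝ) * (q i : ℝ) ^ (ν (φ k) i + j * m i) =
        2 ^ φ k * ∑ i, ((c i : ℝ) * y (φ k) i) * e i ^ j := by
      rw [Finset.mul_sum]
      refine Finset.sum_congr rfl fun i _ => ?_
      rw [hpow]; ring
    rw [h1, abs_mul, abs_of_pos hX]
    calc η₁ / (2 * e i₀ ^ j) * (2 * 2 ^ φ k * e i₀ ^ j) = 2 ^ φ k * η₁ := by field_simp
      _ ≤ _ := by gcongr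

end ComparablePowers

section DependentMonomials

/-- If `ω` is algebraically dependent over `K`, then the monomials in `ω` of degree at most `p` in
each variable span a space whose dimension grows at most like `p ^ (m - 1)`. -/
theorem exists_finrank_span_monomials_le {K L J : Type*} [Field K] [Field L] [Algebra K L]
    [Fintype J] {ω : J → L} (h : ¬ AlgebraicIndependent K ω) :
    ∃ C : ℕ, ∀ p : ℕ, ∃ W : Submodule K L, Module.Finite K W ∧
      Module.finrank K W ≤ C * (Fintype.card J * p + 1) ^ (Fintype.card J - 1) ∧
      ∀ μ : J → ℕ, (∀ j, μ j ≤ p) → ∏ j, ω j ^ μ j ∈ W := by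
  classical
  let _ : LinearOrder J := LinearOrder.lift' (Fintype.equivFin J) (Fintype.equivFin J).injective
  obtain ⟨P, hP0, hPne⟩ : ∃ P : MvPolynomial J K, MvPolynomial.aeval ω P = 0 ∧ P ≠ 0 := by
    rw [algebraicIndependent_iff] at h
    push Not at h
    exact h
  set ν : J →₀ ℕ := MonomialOrder.degLex.degree P
  have hunit : IsUnit (MonomialOrder.degLex.leadingCoeff P) :=
    (MonomialOrder.degLex.leadingCoeff_ne_zero_iff.mpr hPne).isUnit
  refine ⟨∑ j, ν j, fun p => ?_⟩
  set N := Fintype.card J * p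
  let R : Finset (J → ℕ) := Finset.univ.biUnion fun j : J =>
    Fintype.piFinset fun i => if i = j then Finset.range (ν j) else Finset.range (N + 1)
  have hR : R.card ≤ (∑ j, ν j) * (N + 1) ^ (Fintype.card J - 1) := by
    refine Finset.card_biUnion_le.trans ?_
    rw [Finset.sum_mul]
    refine Finset.sum_le_sum fun j _ => ?_
    rw [Fintype.card_piFinset, ← Finset.mul_prod_erase _ _ (Finset.mem_univ j)]
    simp only [if_true, Finset.card_range]
    rw [Finset.prod_congr rfl (g := fun _ => N + 1)]
    · simp [Finset.card_erase_of_mem]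
    · intro i hi
      simp [Finset.ne_of_mem_erase hi]
  let S : Finset L := R.image fun κ => ∏ j, ω j ^ κ j
  refine ⟨Submodule.span K (S : Set L), Module.Finite.span_finset K S, ?_, fun μ hμ => ?_⟩
  · exact (finrank_span_finset_le_card S).trans (Finset.card_image_le.trans hR)
  let f : MvPolynomial J K := MvPolynomial.monomial (Finsupp.equivFunOnFinite.symm μ) 1
  have hf : MvPolynomial.aeval ω f = ∏ j, ω j ^ μ j := by
    simp [f, MvPolynomial.aeval_monomial, Finsupp.prod_fintype]
  have hfdeg : f.totalDegree ≤ N := by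
    refine (MvPolynomial.totalDegree_monomial_le _ _).trans ?_
    rw [Finsupp.sum_fintype _ _ (fun _ => rfl)]
    calc ∑ i, μ i ≤ ∑ _i : J, p := Finset.sum_le_sum fun i _ => hμ i
      _ = N := by simp [N]
  obtain ⟨g, r, hfr, hdeg, hr⟩ := MonomialOrder.degLex.div_single hunit f
  have hrf : r.totalDegree ≤ N := by
    have : r = f - P * g := by rw [hfr]; ring
    rw [this]
    refine (MvPolynomial.totalDegree_sub _ _).trans (max_le hfdeg ?_)
    exact (MvPolynomial.degLex_totalDegree_monotone hdeg).trans hfdeg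
  have hval : ∏ j, ω j ^ μ j = MvPolynomial.aeval ω r := by
    rw [← hf, hfr]; simp [hP0]
  rw [hval, MvPolynomial.aeval_def, MvPolynomial.eval₂_eq']
  refine Submodule.sum_mem _ fun κ hκ => ?_
  rw [← Algebra.smul_def]
  refine Submodule.smul_mem _ _ (Submodule.subset_span ?_)
  refine Finset.mem_coe.mpr (Finset.mem_image.mpr ⟨κ, ?_, rfl⟩)
  obtain ⟨j, hj⟩ : ∃ j, κ j < ν j := by
    have := hr κ hκ
    rw [Finsupp.le_def] at this
    push Not at this
    exact this
  refine Finset.mem_biUnion.mpr ⟨j, Finset.mem_univ j, Fintype.mem_piFinset.mpr fun i => ?_⟩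
  split_ifs with hij
  · simpa [hij] using hj
  · rw [Finset.mem_range, Nat.lt_succ_iff]
    exact ((MvPolynomial.le_degreeOf_of_mem_support i hκ).trans
      (MvPolynomial.degreeOf_le_totalDegree r i)).trans hrf

end DependentMonomials

section ProductIndependence

/-- Products of linearly independent families of functions in separate variables are linearly
independent. -/
theorem linearIndependent_pi_prod {R ι : Type*} [CommRing R] [Fintype ι] {A X : ι → Type*}
    {v : ∀ i, A i → X i → R} (hv : ∀ i, LinearIndependent R (v i)) :
    LinearIndependent R (fun (a : ∀ i, A i) (e : ∀ i, X i) => ∏ i, v i (a i) (e i)) := by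
  classical
  rw [linearIndependent_iff']
  intro T g hg
  have key : ∀ (s : Finset ι) (a' : ∀ i, A i) (e : ∀ i, X i),
      ∑ a ∈ T with ∀ i ∈ s, a i = a' i, g a * ∏ i ∈ sᶜ, v i (a i) (e i) = 0 := by
    intro s
    induction s using Finset.induction_on with
    | empty =>
      intro a' e
      simpa using congrFun hg e
    | insert i₀ s hi₀ ih =>
      intro a' e
      let G : A i₀ → R := fun α => ∑ a ∈ T with (∀ i ∈ s, a i = a' i) ∧ a i₀ = α,
        g a * ∏ i ∈ (insert i₀ s)ᶜ, v i (a i) (e i)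
      have hG : ∑ α ∈ T.image (fun a => a i₀), G α • v i₀ α = 0 := by
        funext n
        have h := ih a' (Function.update e i₀ n)
        rw [← Finset.sum_fiberwise_of_maps_to (t := T.image (fun a => a i₀)) (g := fun a => a i₀)
          (fun a ha => Finset.mem_image_of_mem _ (Finset.mem_filter.mp ha).1)] at h
        rw [Finset.sum_apply, Pi.zero_apply, ← h]
        refine Finset.sum_congr rfl fun α _ => ?_
        rw [Pi.smul_apply, smul_eq_mul, Finset.sum_mul, Finset.filter_filter]
        refine Finset.sum_congr rfl fun a ha => ?_
        have hi : i₀ ∈ sᶜ := by simpa using hi₀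
        rw [← Finset.mul_prod_erase _ _ hi, Finset.compl_insert, Function.update_self,
          (Finset.mem_filter.mp ha).2.2]
        have hp : ∏ i ∈ sᶜ.erase i₀, v i (a i) (Function.update e i₀ n i) =
            ∏ i ∈ sᶜ.erase i₀, v i (a i) (e i) := Finset.prod_congr rfl fun i hi => by
          rw [Function.update_of_ne (Finset.ne_of_mem_erase hi)]
        rw [hp]
        ring
      have hGz : ∀ α, G α = 0 := by
        intro α
        by_cases hα : α ∈ T.image (fun a => a i₀)
        · exact linearIndependent_iff'.mp (hv i₀) _ G hG α hα
        · refine Finset.sum_eq_zero fun a ha => absurd ?_ hα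
          rw [Finset.mem_filter] at ha
          exact Finset.mem_image.mpr ⟨a, ha.1, ha.2.2⟩
      rw [← hGz (a' i₀)]
      refine Finset.sum_congr (Finset.filter_congr fun a _ => ?_) fun _ _ => rfl
      rw [Finset.forall_mem_insert, and_comm]
  intro a ha
  by_cases hX : Nonempty (∀ i, X i)
  · obtain ⟨e⟩ := hX
    have := key Finset.univ a e
    simpa [← funext_iff, Finset.filter_eq', ha] using this
  · rw [not_nonempty_iff, isEmpty_pi] at hX
    obtain ⟨i, hi⟩ := hX
    have h0 : (fun _ : X i => (1 : R)) = 0 := Subsingleton.elim _ _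
    have hsub : Subsingleton R := by
      refine subsingleton_of_zero_eq_one ?_
      have := linearIndependent_iff'.mp (hv i) {a i} (fun _ => 1) (Subsingleton.elim _ _) (a i)
        (Finset.mem_singleton_self _)
      exact this.symm
    exact Subsingleton.elim _ _

end ProductIndependence

section OneVar

variable {ι J : Type*}

/-- The embedding of power series in one variable into power series in several variables,
sending the variable to `X i`. -/
def PowerSeries.toMv {R : Type*} [CommRing R] (i : ι) : PowerSeries R →ₐ[R] MvPowerSeries ι R :=
  MvPowerSeries.rename (⟨fun _ => i, fun _ _ _ => rfl⟩ : Unit ↪ ι)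

theorem PowerSeries.coeff_toMv [DecidableEq ι] {R : Type*} [CommRing R] (i : ι) (f : PowerSeries R)
    (e : ι →₀ ℕ) : MvPowerSeries.coeff e (f.toMv i) =
      if e = Finsupp.single i (e i) then f.coeff (e i) else 0 := by
  have hemb : ∀ n : ℕ, Finsupp.embDomain (⟨fun _ => i, fun _ _ _ => rfl⟩ : Unit ↪ ι)
      (Finsupp.single () n) = Finsupp.single i n := fun n => by
    rw [Finsupp.embDomain_single]; rfl
  split_ifs with h
  · rw [h, ← hemb, PowerSeries.toMv, MvPowerSeries.coeff_embDomain_rename, hemb]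
    simp [PowerSeries.coeff]
  · refine MvPowerSeries.coeff_rename_eq_zero _ _ ?_
    rintro ⟨x, rfl⟩
    apply h
    rw [← Finsupp.embDomain_eq_mapDomain]
    have hx : x = Finsupp.single () (x ()) := by ext; simp
    rw [hx, hemb]
    simp

theorem PowerSeries.toMv_X {R : Type*} [CommRing R] (i : ι) :
    (PowerSeries.X : PowerSeries R).toMv i = MvPowerSeries.X i :=
  MvPowerSeries.rename_X _ _

theorem PowerSeries.coeff_prod_toMv [DecidableEq ι] {R : Type*} [CommRing R] (s : Finset ι)
    (f : ι → PowerSeries R) (e : ι →₀ ℕ) :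
    MvPowerSeries.coeff e (∏ i ∈ s, (f i).toMv i) =
      if e.support ⊆ s then ∏ i ∈ s, (f i).coeff (e i) else 0 := by
  induction s using Finset.induction_on generalizing e with
  | empty => simp [MvPowerSeries.coeff_one]
  | insert i s hi ih =>
    rw [Finset.prod_insert hi, MvPowerSeries.coeff_mul,
      Finset.sum_eq_single (Finsupp.single i (e i), e.erase i)]
    · rw [PowerSeries.coeff_toMv, ih]
      simp only [Finsupp.single_eq_same, if_true, Finsupp.support_erase, Finset.prod_insert hi]
      have hp : ∏ j ∈ s, (f j).coeff (e.erase i j) = ∏ j ∈ s, (f j).coeff (e j) :=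
        Finset.prod_congr rfl fun j hj => by rw [Finsupp.erase_ne (ne_of_mem_of_not_mem hj hi)]
      simp only [Finset.subset_insert_iff, hp]
      split_ifs <;> simp
    · rintro ⟨a, b⟩ hab hne
      rw [Finset.HasAntidiagonal.mem_antidiagonal] at hab
      simp only at hab ⊢
      rw [PowerSeries.coeff_toMv, ih]
      split_ifs with h1 h2
      · exfalso
        apply hne
        have hbi : b i = 0 := by
          by_contra h
          exact hi (h2 (Finsupp.mem_support_iff.mpr h))
        have hai : a i = e i := by rw [← hab]; simp [hbi]
        rw [hai] at h1
        have hb : b = e.erase i := by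
          rw [← hab, h1]
          ext j
          by_cases hj : j = i
          · subst hj; simp [hbi]
          · simp [Finsupp.erase_ne hj]
        rw [h1, ← hb]
      all_goals simp
    · intro h
      refine absurd ?_ h
      rw [Finset.HasAntidiagonal.mem_antidiagonal]
      exact Finsupp.single_add_erase i e

/-- Algebraic independence of power series in one variable over the polynomials passes to power
series in several separate variables. -/
theorem algebraicIndependent_toMv {R : Type*} [CommRing R] [Fintype ι] [Fintype J] (π : J → ι)
    (f : J → PowerSeries R)
    (h : ∀ i, AlgebraicIndependent R
      (Sum.elim (fun _ : Unit => PowerSeries.X) (fun j : {j // π j = i} => f j) :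
        Unit ⊕ {j // π j = i} → PowerSeries R)) :
    AlgebraicIndependent R
      (Sum.elim MvPowerSeries.X (fun j => (f j).toMv (π j)) : ι ⊕ J → MvPowerSeries ι R) := by
  classical
  let A : ι → Type _ := fun i => Unit ⊕ {j // π j = i} → ℕ
  let E : ∀ i, A i → PowerSeries R := fun i a =>
    PowerSeries.X ^ a (Sum.inl ()) * ∏ j : {j // π j = i}, f j ^ a (Sum.inr j)
  let v : ∀ i, A i → ℕ → R := fun i a n => (E i a).coeff n
  have hv : ∀ i, LinearIndependent R (v i) := by
    intro i
    rw [linearIndependent_iff']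
    intro T g hg a ha
    have h0 : MvPolynomial.aeval (Sum.elim (fun _ : Unit => PowerSeries.X)
        (fun j : {j // π j = i} => f j) : Unit ⊕ {j // π j = i} → PowerSeries R)
        (∑ b ∈ T, MvPolynomial.monomial (Finsupp.equivFunOnFinite.symm b) (g b)) = 0 := by
      ext n
      have := congrFun hg n
      simpa [MvPolynomial.aeval_monomial, Finsupp.prod_fintype, v, E, ← PowerSeries.smul_eq_C_mul,
        ← Algebra.smul_def] using this
    have h1 := (algebraicIndependent_iff.mp (h i)) _ h0
    have h2 := congrArg (MvPolynomial.coeff (Finsupp.equivFunOnFinite.symm a)) h1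
    rw [MvPolynomial.coeff_sum, Finset.sum_eq_single a] at h2
    · simpa using h2
    · intro b _ hb
      rw [MvPolynomial.coeff_monomial, if_neg (by simpa using hb)]
    · exact fun h => absurd ha h
  rw [algebraicIndependent_iff]
  intro P hP
  ext κ
  let ρ : (ι ⊕ J →₀ ℕ) → ∀ i, A i := fun κ i =>
    Sum.elim (fun _ => κ (Sum.inl i)) (fun j => κ (Sum.inr j))
  have hρ : Function.Injective ρ := by
    intro κ κ' hκ
    ext (i | j)
    · exact congrFun (congrFun hκ i) (Sum.inl ())
    · exact congrFun (congrFun hκ (π j)) (Sum.inr ⟨j, rfl⟩)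
  have hlin := (linearIndependent_pi_prod hv).comp ρ hρ
  rw [linearIndependent_iff'] at hlin
  by_cases hκ : κ ∈ P.support
  swap
  · simpa using hκ
  refine hlin P.support (fun κ => P.coeff κ) ?_ κ hκ
  funext e
  have he := congrArg (MvPowerSeries.coeff (Finsupp.equivFunOnFinite.symm e)) hP
  rw [MvPolynomial.aeval_def, MvPolynomial.eval₂_eq', map_sum, map_zero] at he
  rw [Finset.sum_apply, Pi.zero_apply, ← he]
  refine Finset.sum_congr rfl fun κ _ => ?_
  rw [← Algebra.smul_def, map_smul, Pi.smul_apply]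
  congr 1
  have hprod : ∏ x : ι ⊕ J, (Sum.elim MvPowerSeries.X (fun j => (f j).toMv (π j)) :
      ι ⊕ J → MvPowerSeries ι R) x ^ κ x = ∏ i, (E i (ρ κ i)).toMv i := by
    rw [Fintype.prod_sum_type]
    simp only [E, Sum.elim_inl, Sum.elim_inr, map_mul, map_pow, map_prod, PowerSeries.toMv_X,
      Finset.prod_mul_distrib, ρ]
    congr 1
    rw [← Fintype.prod_fiberwise π]
    refine Finset.prod_congr rfl fun i _ => Finset.prod_congr rfl fun j _ => ?_
    rw [j.2]
  rw [hprod, PowerSeries.coeff_prod_toMv]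
  simp [v]

end OneVar

section Asymptotics

open Filter Topology Asymptotics

variable {ι : Type*}

/-- `F` has the asymptotic expansion `f` at the origin of `ℂ`. -/
def HasAsymp (F : ℂ → ℂ) (f : PowerSeries ℂ) : Prop :=
  ∀ s : ℕ, ∃ p : Polynomial ℂ, (∀ n < s, p.coeff n = f.coeff n) ∧
    (fun x => F x - p.eval x) =O[𝓝 0] fun x => ‖x‖ ^ s

/-- `g` has the asymptotic expansion `Φ` at the origin of `ι → ℂ`. -/
def HasMvAsymp [Fintype ι] (g : (ι → ℂ) → ℂ) (Φ : MvPowerSeries ι ℂ) : Prop :=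
  ∀ s : ℕ, ∃ P : MvPolynomial ι ℂ, (∀ e : ι →₀ ℕ, e.degree < s → P.coeff e = Φ.coeff e) ∧
    (fun z => g z - P.eval z) =O[𝓝 0] fun z => ‖z‖ ^ s

variable [Fintype ι]

theorem HasMvAsymp.const (c : ℂ) :
    HasMvAsymp (fun _ : ι → ℂ => c) (algebraMap ℂ (MvPowerSeries ι ℂ) c) := fun s =>
  ⟨MvPolynomial.C c, fun e _ => by
    classical
    rw [MvPowerSeries.algebraMap_apply, Algebra.algebraMap_self_apply, MvPolynomial.coeff_C,
      MvPowerSeries.coeff_C]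
    simp [eq_comm], by simpa using isBigO_zero _ _⟩

theorem HasMvAsymp.coord (i : ι) : HasMvAsymp (fun z => z i) (MvPowerSeries.X i) := fun s =>
  ⟨MvPolynomial.X i, fun e _ => by
    classical
    rw [MvPolynomial.coeff_X, MvPowerSeries.coeff_X]
    simp [eq_comm], by simpa using isBigO_zero _ _⟩

theorem HasMvAsymp.add {g h : (ι → ℂ) → ℂ} {Φ Ψ : MvPowerSeries ι ℂ} (hg : HasMvAsymp g Φ)
    (hh : HasMvAsymp h Ψ) : HasMvAsymp (fun z => g z + h z) (Φ + Ψ) := fun s => by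
  obtain ⟨P, hP, hgP⟩ := hg s
  obtain ⟨Q, hQ, hhQ⟩ := hh s
  refine ⟨P + Q, fun e he => by simp [hP e he, hQ e he], ?_⟩
  refine (hgP.add hhQ).congr_left fun z => ?_
  rw [map_add]
  ring

theorem HasMvAsymp.isBigO_one {g : (ι → ℂ) → ℂ} {Φ : MvPowerSeries ι ℂ} (hg : HasMvAsymp g Φ) :
    g =O[𝓝 0] fun _ => (1 : ℝ) := by
  obtain ⟨P, -, hP⟩ := hg 0
  have hcont : Continuous fun z : ι → ℂ => P.eval z := MvPolynomial.continuous_eval P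
  have h1 : (fun z : ι → ℂ => P.eval z) =O[𝓝 0] fun _ => (1 : ℝ) :=
    hcont.continuousAt.tendsto.isBigO_one ℝ
  simpa using (hP.trans (by simpa using isBigO_refl (fun _ : ι → ℂ => (1 : ℝ)) _)).add h1

theorem HasMvAsymp.mul {g h : (ι → ℂ) → ℂ} {Φ Ψ : MvPowerSeries ι ℂ} (hg : HasMvAsymp g Φ)
    (hh : HasMvAsymp h Ψ) : HasMvAsymp (fun z => g z * h z) (Φ * Ψ) := fun s => by
  classical
  obtain ⟨P, hP, hgP⟩ := hg s
  obtain ⟨Q, hQ, hhQ⟩ := hh s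
  refine ⟨P * Q, fun e he => ?_, ?_⟩
  · rw [MvPolynomial.coeff_mul, MvPowerSeries.coeff_mul]
    refine Finset.sum_congr rfl fun x hx => ?_
    rw [Finset.HasAntidiagonal.mem_antidiagonal] at hx
    have : x.1.degree + x.2.degree = e.degree := by rw [← hx, map_add]
    rw [hP _ (by omega), hQ _ (by omega)]
  · have h1 : (fun z : ι → ℂ => Q.eval z) =O[𝓝 0] fun _ => (1 : ℝ) :=
      (MvPolynomial.continuous_eval Q).continuousAt.tendsto.isBigO_one ℝ
    have h2 := (hg.isBigO_one.mul hhQ).add ((hgP.mul h1).congr_right fun z => mul_comm _ _)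
    refine (h2.congr_left fun z => ?_).congr_right fun z => one_mul _
    rw [map_mul]
    ring

theorem HasMvAsymp.aeval {σ : Type*} {g : σ → (ι → ℂ) → ℂ} {Φ : σ → MvPowerSeries ι ℂ}
    (h : ∀ x, HasMvAsymp (g x) (Φ x)) (B : MvPolynomial σ ℂ) :
    HasMvAsymp (fun z => B.eval fun x => g x z) (MvPolynomial.aeval Φ B) := by
  induction B using MvPolynomial.induction_on with
  | C a => simpa using HasMvAsymp.const a
  | add p q hp hq => simpa using hp.add hq
  | mul_X p x hp => simpa using hp.mul (h x)

theorem HasAsymp.toMv {F : ℂ → ℂ} {f : PowerSeries ℂ} (h : HasAsymp F f) (i : ι) :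
    HasMvAsymp (fun z => F (z i)) (f.toMv i) := fun s => by
  classical
  obtain ⟨p, hp, hF⟩ := h s
  refine ⟨Polynomial.aeval (MvPolynomial.X i) p, fun e he => ?_, ?_⟩
  · have hcoe : MvPolynomial.coeff e (Polynomial.aeval (MvPolynomial.X i : MvPolynomial ι ℂ) p) =
        MvPowerSeries.coeff e ((p : PowerSeries ℂ).toMv i) := by
      have : (p : PowerSeries ℂ).toMv i =
          ((Polynomial.aeval (MvPolynomial.X i : MvPolynomial ι ℂ) p : MvPolynomial ι ℂ) :
            MvPowerSeries ι ℂ) := by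
        refine DFunLike.congr_fun (f := (PowerSeries.toMv i).comp
          (Polynomial.coeToPowerSeries.algHom ℂ)) (g := (MvPolynomial.coeToMvPowerSeries.algHom
          ℂ).comp (Polynomial.aeval (MvPolynomial.X i))) (Polynomial.algHom_ext ?_) p
        simp [PowerSeries.toMv_X]
      rw [this, MvPolynomial.coeff_coe]
    rw [hcoe, PowerSeries.coeff_toMv, PowerSeries.coeff_toMv, Polynomial.coeff_coe]
    split_ifs with hei
    · refine hp _ (lt_of_le_of_lt ?_ he)
      exact Finsupp.le_degree i e
    · rfl
  · have hproj : Tendsto (fun z : ι → ℂ => z i) (𝓝 0) (𝓝 0) :=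
      (continuous_apply i).tendsto' _ _ rfl
    have h1 := hF.comp_tendsto hproj
    refine (h1.congr_left fun z => ?_).trans (IsBigO.of_bound 1 (Eventually.of_forall fun z => ?_))
    · have h2 := Polynomial.aeval_algHom_apply (MvPolynomial.aeval z) (MvPolynomial.X i) p
      rw [MvPolynomial.aeval_X, Polynomial.coe_aeval_eq_eval, MvPolynomial.aeval_eq_eval] at h2
      exact congrArg _ h2
    · simp only [Function.comp, norm_pow, norm_norm, one_mul]
      gcongr
      exact norm_le_pi_norm z i

/-- A function whose expansion has no terms of low order is small. -/
theorem HasMvAsymp.isBigO_of_coeff_eq_zero {g : (ι → ℂ) → ℂ} {Φ : MvPowerSeries ι ℂ}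
    (hg : HasMvAsymp g Φ) {s : ℕ} (h : ∀ e : ι →₀ ℕ, e.degree < s → Φ.coeff e = 0) :
    g =O[𝓝 0] fun z => ‖z‖ ^ s := by
  obtain ⟨P, hP, hgP⟩ := hg s
  have hPO : (fun z : ι → ℂ => P.eval z) =O[𝓝 0] fun z => ‖z‖ ^ s := by
    simp_rw [MvPolynomial.eval_eq']
    suffices hmon : ∀ e ∈ P.support, (fun z : ι → ℂ => P.coeff e * ∏ i, z i ^ e i) =O[𝓝 0]
        fun z => ‖z‖ ^ s from IsBigO.fun_sum hmon
    intro e he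
    have hes : s ≤ e.degree := by
      by_contra! hlt
      rw [MvPolynomial.mem_support_iff, hP e hlt, h e hlt] at he
      exact he rfl
    refine IsBigO.const_mul_left ?_ _
    refine IsBigO.of_bound (E := ℂ) 1 ?_
    have hball : ∀ᶠ z : ι → ℂ in 𝓝 0, ‖z‖ < 1 :=
      (continuous_norm.tendsto' (0 : ι → ℂ) 0 norm_zero).eventually_lt_const one_pos
    filter_upwards [hball] with z hz
    rw [norm_prod, one_mul, norm_pow, norm_norm]
    calc ∏ i, ‖z i ^ e i‖ ≤ ∏ i, ‖z‖ ^ e i := by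
          refine Finset.prod_le_prod (fun _ _ => norm_nonneg _) fun i _ => ?_
          rw [norm_pow]
          gcongr
          exact norm_le_pi_norm z i
      _ = ‖z‖ ^ e.degree := by rw [Finset.prod_pow_eq_pow_sum, Finsupp.degree_eq_sum]
      _ ≤ ‖z‖ ^ s := pow_le_pow_of_le_one (norm_nonneg _) hz.le hes
  simpa using hgP.add hPO

end Asymptotics

section Nonvanishing

open Filter Topology Asymptotics

variable {ι : Type*} [Fintype ι]

theorem norm_pow_coords_le {α : ℝ} (h0 : 0 < α) (h1 : α < 1) {x : ι → ℕ} {y : ℝ}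
    (hx : ∀ i, y ≤ x i) : ‖fun i => (α : ℂ) ^ x i‖ ≤ α ^ y := by
  refine (pi_norm_le_iff_of_nonneg (Real.rpow_nonneg h0.le _)).mpr fun i => ?_
  rw [norm_pow, Complex.norm_real, Real.norm_of_nonneg h0.le, ← Real.rpow_natCast]
  exact Real.rpow_le_rpow_of_exponent_ge h0 h1.le (hx i)

/-- A function with a nonzero asymptotic expansion does not vanish along suitable sequences of
points whose coordinates are `α ^ (q i) ^ n`. -/
theorem HasMvAsymp.exists_ne_zero [Nonempty ι] {q : ι → ℕ} (hq : ∀ i, 2 ≤ q i)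
    (hind : ∀ i j, i ≠ j → ∀ a b, 0 < a → 0 < b → q i ^ a ≠ q j ^ b)
    {α : ℝ} (hα0 : 0 < α) (hα1 : α < 1) :
    ∃ C : ℝ, 1 ≤ C ∧ ∀ (g : (ι → ℂ) → ℂ) (Φ : MvPowerSeries ι ℂ), Φ ≠ 0 → HasMvAsymp g Φ →
      ∀ B : ℕ, ∃ (n : ι → ℕ) (T : ℝ), B ≤ T ∧ (∀ i, B ≤ n i) ∧
        (∀ i, (q i : ℝ) ^ n i ≤ T ∧ T ≤ C * (q i : ℝ) ^ n i) ∧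
        g (fun i => (α : ℂ) ^ q i ^ n i) ≠ 0 := by
  classical
  obtain ⟨C, hC, hdir⟩ := exists_comparable_powers hq hind
  refine ⟨C, hC, fun g Φ hΦ hg B => ?_⟩
  obtain ⟨e₀, he₀⟩ : ∃ e₀, Φ.coeff e₀ ≠ 0 := by
    by_contra! h
    exact hΦ (MvPowerSeries.ext h)
  obtain ⟨s, hs⟩ := exists_nat_gt (C * (e₀.degree + 1))
  have hse : e₀.degree < s := by
    have : ((e₀.degree : ℕ) : ℝ) < s := by nlinarith [(Nat.cast_nonneg e₀.degree : (0 : ℝ) ≤ _)]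
    exact_mod_cast this
  obtain ⟨P, hP, hgP⟩ := hg s
  have he₀P : e₀ ∈ P.support := by rwa [MvPolynomial.mem_support_iff, hP _ hse]
  obtain ⟨K', hK'0, hK'⟩ := hgP.exists_pos
  rw [isBigOWith_iff] at hK'
  obtain ⟨ε, hε, hball⟩ := Metric.eventually_nhds_iff.mp hK'
  let D : Finset (ι → ℤ) := P.support.offDiag.image fun x i => (x.1 i : ℤ) - x.2 i
  have hD : (0 : ι → ℤ) ∉ D := by
    intro h
    obtain ⟨x, hx, hx0⟩ := Finset.mem_image.mp h
    apply (Finset.mem_offDiag.mp hx).2.2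
    ext i
    have := congrFun hx0 i
    simpa [sub_eq_zero] using this
  obtain ⟨η, hη, hdirη⟩ := hdir D hD
  obtain ⟨c₀, hc₀, hc₀P⟩ : ∃ c₀ : ℝ, 0 < c₀ ∧ ∀ e ∈ P.support, c₀ ≤ ‖P.coeff e‖ := by
    obtain ⟨e, he, hmin⟩ := P.support.exists_min_image (fun e => ‖P.coeff e‖) ⟨e₀, he₀P⟩
    exact ⟨_, norm_pos_iff.mpr (MvPolynomial.mem_support_iff.mp he), hmin⟩
  set K := ∑ e ∈ P.support, ‖P.coeff e‖
  have hlim : ∀ᶠ T : ℝ in atTop, K * α ^ (η * T) + K' * α ^ T < c₀ ∧ α ^ (T / C) < ε := by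
    have h0 := tendsto_rpow_atTop_of_base_lt_one α (by linarith) hα1
    have h1 : Tendsto (fun T : ℝ => K * α ^ (η * T) + K' * α ^ T) atTop (𝓝 (K * 0 + K' * 0)) :=
      ((h0.comp (tendsto_id.const_mul_atTop hη)).const_mul K).add (h0.const_mul K')
    have h2 : Tendsto (fun T : ℝ => α ^ (T / C)) atTop (𝓝 0) :=
      h0.comp (tendsto_id.atTop_div_const (by linarith))
    exact (h1.eventually_lt_const (by simpa using hc₀)).and (h2.eventually_lt_const hε)
  obtain ⟨T₀, hT₀⟩ := eventually_atTop.mp hlim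
  obtain ⟨n, T, hBT, hBn, hcomp, hsep⟩ := hdirη (max B ⌈T₀⌉₊)
  have hTB : (B : ℝ) ≤ T := le_trans (by exact_mod_cast le_max_left _ _) hBT
  have hTT : T₀ ≤ T := (Nat.le_ceil T₀).trans (le_trans (by exact_mod_cast le_max_right _ _) hBT)
  obtain ⟨hT1, hT2⟩ := hT₀ T hTT
  refine ⟨n, T, hTB, fun i => (le_max_left _ _).trans (hBn i), hcomp, ?_⟩
  set z : ι → ℂ := fun i => (α : ℂ) ^ q i ^ n i with hz
  have hC0 : 0 < C := by linarith
  have hT0 : 0 ≤ T := (Nat.cast_nonneg _).trans hTB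
  have hzn : ‖z‖ ≤ α ^ (T / C) := norm_pow_coords_le hα0 hα1 fun i => by
    rw [div_le_iff₀ hC0, mul_comm]
    exact_mod_cast (hcomp i).2
  have herr : ‖g z - P.eval z‖ ≤ K' * ‖‖z‖ ^ s‖ := hball (by
    rw [dist_zero_right]
    exact hzn.trans_lt hT2)
  let N : (ι →₀ ℕ) → ℝ := fun e => ∑ i, (e i : ℝ) * (q i : ℝ) ^ n i
  have hmon : ∀ e : ι →₀ ℕ, ‖∏ i, z i ^ e i‖ = α ^ N e := by
    intro e
    rw [norm_prod, Real.rpow_sum_of_pos hα0]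
    refine Finset.prod_congr rfl fun i _ => ?_
    rw [hz, norm_pow, norm_pow, Complex.norm_real, Real.norm_of_nonneg hα0.le, ← pow_mul,
      ← Real.rpow_natCast]
    congr 1
    push_cast
    ring
  obtain ⟨e₁, he₁, hmin⟩ := P.support.exists_min_image N ⟨e₀, he₀P⟩
  have hN0 : N e₁ ≤ e₀.degree * T := by
    refine (hmin e₀ he₀P).trans ?_
    rw [Finsupp.degree_eq_sum, Nat.cast_sum, Finset.sum_mul]
    exact Finset.sum_le_sum fun i _ => mul_le_mul_of_nonneg_left (hcomp i).1 (Nat.cast_nonneg _)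
  have hgap : ∀ e ∈ P.support, e ≠ e₁ → N e₁ + η * T ≤ N e := by
    intro e he hne
    have hmem : (fun i => ((e i : ℤ) - e₁ i)) ∈ D :=
      Finset.mem_image.mpr ⟨(e, e₁), Finset.mem_offDiag.mpr ⟨he, he₁, hne⟩, rfl⟩
    have h := hsep _ hmem
    have h2 : ∑ i, (((e i : ℤ) - e₁ i : ℤ) : ℝ) * (q i : ℝ) ^ n i = N e - N e₁ := by
      rw [← Finset.sum_sub_distrib]
      refine Finset.sum_congr rfl fun i _ => ?_
      push_cast
      ring
    rw [h2, abs_of_nonneg (sub_nonneg.mpr (hmin e he))] at h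
    linarith
  have hα1' : 0 < α ^ N e₁ := Real.rpow_pos_of_pos hα0 _
  have hrest : ‖∑ e ∈ P.support.erase e₁, P.coeff e * ∏ i, z i ^ e i‖ ≤
      K * α ^ (η * T) * α ^ N e₁ := by
    calc _ ≤ ∑ e ∈ P.support.erase e₁, ‖P.coeff e‖ * (α ^ (η * T) * α ^ N e₁) := by
          refine norm_sum_le_of_le _ fun e he => ?_
          rw [norm_mul, hmon, ← Real.rpow_add hα0, add_comm]
          refine mul_le_mul_of_nonneg_left ?_ (norm_nonneg _)
          exact Real.rpow_le_rpow_of_exponent_ge hα0 hα1.le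
            (hgap e (Finset.mem_of_mem_erase he) (Finset.ne_of_mem_erase he))
      _ ≤ K * (α ^ (η * T) * α ^ N e₁) := by
          rw [← Finset.sum_mul]
          refine mul_le_mul_of_nonneg_right ?_ (by positivity)
          exact Finset.sum_le_sum_of_subset_of_nonneg (Finset.erase_subset _ _)
            fun _ _ _ => norm_nonneg _
      _ = _ := by ring
  have herr2 : ‖g z - P.eval z‖ ≤ K' * α ^ T * α ^ N e₁ := by
    refine herr.trans ?_
    rw [norm_pow, norm_norm, mul_assoc, ← Real.rpow_add hα0]
    refine mul_le_mul_of_nonneg_left ?_ hK'0.le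
    calc ‖z‖ ^ s ≤ (α ^ (T / C)) ^ s := by gcongr
      _ = α ^ (T / C * s) := by rw [Real.rpow_mul hα0.le, Real.rpow_natCast]
      _ ≤ _ := by
        refine Real.rpow_le_rpow_of_exponent_ge hα0 hα1.le ?_
        calc T + N e₁ ≤ T / C * (C * (e₀.degree + 1)) := by
              field_simp
              linarith
          _ ≤ T / C * s := by gcongr
  intro hg0
  have hmain : ‖P.coeff e₁‖ * α ^ N e₁ ≤ (K * α ^ (η * T) + K' * α ^ T) * α ^ N e₁ := by
    have h1 : P.coeff e₁ * ∏ i, z i ^ e₁ i =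
        -(g z - P.eval z) - ∑ e ∈ P.support.erase e₁, P.coeff e * ∏ i, z i ^ e i := by
      rw [hg0, MvPolynomial.eval_eq', ← Finset.add_sum_erase _ _ he₁]
      ring
    rw [← hmon e₁, ← norm_mul, h1, hmon e₁]
    refine (norm_sub_le _ _).trans ?_
    rw [norm_neg]
    linarith
  have := le_of_mul_le_mul_right hmain hα1'
  linarith [hc₀P e₁ he₁]

end Nonvanishing

section AuxiliaryPolynomial

variable {ι J : Type*}

/-- Replacing some members of an algebraically independent family by constants minus them
preserves algebraic independence. -/
theorem AlgebraicIndependent.const_sub {R S : Type*} [CommRing R] [CommRing S] [Algebra R S]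
    {x : ι → S} {y : J → S} (h : AlgebraicIndependent R (Sum.elim x y)) (ω : J → R) :
    AlgebraicIndependent R (Sum.elim x fun j => algebraMap R S (ω j) - y j) := by
  rw [algebraicIndependent_iff]
  intro A hA
  let τ : MvPolynomial (ι ⊕ J) R →ₐ[R] MvPolynomial (ι ⊕ J) R :=
    MvPolynomial.aeval (Sum.elim (fun i => MvPolynomial.X (Sum.inl i))
      fun j => MvPolynomial.C (ω j) - MvPolynomial.X (Sum.inr j))
  have h1 : (MvPolynomial.aeval (Sum.elim x y)).comp τ =
      MvPolynomial.aeval (Sum.elim x fun j => algebraMap R S (ω j) - y j) := by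
    refine MvPolynomial.algHom_ext fun k => ?_
    rcases k with i | j <;> simp [τ]
  have h2 : τ.comp τ = AlgHom.id R _ := by
    refine MvPolynomial.algHom_ext fun k => ?_
    rcases k with i | j <;> simp [τ, MvPolynomial.algebraMap_eq]
  have h3 : MvPolynomial.aeval (Sum.elim x y) (τ A) = 0 := by
    rw [← hA, ← h1]; rfl
  have h4 := (algebraicIndependent_iff.mp h) _ h3
  have h5 : τ (τ A) = A := DFunLike.congr_fun h2 A
  rw [← h5, h4, map_zero]

theorem coeff_prod_const_sub_mem [Fintype J] {K L : Type*} [Field K] [Field L] [Algebra K L]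
    {ω : J → L} {W : Submodule K L} {p : ℕ}
    (hW : ∀ μ : J → ℕ, (∀ j, μ j ≤ p) → ∏ j, ω j ^ μ j ∈ W) (φ : J → MvPowerSeries ι K)
    (χ : MvPowerSeries ι K) {ν : J → ℕ} (hν : ∀ j, ν j ≤ p) (e : ι →₀ ℕ) :
    MvPowerSeries.coeff e (MvPowerSeries.map (algebraMap K L) χ *
      ∏ j, (MvPowerSeries.C (ω j) - MvPowerSeries.map (algebraMap K L) (φ j)) ^ ν j) ∈ W := by
  classical
  have hexp : MvPowerSeries.map (algebraMap K L) χ *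
      ∏ j, (MvPowerSeries.C (ω j) - MvPowerSeries.map (algebraMap K L) (φ j)) ^ ν j =
      ∑ κ ∈ Fintype.piFinset fun j => Finset.range (ν j + 1),
        MvPowerSeries.C (∏ j, ω j ^ κ j) * MvPowerSeries.map (algebraMap K L)
          (χ * ∏ j, ((-φ j) ^ (ν j - κ j) * ((ν j).choose (κ j) : MvPowerSeries ι K))) := by
    simp_rw [sub_eq_add_neg, add_pow]
    rw [Finset.prod_univ_sum, Finset.mul_sum]
    refine Finset.sum_congr rfl fun κ _ => ?_
    simp only [map_mul, map_prod, map_pow, map_neg, map_natCast]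
    rw [mul_left_comm, ← Finset.prod_mul_distrib]
    congr 1
    exact Finset.prod_congr rfl fun j _ => by ring
  rw [hexp, map_sum]
  refine Submodule.sum_mem _ fun κ hκ => ?_
  rw [MvPowerSeries.coeff_C_mul, MvPowerSeries.coeff_map, mul_comm, ← Algebra.smul_def]
  refine Submodule.smul_mem _ _ (hW κ fun j => ?_)
  have := Fintype.mem_piFinset.mp hκ j
  rw [Finset.mem_range] at this
  exact (Nat.lt_succ_iff.mp this).trans (hν j)

/-- If the `ω j` are algebraically dependent then there is an auxiliary polynomial `A` of degree
at most `p` in each variable for which `A (X, ω - φ)` vanishes to order `c * p`. -/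
theorem exists_auxiliary_polynomial [Fintype ι] [Fintype J] {K L : Type*} [Field K] [Field L]
    [Algebra K L] {ω : J → L} (h : ¬ AlgebraicIndependent K ω) (φ : J → MvPowerSeries ι K)
    (c : ℕ) : ∃ (p : ℕ) (A : MvPolynomial (ι ⊕ J) K), 1 ≤ p ∧ A ≠ 0 ∧
      (∀ ν ∈ A.support, ∀ x, ν x ≤ p) ∧
      ∀ e : ι →₀ ℕ, e.degree < c * p → MvPowerSeries.coeff e (MvPolynomial.aeval
        (Sum.elim MvPowerSeries.X fun j => algebraMap L (MvPowerSeries ι L) (ω j) -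
          MvPowerSeries.map (algebraMap K L) (φ j)) A) = 0 := by
  classical
  have hJ : Nonempty J := by
    by_contra hJ
    rw [not_nonempty_iff] at hJ
    exact h (algebraicIndependent_empty_type_iff.mpr (algebraMap K L).injective)
  obtain ⟨C, hC⟩ := exists_finrank_span_monomials_le h
  set t := Fintype.card ι
  set m := Fintype.card J
  have hm : 1 ≤ m := Fintype.card_pos
  set M := c ^ t * (C * (m + 1) ^ (m - 1)) with hM
  obtain ⟨W, hWfin, hWrank, hW⟩ := hC (M + 1)
  set p := M + 1
  let Ψ : ι ⊕ J → MvPowerSeries ι L := Sum.elim MvPowerSeries.X fun j =>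
    algebraMap L (MvPowerSeries ι L) (ω j) - MvPowerSeries.map (algebraMap K L) (φ j)
  have hmem : ∀ (ν : ι ⊕ J → Fin (p + 1)) (e : ι →₀ ℕ),
      MvPowerSeries.coeff e (∏ x, Ψ x ^ (ν x : ℕ)) ∈ W := by
    intro ν e
    have := coeff_prod_const_sub_mem hW φ (∏ i, MvPowerSeries.X i ^ (ν (Sum.inl i) : ℕ))
      (ν := fun j => ν (Sum.inr j)) (fun j => Nat.lt_succ_iff.mp (ν (Sum.inr j)).2) e
    rw [Fintype.prod_sum_type]
    simpa [Ψ, MvPowerSeries.algebraMap_apply] using this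
  let T : ((ι ⊕ J → Fin (p + 1)) → K) →ₗ[K] ((ι → Fin (c * p)) → W) :=
    Fintype.linearCombination K fun ν e =>
      ⟨MvPowerSeries.coeff (Finsupp.equivFunOnFinite.symm fun i => (e i : ℕ))
        (∏ x, Ψ x ^ (ν x : ℕ)), hmem ν _⟩
  have hlt : Module.finrank K ((ι → Fin (c * p)) → W) <
      Module.finrank K ((ι ⊕ J → Fin (p + 1)) → K) := by
    rw [Module.finrank_fintype_fun_eq_card, Module.finrank_pi_fintype, Finset.sum_const,
      Finset.card_univ, Fintype.card_fun, Fintype.card_fun, Fintype.card_fin, Fintype.card_fin,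
      Fintype.card_sum, smul_eq_mul]
    calc (c * p) ^ t * Module.finrank K W
        ≤ (c * (p + 1)) ^ t * (C * ((m + 1) * (p + 1)) ^ (m - 1)) := by
          gcongr
          · omega
          · refine hWrank.trans ?_
            gcongr
            change m * p + 1 ≤ _
            nlinarith
      _ = M * (p + 1) ^ (t + (m - 1)) := by rw [hM, mul_pow, mul_pow, pow_add]; ring
      _ < (p + 1) * (p + 1) ^ (t + (m - 1)) := by
          gcongr
          omega
      _ = (p + 1) ^ (t + m) := by
          rw [← pow_succ']
          congr 1
          omega
  obtain ⟨a, ha, ha0⟩ :=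
    (Submodule.ne_bot_iff _).mp (LinearMap.ker_ne_bot_of_finrank_lt hlt (f := T))
  let A : MvPolynomial (ι ⊕ J) K := ∑ ν : ι ⊕ J → Fin (p + 1),
    MvPolynomial.monomial (Finsupp.equivFunOnFinite.symm fun x => (ν x : ℕ)) (a ν)
  have hinj : ∀ ν ν' : ι ⊕ J → Fin (p + 1), (Finsupp.equivFunOnFinite.symm fun x => (ν x : ℕ)) =
      (Finsupp.equivFunOnFinite.symm fun x => (ν' x : ℕ)) → ν = ν' := by
    intro ν ν' hνν
    have := Finsupp.equivFunOnFinite.symm.injective hνν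
    funext x
    exact Fin.ext (congrFun this x)
  refine ⟨p, A, by omega, ?_, ?_, ?_⟩
  · intro hA
    apply ha0
    funext ν
    have := congrArg (MvPolynomial.coeff (Finsupp.equivFunOnFinite.symm fun x => (ν x : ℕ))) hA
    rw [MvPolynomial.coeff_sum, Finset.sum_eq_single ν] at this
    · simpa using this
    · intro ν' _ hν'
      rw [MvPolynomial.coeff_monomial, if_neg fun h => hν' (hinj _ _ h)]
    · simp
  · intro κ hκ x
    obtain ⟨ν, -, hν⟩ := Finset.mem_biUnion.mp (MvPolynomial.support_sum hκ)
    have hκν := Finset.mem_singleton.mp (MvPolynomial.support_monomial_subset hν)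
    rw [hκν]
    exact Nat.lt_succ_iff.mp (ν x).2
  · intro e he
    have hei : ∀ i, e i < c * p := fun i => (Finsupp.le_degree i e).trans_lt he
    have h0 := congrArg Subtype.val (congrFun (LinearMap.mem_ker.mp ha) fun i => ⟨e i, hei i⟩)
    simp only [T, Fintype.linearCombination_apply, Finset.sum_apply, Pi.smul_apply,
      AddSubmonoidClass.coe_finsetSum, Submodule.coe_smul, Pi.zero_apply, Submodule.coe_zero] at h0
    have he' : (Finsupp.equivFunOnFinite.symm fun i => e i) = e := by ext; rfl
    rw [he'] at h0
    rw [← h0]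
    change MvPowerSeries.coeff e (MvPolynomial.aeval Ψ A) = _
    simp only [A, map_sum]
    refine Finset.sum_congr rfl fun ν _ => ?_
    rw [MvPolynomial.aeval_monomial, Finsupp.prod_fintype _ _ (fun _ => pow_zero _),
      ← Algebra.smul_def]
    rfl

end AuxiliaryPolynomial

section Heights

variable {K : Type*} [Field K] [Algebra ℚ K]

/-- The algebraic number `x` has a denominator at most `B` and conjugates of absolute value at
most `B`. -/
def HeightLE (x : K) (B : ℝ) : Prop :=
  ∃ D : ℕ, 0 < D ∧ (D : ℝ) ≤ B ∧ IsIntegral ℤ ((D : K) * x) ∧ ∀ σ : K →ₐ[ℚ] ℂ, ‖σ x‖ ≤ B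

theorem HeightLE.one_le {x : K} {B : ℝ} (h : HeightLE x B) : 1 ≤ B := by
  obtain ⟨D, hD, hDB, -, -⟩ := h
  exact le_trans (by exact_mod_cast hD) hDB

/-- Liouville's inequality. -/
theorem one_le_mul_norm_of_isIntegral [FiniteDimensional ℚ K] {x : K} (hx : x ≠ 0) {D : ℕ}
    (hD : 0 < D) (hint : IsIntegral ℤ ((D : K) * x)) {B : ℝ} (hB1 : 1 ≤ B)
    (hB : ∀ σ : K →ₐ[ℚ] ℂ, ‖σ x‖ ≤ B) (σ₀ : K →ₐ[ℚ] ℂ) :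
    1 ≤ (D * B) ^ Module.finrank ℚ K * ‖σ₀ x‖ := by
  classical
  have : CharZero K := algebraRat.charZero K
  have hy : (D : K) * x ≠ 0 := mul_ne_zero (by exact_mod_cast hD.ne') hx
  have hnorm : ‖(algebraMap ℚ ℂ) (Algebra.norm ℚ ((D : K) * x))‖ =
      ∏ σ : K →ₐ[ℚ] ℂ, (D * ‖σ x‖) := by
    rw [Algebra.norm_eq_prod_embeddings ℚ ℂ, norm_prod]
    simp
  obtain ⟨N, hN⟩ := IsIntegrallyClosed.isIntegral_iff.mp (Algebra.isIntegral_norm ℚ hint)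
  have hN0 : N ≠ 0 := by
    rintro rfl
    rw [map_zero] at hN
    exact hy (Algebra.norm_eq_zero_iff.mp hN.symm)
  have h1 : (1 : ℝ) ≤ ‖(algebraMap ℚ ℂ) (Algebra.norm ℚ ((D : K) * x))‖ := by
    rw [← hN]
    have : (1 : ℝ) ≤ |(N : ℝ)| := by exact_mod_cast Int.one_le_abs hN0
    simpa using this
  have hcard : (Finset.univ.erase σ₀).card + 1 = Module.finrank ℚ K := by
    rw [Finset.card_erase_add_one (Finset.mem_univ _), Finset.card_univ, AlgHom.card]
  have hD1 : (1 : ℝ) ≤ D := by exact_mod_cast hD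
  rw [hnorm, ← Finset.mul_prod_erase _ _ (Finset.mem_univ σ₀)] at h1
  refine h1.trans ?_
  calc (D * ‖σ₀ x‖) * ∏ σ ∈ Finset.univ.erase σ₀, (D * ‖σ x‖)
      ≤ (D * B * ‖σ₀ x‖) * ∏ _σ ∈ Finset.univ.erase σ₀, (D * B) := by
        have h2 : (D : ℝ) ≤ D * B := le_mul_of_one_le_right (by positivity) hB1
        have h3 : ∏ σ ∈ Finset.univ.erase σ₀, (D * ‖σ x‖) ≤
            ∏ _σ ∈ Finset.univ.erase σ₀, (D * B) :=
          Finset.prod_le_prod (fun _ _ => by positivity) fun σ _ => by gcongr; exact hB σ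
        gcongr
    _ = _ := by rw [Finset.prod_const, ← hcard]; ring

/-- A lower bound for the values of a polynomial at algebraic points of bounded height. -/
theorem exists_one_le_mul_norm_aeval [FiniteDimensional ℚ K] {τ : Type*} [Fintype τ]
    (A : MvPolynomial τ K) {p : ℕ} (hA : ∀ ν ∈ A.support, ∀ k, ν k ≤ p) :
    ∃ M : ℝ, 1 ≤ M ∧ ∀ (y : τ → K) (B : τ → ℝ), (∀ k, HeightLE (y k) (B k)) →
      MvPolynomial.aeval y A ≠ 0 → ∀ σ₀ : K →ₐ[ℚ] ℂ,
        1 ≤ (M * (∏ k, B k) ^ (2 * p)) ^ Module.finrank ℚ K *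
          ‖σ₀ (MvPolynomial.aeval y A)‖ := by
  classical
  have : CharZero K := algebraRat.charZero K
  obtain ⟨d, hd0, hd⟩ := exists_integral_multiples ℤ ℚ (A.support.image A.coeff)
  set S := 1 + ∑ σ : K →ₐ[ℚ] ℂ, ∑ ν ∈ A.support, ‖σ (A.coeff ν)‖ with hS
  have hS1 : 1 ≤ S := le_add_of_nonneg_right (by positivity)
  have hd1 : (1 : ℝ) ≤ d.natAbs := by exact_mod_cast Int.natAbs_pos.mpr hd0
  refine ⟨d.natAbs * S, by nlinarith, fun y B hy hne σ₀ => ?_⟩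
  choose D hD hDB hDint hconj using hy
  have hB1 : ∀ k, 1 ≤ B k := fun k => HeightLE.one_le ⟨D k, hD k, hDB k, hDint k, hconj k⟩
  have hval : MvPolynomial.aeval y A = ∑ ν ∈ A.support, A.coeff ν * ∏ k, y k ^ ν k := by
    rw [MvPolynomial.aeval_def, MvPolynomial.eval₂_eq']
    rfl
  have hint : IsIntegral ℤ (((d.natAbs * ∏ k, D k ^ p : ℕ) : K) * MvPolynomial.aeval y A) := by
    rw [hval, Finset.mul_sum]
    refine IsIntegral.sum _ fun ν hν => ?_
    have h1 : IsIntegral ℤ ((d.natAbs : K) * A.coeff ν) := by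
      have h2 := hd _ (Finset.mem_image_of_mem _ hν)
      rw [zsmul_eq_mul] at h2
      rcases Int.natAbs_eq d with h | h
      · rw [h] at h2
        simpa using h2
      · rw [h] at h2
        simpa using h2.neg
    have h2 : ∀ k, IsIntegral ℤ ((D k : K) ^ p * y k ^ ν k) := by
      intro k
      obtain ⟨m, hm⟩ := Nat.exists_eq_add_of_le (hA ν hν k)
      have : (D k : K) ^ p * y k ^ ν k = ((D k : K) * y k) ^ ν k * ((D k ^ m : ℕ) : K) := by
        rw [hm]; push_cast; ring
      rw [this]
      exact ((hDint k).pow _).mul (isIntegral_natCast _)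
    have h3 : IsIntegral ℤ (∏ k, ((D k : K) ^ p * y k ^ ν k)) :=
      IsIntegral.prod _ fun k _ => h2 k
    convert h1.mul h3 using 1
    rw [Finset.prod_mul_distrib]
    push_cast
    ring
  have hbound : ∀ σ : K →ₐ[ℚ] ℂ, ‖σ (MvPolynomial.aeval y A)‖ ≤ S * ∏ k, B k ^ p := by
    intro σ
    rw [hval, map_sum]
    calc _ ≤ ∑ ν ∈ A.support, ‖σ (A.coeff ν)‖ * ∏ k, B k ^ p := by
          refine norm_sum_le_of_le _ fun ν hν => ?_
          rw [map_mul, norm_mul, map_prod, norm_prod]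
          refine mul_le_mul_of_nonneg_left ?_ (norm_nonneg _)
          refine Finset.prod_le_prod (fun _ _ => norm_nonneg _) fun k _ => ?_
          rw [map_pow, norm_pow]
          calc ‖σ (y k)‖ ^ ν k ≤ B k ^ ν k := by gcongr; exact hconj k σ
            _ ≤ B k ^ p := pow_le_pow_right₀ (hB1 k) (hA ν hν k)
      _ ≤ _ := by
          rw [← Finset.sum_mul]
          refine mul_le_mul_of_nonneg_right ?_
            (Finset.prod_nonneg fun k _ => pow_nonneg (zero_le_one.trans (hB1 k)) _)
          refine le_trans ?_ (le_add_of_nonneg_left zero_le_one)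
          exact Finset.single_le_sum
            (f := fun σ : K →ₐ[ℚ] ℂ => ∑ ν ∈ A.support, ‖σ (A.coeff ν)‖)
            (fun _ _ => by positivity) (Finset.mem_univ σ)
  have hprod1 : 1 ≤ ∏ k, B k ^ p := by
    rw [Finset.prod_pow]
    exact one_le_pow₀ (Finset.one_le_prod fun k _ => hB1 k)
  have hmain := one_le_mul_norm_of_isIntegral hne
    (Nat.mul_pos (Int.natAbs_pos.mpr hd0) (Finset.prod_pos fun k _ => pow_pos (hD k) _)) hint
    (one_le_mul_of_one_le_of_one_le hS1 hprod1) hbound σ₀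
  refine hmain.trans ?_
  refine mul_le_mul_of_nonneg_right (pow_le_pow_left₀ (by positivity) ?_ _) (norm_nonneg _)
  rw [mul_comm 2 p, pow_mul, ← Finset.prod_pow, sq]
  push_cast
  have : ∏ k, (D k : ℝ) ^ p ≤ ∏ k, B k ^ p :=
    Finset.prod_le_prod (fun _ _ => by positivity) fun k _ => by gcongr; exact hDB k
  have h0 : 0 ≤ ∏ k, B k ^ p := zero_le_one.trans hprod1
  calc (d.natAbs : ℝ) * (∏ k, (D k : ℝ) ^ p) * (S * ∏ k, B k ^ p)
      ≤ (d.natAbs : ℝ) * (∏ k, B k ^ p) * (S * ∏ k, B k ^ p) :=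
        mul_le_mul_of_nonneg_right (mul_le_mul_of_nonneg_left this (Nat.cast_nonneg _))
          (mul_nonneg (zero_le_one.trans hS1) h0)
    _ = _ := by ring

end Heights

section Mahler

open Filter Topology Asymptotics

variable {ι J : Type*}

theorem PowerSeries.map_toMv {R S : Type*} [CommRing R] [CommRing S] (φ : R →+* S) (i : ι)
    (f : PowerSeries R) : MvPowerSeries.map φ (f.toMv i) = (PowerSeries.map φ f).toMv i := by
  classical
  ext e
  simp only [MvPowerSeries.coeff_map, PowerSeries.coeff_toMv, PowerSeries.coeff_map]
  split_ifs <;> simp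

theorem HeightLE.mono {K : Type*} [Field K] [Algebra ℚ K] {x : K} {B B' : ℝ} (h : HeightLE x B)
    (hB : B ≤ B') : HeightLE x B' := by
  obtain ⟨D, hD, hDB, hint, hconj⟩ := h
  exact ⟨D, hD, hDB.trans hB, hint, fun σ => (hconj σ).trans hB⟩

theorem IsIntegral.exists_heightLE_pow {K : Type*} [Field K] [Algebra ℚ K]
    [FiniteDimensional ℚ K] {x : K} (hx : IsIntegral ℤ x) :
    ∃ c : ℝ, 0 ≤ c ∧ ∀ n : ℕ, HeightLE (x ^ n) (Real.exp (c * n)) := by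
  set H : ℝ := 1 + ∑ σ : K →ₐ[ℚ] ℂ, ‖σ x‖ with hH
  have hH1 : 1 ≤ H := le_add_of_nonneg_right (by positivity)
  refine ⟨Real.log H, Real.log_nonneg hH1, fun n => ?_⟩
  have hexp : Real.exp (Real.log H * n) = H ^ n := by
    rw [mul_comm, Real.exp_nat_mul, Real.exp_log (zero_lt_one.trans_le hH1)]
  rw [hexp]
  refine ⟨1, one_pos, by simpa using one_le_pow₀ hH1, by simpa using hx.pow n, fun σ => ?_⟩
  rw [map_pow, norm_pow]
  gcongr
  refine le_trans ?_ (le_add_of_nonneg_left zero_le_one)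
  exact Finset.single_le_sum (f := fun σ : K →ₐ[ℚ] ℂ => ‖σ x‖)
    (fun _ _ => norm_nonneg _) (Finset.mem_univ σ)

/-- Mahler's method for several pairwise multiplicatively independent bases. -/
theorem algebraicIndependent_of_hasAsymp [Fintype ι] [Nonempty ι] [Fintype J] {q : ι → ℕ}
    (hq : ∀ i, 2 ≤ q i) (hind : ∀ i j, i ≠ j → ∀ a b, 0 < a → 0 < b → q i ^ a ≠ q j ^ b)
    {α : ℝ} (hα0 : 0 < α) (hα1 : α < 1) {K : Type*} [Field K] [Algebra ℚ K]
    [FiniteDimensional ℚ K] [Algebra K ℂ] {αK : K} (hαK : algebraMap K ℂ αK = α)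
    (hint : IsIntegral ℤ αK) (π : J → ι) (f : J → PowerSeries K)
    (F : J → ℂ → ℂ) (hF : ∀ j, HasAsymp (F j) (PowerSeries.map (algebraMap K ℂ) (f j)))
    (hf : ∀ i, AlgebraicIndependent ℂ (Sum.elim (fun _ : Unit => PowerSeries.X)
      (fun j : {j // π j = i} => PowerSeries.map (algebraMap K ℂ) (f j)) :
        Unit ⊕ {j // π j = i} → PowerSeries ℂ))
    (ω : J → ℂ) (w : J → ℕ → K)
    (hw : ∀ j, ∀ᶠ n in atTop, ω j = algebraMap K ℂ (w j n) + F j ((α : ℂ) ^ q (π j) ^ n))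
    (hheight : ∀ j, ∃ c : ℝ, ∀ᶠ n in atTop,
      HeightLE (w j n) (Real.exp (c * (q (π j) : ℝ) ^ n))) :
    AlgebraicIndependent K ω := by
  classical
  by_contra hdep
  obtain ⟨C, hC1, hC⟩ := HasMvAsymp.exists_ne_zero hq hind hα0 hα1
  choose c hc using hheight
  obtain ⟨h₀, hh₀, hαH⟩ := hint.exists_heightLE_pow
  set c₀ := ∑ j, |c j| with hc₀
  have hc₀' : 0 ≤ c₀ := by positivity
  set c₁ := Fintype.card ι * h₀ + Fintype.card J * c₀ with hc₁
  have hc₁' : 0 ≤ c₁ := by positivity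
  set σ₀ : K →ₐ[ℚ] ℂ := (algebraMap K ℂ).toRatAlgHom
  set d := Module.finrank ℚ K with hd
  set lam := -Real.log α with hlam
  have hlam0 : 0 < lam := neg_pos.mpr (Real.log_neg hα0 hα1)
  have hαexp : α = Real.exp (-lam) := by rw [hlam, neg_neg, Real.exp_log hα0]
  obtain ⟨s, hs⟩ := exists_nat_ge (C * (2 * d * c₁ + 1) / lam)
  obtain ⟨p, A, hp, hA0, hAp, hAord⟩ :=
    exists_auxiliary_polynomial hdep (fun j => (f j).toMv (π j)) s
  set fc : J → PowerSeries ℂ := fun j => PowerSeries.map (algebraMap K ℂ) (f j) with hfc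
  set A' := MvPolynomial.map (algebraMap K ℂ) A with hA'
  set Ψ : ι ⊕ J → MvPowerSeries ι ℂ := Sum.elim MvPowerSeries.X fun j =>
    algebraMap ℂ (MvPowerSeries ι ℂ) (ω j) - (fc j).toMv (π j) with hΨ
  have hA'0 : A' ≠ 0 := by
    exact (map_ne_zero_iff _ (MvPolynomial.map_injective _ (algebraMap K ℂ).injective)).mpr hA0
  have hΦ0 : MvPolynomial.aeval Ψ A' ≠ 0 := fun h0 =>
    hA'0 (((algebraicIndependent_toMv π fc hf).const_sub ω).eq_zero_of_aeval_eq_zero A' h0)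
  have hΦord : ∀ e : ι →₀ ℕ, e.degree < s * p →
      MvPowerSeries.coeff e (MvPolynomial.aeval Ψ A') = 0 := by
    intro e he
    rw [hA', MvPolynomial.aeval_map_algebraMap]
    simpa only [PowerSeries.map_toMv] using hAord e he
  set v : (ι → ℂ) → ι ⊕ J → ℂ := fun z =>
    Sum.elim z fun j => ω j + (-1) * F j (z (π j)) with hv
  have hg : HasMvAsymp (fun z => A'.eval fun x => v z x) (MvPolynomial.aeval Ψ A') := by
    refine HasMvAsymp.aeval (g := fun x z => v z x) (fun x => ?_) A'
    rcases x with i | j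
    · exact HasMvAsymp.coord i
    · have h1 := (HasMvAsymp.const (ι := ι) (ω j)).add
        ((HasMvAsymp.const (ι := ι) (-1)).mul ((hF j).toMv (π j)))
      rw [map_neg, map_one, neg_one_mul, ← sub_eq_add_neg] at h1
      exact h1
  obtain ⟨K', hK'⟩ := (hg.isBigO_of_coeff_eq_zero hΦord).bound
  obtain ⟨ε, hε, hball⟩ := Metric.eventually_nhds_iff.mp hK'
  obtain ⟨M, hM1, hM⟩ := exists_one_le_mul_norm_aeval A hAp
  have hev : ∀ᶠ n in atTop, ∀ j, ω j = algebraMap K ℂ (w j n) + F j ((α : ℂ) ^ q (π j) ^ n) ∧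
      HeightLE (w j n) (Real.exp (c j * (q (π j) : ℝ) ^ n)) :=
    eventually_all.mpr fun j => (hw j).and (hc j)
  obtain ⟨N₀, hN₀⟩ := eventually_atTop.mp hev
  have hlim1 : Tendsto (fun T : ℝ => α ^ (T / C)) atTop (𝓝 0) :=
    (tendsto_rpow_atTop_of_base_lt_one α (by linarith) hα1).comp
      (tendsto_id.atTop_div_const (by linarith))
  have hlim2 : Tendsto (fun T : ℝ => M ^ d * |K'| * Real.exp (-T)) atTop (𝓝 0) := by
    simpa using (Real.tendsto_exp_neg_atTop_nhds_zero).const_mul (M ^ d * |K'|)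
  obtain ⟨T₀, hT₀⟩ := eventually_atTop.mp
    ((hlim1.eventually (gt_mem_nhds hε)).and (hlim2.eventually (gt_mem_nhds one_pos)))
  obtain ⟨B, hB⟩ := exists_nat_ge (max T₀ N₀)
  obtain ⟨n, T, hBT, hBn, hqT, hne⟩ := hC _ _ hΦ0 hg B
  have hTT : T₀ ≤ T := (le_max_left _ _).trans (hB.trans hBT)
  have hT0 : 0 ≤ T := (Nat.cast_nonneg B).trans hBT
  have hnN : ∀ i, N₀ ≤ n i := fun i => by
    have : (N₀ : ℝ) ≤ B := (le_max_right _ _).trans hB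
    exact (Nat.cast_le.mp this).trans (hBn i)
  obtain ⟨hT1, hT2⟩ := hT₀ T hTT
  set z : ι → ℂ := fun i => (α : ℂ) ^ q i ^ n i with hz
  have hznorm : ‖z‖ ≤ α ^ (T / C) := by
    refine norm_pow_coords_le hα0 hα1 fun i => ?_
    rw [div_le_iff₀ (by linarith), mul_comm]
    exact_mod_cast (hqT i).2
  set y : ι ⊕ J → K := Sum.elim (fun i => αK ^ q i ^ n i) (fun j => w j (n (π j))) with hy
  have hvy : ∀ x, v z x = algebraMap K ℂ (y x) := by
    rintro (i | j)
    · simp [hv, hy, hz, ← hαK]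
    · simp only [hv, hy, hz, Sum.elim_inr]
      rw [((hN₀ _ (hnN (π j))) j).1]
      simp
  have hgy : (A'.eval fun x => v z x) = σ₀ (MvPolynomial.aeval y A) := by
    rw [hA', MvPolynomial.eval_map]
    simp only [hvy]
    exact (MvPolynomial.map_aeval y (algebraMap K ℂ) A).symm
  have hupper : ‖σ₀ (MvPolynomial.aeval y A)‖ ≤ |K'| * Real.exp (-(2 * d * c₁ + 1) * p * T) := by
    rw [← hgy]
    have hz1 : dist z 0 < ε := by rw [dist_zero_right]; exact hznorm.trans_lt hT1
    refine (hball hz1).trans ?_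
    rw [norm_pow, norm_norm]
    refine mul_le_mul (le_abs_self _) ?_ (by positivity) (abs_nonneg _)
    calc ‖z‖ ^ (s * p) ≤ (α ^ (T / C)) ^ (s * p) := by gcongr
      _ = Real.exp (-(lam * s / C) * p * T) := by
        rw [hαexp, ← Real.exp_mul, ← Real.exp_nat_mul]
        congr 1
        push_cast
        ring
      _ ≤ _ := by
        rw [Real.exp_le_exp]
        have h1 : 2 * d * c₁ + 1 ≤ lam * s / C := by
          rw [le_div_iff₀ (by linarith)]
          rw [div_le_iff₀ hlam0] at hs
          linarith
        have h2 : 0 ≤ (p : ℝ) * T := by positivity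
        nlinarith
  set Bd : ι ⊕ J → ℝ := Sum.elim (fun _ => Real.exp (h₀ * T)) (fun _ => Real.exp (c₀ * T)) with hBd
  have hyB : ∀ x, HeightLE (y x) (Bd x) := by
    rintro (i | j)
    · refine (hαH (q i ^ n i)).mono (Real.exp_le_exp.mpr ?_)
      have := (hqT i).1
      push_cast
      gcongr
    · refine ((hN₀ _ (hnN (π j))) j).2.mono (Real.exp_le_exp.mpr ?_)
      have h1 := (hqT (π j)).1
      have h2 : c j ≤ c₀ := (le_abs_self _).trans
        (Finset.single_le_sum (f := fun j => |c j|) (fun _ _ => abs_nonneg _) (Finset.mem_univ j))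
      calc c j * (q (π j) : ℝ) ^ n (π j) ≤ c₀ * (q (π j) : ℝ) ^ n (π j) := by gcongr
        _ ≤ _ := by gcongr
  have hBprod : ∏ x, Bd x = Real.exp (c₁ * T) := by
    rw [Fintype.prod_sum_type]
    simp only [hBd, Sum.elim_inl, Sum.elim_inr, Finset.prod_const, Finset.card_univ,
      ← Real.exp_nat_mul, ← Real.exp_add]
    congr 1
    ring
  have hne' : MvPolynomial.aeval y A ≠ 0 := fun h0 => hne (by rw [hgy, h0, map_zero])
  have hlower := hM y Bd hyB hne' σ₀
  rw [hBprod] at hlower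
  have : (M * Real.exp (c₁ * T) ^ (2 * p)) ^ d * ‖σ₀ (MvPolynomial.aeval y A)‖ ≤
      M ^ d * |K'| * Real.exp (-T) := by
    calc _ ≤ (M * Real.exp (c₁ * T) ^ (2 * p)) ^ d *
          (|K'| * Real.exp (-(2 * d * c₁ + 1) * p * T)) := by gcongr
      _ = M ^ d * |K'| * Real.exp (-(p * T)) := by
        rw [mul_pow, ← Real.exp_nat_mul, ← Real.exp_nat_mul, mul_mul_mul_comm, ← Real.exp_add]
        congr 2
        push_cast
        ring
      _ ≤ _ := by
        gcongr
        have : (1 : ℝ) ≤ p := by exact_mod_cast hp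
        nlinarith
  exact (hlower.trans this).not_gt hT2

end Mahler

section Ostrowski

open MvPolynomial

variable {k L J : Type*} [Field k] [Field L] [Algebra k L]

/-- The ring endomorphism acting as `τ` on the coefficients and sending `X j` to `X j + b j`. -/
def MvPolynomial.twistedShift (τ : k →+* k) (b : J → k) :
    MvPolynomial J k →+* MvPolynomial J k :=
  eval₂Hom (C.comp τ) fun j => X j + C (b j)

theorem MvPolynomial.aeval_twistedShift {τ : k →+* k} {τ' : L →+* L}
    (hτ : ∀ a, τ' (algebraMap k L a) = algebraMap k L (τ a)) {f : J → L} {b : J → k}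
    (hb : ∀ j, τ' (f j) = f j + algebraMap k L (b j)) (P : MvPolynomial J k) :
    aeval f (twistedShift τ b P) = τ' (aeval f P) := by
  induction P using MvPolynomial.induction_on with
  | C a => simp [twistedShift, hτ]
  | add p q hp hq => simp [hp, hq]
  | mul_X p j hp =>
    have hX : twistedShift τ b (X j) = X j + C (b j) := by simp [twistedShift]
    simp [hp, hb, hX]

theorem MvPolynomial.pderiv_twistedShift (τ : k →+* k) (b : J → k) (i : J)
    (P : MvPolynomial J k) :
    pderiv i (twistedShift τ b P) = twistedShift τ b (pderiv i P) := by
  classical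
  induction P using MvPolynomial.induction_on with
  | C a => simp [twistedShift]
  | add p q hp hq => simp [hp, hq]
  | mul_X p j hp =>
    have hX : twistedShift τ b (X j) = X j + C (b j) := by simp [twistedShift]
    rw [map_mul, pderiv_mul, pderiv_mul, hp, map_add, map_mul, map_mul, hX, map_add, pderiv_C,
      add_zero, pderiv_X]
    by_cases hij : j = i
    · subst hij; simp
    · simp [hij]

theorem MvPolynomial.coeff_twistedShift [Fintype J] (m : MonomialOrder J) (τ : k →+* k) (b : J → k)
    (P : MvPolynomial J k) {e : J →₀ ℕ} (he : m.toSyn (m.degree P) ≤ m.toSyn e) :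
    coeff e (twistedShift τ b P) = τ (coeff e P) := by
  classical
  have hmonic : ∀ μ : J →₀ ℕ, m.Monic (∏ j, (X j + C (b j)) ^ μ j : MvPolynomial J k) :=
    fun μ => MonomialOrder.Monic.prod fun j _ => (m.monic_X_add_C j (b j)).pow
  have hdeg : ∀ μ : J →₀ ℕ, m.degree (∏ j, (X j + C (b j)) ^ μ j : MvPolynomial J k) = μ := by
    intro μ
    rw [m.degree_prod fun j _ => pow_ne_zero _ (m.monic_X_add_C j (b j)).ne_zero]
    simp_rw [m.degree_pow, m.degree_X_add_C]
    ext j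
    simp
  have hT : twistedShift τ b P =
      ∑ μ ∈ P.support, C (τ (coeff μ P)) * ∏ j, (X j + C (b j)) ^ μ j := by
    rw [twistedShift, coe_eval₂Hom, eval₂_eq']
    rfl
  rw [hT, coeff_sum]
  simp_rw [coeff_C_mul]
  have hcoeff : ∀ μ ∈ P.support, coeff e (∏ j, (X j + C (b j)) ^ μ j : MvPolynomial J k) =
      if e = μ then 1 else 0 := by
    intro μ hμ
    split_ifs with h
    · rw [h]
      nth_rewrite 1 [← hdeg μ]
      exact (hmonic μ).coeff_degree
    · refine m.coeff_eq_zero_of_lt ?_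
      rw [hdeg]
      exact lt_of_le_of_ne ((m.le_degree hμ).trans he)
        fun h' => h (m.toSyn.injective h'.symm)
  rw [Finset.sum_congr rfl fun μ hμ => by rw [hcoeff μ hμ]]
  simp only [mul_ite, mul_one, mul_zero]
  rw [Finset.sum_ite_eq]
  split_ifs with h
  · rfl
  · rw [notMem_support_iff.mp h, map_zero]

theorem MvPolynomial.eq_C_of_pderiv_eq_zero [CharZero k] {P : MvPolynomial J k}
    (h : ∀ i, pderiv i P = 0) : P = C (coeff 0 P) := by
  classical
  ext e
  rw [coeff_C]
  split_ifs with he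
  · rw [he]
  · obtain ⟨i, hi⟩ := Finsupp.ne_iff.mp (Ne.symm he)
    have hi' : 1 ≤ e i := Nat.one_le_iff_ne_zero.mpr hi
    have h1 := coeff_pderiv (i := i) P (e - Finsupp.single i 1)
    have h2 : e - Finsupp.single i 1 + Finsupp.single i 1 = e :=
      tsub_add_cancel_of_le (Finsupp.single_le_iff.mpr hi')
    rw [h i, coeff_zero, h2] at h1
    rcases mul_eq_zero.mp h1.symm with h3 | h3
    · exact h3
    · exact absurd h3 (Nat.cast_add_one_ne_zero _)

theorem MvPolynomial.totalDegree_pderiv_lt {P : MvPolynomial J k} {i : J}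
    (h : 0 < P.totalDegree) : (pderiv i P).totalDegree < P.totalDegree := by
  classical
  refine (Finset.sup_lt_iff h).mpr fun e he => ?_
  have h1 : coeff (e + Finsupp.single i 1) P ≠ 0 := by
    intro h0
    rw [mem_support_iff, coeff_pderiv, h0, zero_mul] at he
    exact he rfl
  have h2 := le_totalDegree (mem_support_iff.mpr h1)
  rw [Finsupp.sum_add_index' (fun _ => rfl) (fun _ _ _ => rfl),
    Finsupp.sum_single_index rfl] at h2
  omega

/-- Ostrowski's argument: algebraically dependent solutions of the equations `τ f = f + b` satisfy
an invariant linear relation. -/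
theorem exists_invariant_linear_form [Fintype J] [CharZero k] {τ : k →+* k} {τ' : L →+* L}
    (hτ : ∀ a, τ' (algebraMap k L a) = algebraMap k L (τ a)) {f : J → L} {b : J → k}
    (hb : ∀ j, τ' (f j) = f j + algebraMap k L (b j)) (hdep : ¬ AlgebraicIndependent k f) :
    ∃ c : J → k, c ≠ 0 ∧ (∀ j, τ (c j) = c j) ∧ ∃ e : k,
      τ' (algebraMap k L e + ∑ j, algebraMap k L (c j) * f j) =
        algebraMap k L e + ∑ j, algebraMap k L (c j) * f j := by
  classical
  let _ : LinearOrder J := LinearOrder.lift' (Fintype.equivFin J) (Fintype.equivFin J).injective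
  let m : MonomialOrder J := MonomialOrder.degLex
  have hinv : ∃ Q : MvPolynomial J k, twistedShift τ b Q = Q ∧ 0 < Q.totalDegree := by
    have hex : ∃ P : MvPolynomial J k, aeval f P = 0 ∧ P ≠ 0 := by
      rw [algebraicIndependent_iff] at hdep
      push Not at hdep
      exact hdep
    obtain ⟨P, ⟨hP0, hPne⟩, hmin⟩ := WellFounded.has_min
      (InvImage.wf (fun P : MvPolynomial J k => m.toSyn (m.degree P)) wellFounded_lt)
      {P : MvPolynomial J k | aeval f P = 0 ∧ P ≠ 0} hex
    have hlc := m.leadingCoeff_ne_zero_iff.mpr hPne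
    set Q := C (m.leadingCoeff P)⁻¹ * P with hQ
    have hQcoeff : ∀ e, coeff e Q = (m.leadingCoeff P)⁻¹ * coeff e P := fun e => coeff_C_mul _ _ _
    have hQne : Q ≠ 0 := mul_ne_zero (by simpa using hlc) hPne
    have hQdeg : m.toSyn (m.degree Q) ≤ m.toSyn (m.degree P) := by
      refine m.degree_le_iff.mpr fun e he => m.le_degree ?_
      rw [mem_support_iff, hQcoeff] at he
      exact mem_support_iff.mpr (right_ne_zero_of_mul he)
    have hQ0 : aeval f Q = 0 := by rw [hQ, map_mul, hP0, mul_zero]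
    refine ⟨Q, ?_, ?_⟩
    · by_contra hne
      set R := twistedShift τ b Q - Q with hR
      have hRne : R ≠ 0 := sub_ne_zero.mpr hne
      have hR0 : aeval f R = 0 := by
        rw [hR, map_sub, aeval_twistedShift hτ hb, hQ0, map_zero, sub_zero]
      have hle : m.toSyn (m.degree P) ≤ m.toSyn (m.degree R) := not_lt.mp (hmin R ⟨hR0, hRne⟩)
      have h1 : coeff (m.degree R) R ≠ 0 := m.coeff_degree_ne_zero_iff.mpr hRne
      apply h1
      nth_rewrite 2 [hR]
      rw [coeff_sub, coeff_twistedShift m τ b Q (hQdeg.trans hle), hQcoeff]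
      rcases hle.eq_or_lt with h | h
      · rw [← m.toSyn.injective h, ← MonomialOrder.leadingCoeff, inv_mul_cancel₀ hlc, map_one,
          sub_self]
      · rw [m.coeff_eq_zero_of_lt h, mul_zero, map_zero, sub_self]
    · by_contra h
      have h1 := totalDegree_eq_zero_iff_eq_C.mp (Nat.eq_zero_of_not_pos h)
      rw [h1, aeval_C] at hQ0
      rw [(algebraMap k L).injective (hQ0.trans (map_zero _).symm), C_0] at h1
      exact hQne h1
  obtain ⟨Q, ⟨hQT, hQdeg⟩, hmin⟩ := WellFounded.has_min
    (InvImage.wf (fun P : MvPolynomial J k => P.totalDegree) wellFounded_lt)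
    {Q : MvPolynomial J k | twistedShift τ b Q = Q ∧ 0 < Q.totalDegree} hinv
  have hderiv : ∀ i, ∃ c, pderiv i Q = C c ∧ τ c = c := by
    intro i
    have h1 : twistedShift τ b (pderiv i Q) = pderiv i Q := by rw [← pderiv_twistedShift, hQT]
    have h2 : (pderiv i Q).totalDegree = 0 := by
      by_contra h
      exact hmin _ ⟨h1, Nat.pos_of_ne_zero h⟩ (totalDegree_pderiv_lt hQdeg)
    have h3 := totalDegree_eq_zero_iff_eq_C.mp h2
    refine ⟨_, h3, ?_⟩
    rw [h3] at h1
    refine C_injective J k ?_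
    simpa [twistedShift] using h1
  choose c hc hcτ using hderiv
  have hlin : Q - ∑ j, C (c j) * X j = C (coeff 0 (Q - ∑ j, C (c j) * X j)) := by
    refine eq_C_of_pderiv_eq_zero fun i => ?_
    rw [map_sub, map_sum, hc, Finset.sum_congr rfl fun j _ => by rw [pderiv_C_mul, pderiv_X]]
    simp [Pi.single_apply]
  set e := coeff 0 (Q - ∑ j, C (c j) * X j)
  refine ⟨c, ?_, hcτ, e, ?_⟩
  · rintro rfl
    rw [eq_C_of_pderiv_eq_zero (P := Q) fun i => by rw [hc]; simp, totalDegree_C] at hQdeg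
    exact lt_irrefl _ hQdeg
  · have hval : aeval f Q = algebraMap k L e + ∑ j, algebraMap k L (c j) * f j := by
      rw [sub_eq_iff_eq_add.mp hlin]
      simp
    rw [← hval, ← aeval_twistedShift hτ hb, hQT]

end Ostrowski

section Rational

open Polynomial
open scoped RatFunc

/-- The power series `g` is the expansion of a rational function. -/
def PowerSeries.IsRat (g : PowerSeries ℂ) : Prop :=
  ∃ a b : ℂ[X], b ≠ 0 ∧ (b : PowerSeries ℂ) * g = a

/-- Substitution of `X ^ q` for `X` in Laurent series. -/
def LaurentSeries.expandHom (q : ℕ) (hq : q ≠ 0) :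
    LaurentSeries ℂ →+* LaurentSeries ℂ :=
  HahnSeries.embDomainRingHom (AddMonoidHom.mulLeft (q : ℤ))
    (fun a b h => by simpa [hq] using h) fun a b => by
      simpa using mul_le_mul_iff_right₀ (by exact_mod_cast Nat.pos_of_ne_zero hq)

theorem LaurentSeries.coeff_expandHom_mul (q : ℕ) (hq : q ≠ 0) (f : LaurentSeries ℂ) (n : ℤ) :
    (LaurentSeries.expandHom q hq f).coeff (q * n) = f.coeff n :=
  HahnSeries.embDomain_coeff

theorem LaurentSeries.coeff_expandHom_of_not_dvd (q : ℕ) (hq : q ≠ 0) (f : LaurentSeries ℂ)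
    {n : ℤ} (hn : ¬ (q : ℤ) ∣ n) : (LaurentSeries.expandHom q hq f).coeff n = 0 :=
  HahnSeries.embDomain_of_notMem_range fun ⟨m, hm⟩ => hn ⟨m, hm.symm⟩

theorem LaurentSeries.eq_C_of_expandHom_eq {q : ℕ} (hq : 2 ≤ q) {f : LaurentSeries ℂ}
    (h : LaurentSeries.expandHom q (by omega) f = f) : f = HahnSeries.C (f.coeff 0) := by
  have key : ∀ N : ℕ, ∀ n : ℤ, n.natAbs = N → n ≠ 0 → f.coeff n = 0 := by
    intro N
    induction N using Nat.strong_induction_on with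
    | _ N ih =>
      intro n hn hn0
      rw [← h]
      by_cases hd : (q : ℤ) ∣ n
      · obtain ⟨m, rfl⟩ := hd
        rw [LaurentSeries.coeff_expandHom_mul]
        have hm0 : m ≠ 0 := right_ne_zero_of_mul hn0
        refine ih m.natAbs ?_ m rfl hm0
        rw [← hn, Int.natAbs_mul, Int.natAbs_natCast]
        have : 0 < m.natAbs := Int.natAbs_pos.mpr hm0
        nlinarith
      · exact LaurentSeries.coeff_expandHom_of_not_dvd q _ f hd
  ext n
  rw [HahnSeries.C_apply]
  by_cases hn : n = 0
  · rw [hn, HahnSeries.coeff_single_same]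
  · rw [HahnSeries.coeff_single_of_ne hn, key _ n rfl hn]

theorem LaurentSeries.expandHom_ofPowerSeries (q : ℕ) (hq : q ≠ 0) (f : PowerSeries ℂ) :
    LaurentSeries.expandHom q hq (HahnSeries.ofPowerSeries ℤ ℂ f) =
      HahnSeries.ofPowerSeries ℤ ℂ (PowerSeries.expand q hq f) := by
  have hneg : ∀ (g : PowerSeries ℂ) (n : ℤ), n < 0 →
      (HahnSeries.ofPowerSeries ℤ ℂ g).coeff n = 0 := fun g n hn => by
    rw [HahnSeries.ofPowerSeries_apply]
    refine HahnSeries.embDomain_of_notMem_range ?_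
    rintro ⟨m, hm⟩
    have : (m : ℤ) = n := hm
    omega
  ext n
  by_cases hd : (q : ℤ) ∣ n
  · obtain ⟨m, rfl⟩ := hd
    rw [LaurentSeries.coeff_expandHom_mul]
    rcases lt_or_ge m 0 with hm | hm
    · rw [hneg _ _ hm, hneg _ _ (mul_neg_of_pos_of_neg (by positivity) hm)]
    · lift m to ℕ using hm
      rw [← Nat.cast_mul]
      simp only [HahnSeries.ofPowerSeries_apply_coeff, PowerSeries.coeff_expand_mul]
  · rw [LaurentSeries.coeff_expandHom_of_not_dvd _ _ _ hd]
    rcases lt_or_ge n 0 with hn | hn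
    · rw [hneg _ _ hn]
    · lift n to ℕ using hn
      rw [HahnSeries.ofPowerSeries_apply_coeff, PowerSeries.coeff_expand_of_not_dvd]
      exact fun h' => hd (Int.natCast_dvd_natCast.mpr h')

theorem PowerSeries.expand_coe (q : ℕ) (hq : q ≠ 0) (a : ℂ[X]) :
    PowerSeries.expand q hq (a : PowerSeries ℂ) = (Polynomial.expand ℂ q a : ℂ[X]) := by
  ext n
  rw [PowerSeries.coeff_expand, Polynomial.coeff_coe, Polynomial.coeff_coe,
    Polynomial.coeff_expand (by omega)]

/-- A family of power series satisfying inhomogeneous equations with rational right-hand sides is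
algebraically independent over the rational functions as soon as no nontrivial linear combination
with constant coefficients is rational. -/
theorem PowerSeries.algebraicIndependent_of_isRat {J : Type*} [Fintype J] {q : ℕ} (hq : 2 ≤ q)
    (f : J → PowerSeries ℂ)
    (hf : ∀ j, (f j - PowerSeries.expand q (by omega) (f j)).IsRat)
    (h : ∀ c : J → ℂ, (∑ j, c j • f j).IsRat → c = 0) :
    AlgebraicIndependent ℂ (Sum.elim (fun _ : Unit => (PowerSeries.X : PowerSeries ℂ)) f) := by
  classical
  have hq0 : q ≠ 0 := by omega
  set τ' := LaurentSeries.expandHom q hq0 with hτ'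
  have hexpinj : Function.Injective (Polynomial.expand ℂ q) :=
    Polynomial.expand_injective (by omega)
  set τ : RatFunc ℂ →+* RatFunc ℂ := RatFunc.mapRingHom (Polynomial.expand ℂ q)
    (nonZeroDivisors_le_comap_nonZeroDivisors_of_injective _ hexpinj) with hτdef
  have hpoly : ∀ a : ℂ[X], algebraMap (RatFunc ℂ) (LaurentSeries ℂ) (algebraMap ℂ[X] _ a) =
      HahnSeries.ofPowerSeries ℤ ℂ (a : PowerSeries ℂ) := fun a => (RatFunc.coe_coe a).symm
  have hτ : ∀ a, τ' (algebraMap (RatFunc ℂ) (LaurentSeries ℂ) a) = algebraMap _ _ (τ a) := by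
    intro a
    induction a using RatFunc.induction_on with
    | _ a b hb =>
      rw [map_div₀, map_div₀, map_div₀, map_div₀, hpoly, hpoly, hτ',
        LaurentSeries.expandHom_ofPowerSeries, LaurentSeries.expandHom_ofPowerSeries]
      have h1 : ∀ p : ℂ[X], τ (algebraMap ℂ[X] (RatFunc ℂ) p) =
          algebraMap ℂ[X] (RatFunc ℂ) (Polynomial.expand ℂ q p) := fun p => by
        rw [hτdef, RatFunc.coe_mapRingHom_eq_coe_map, RatFunc.map_apply]
        simp
      rw [h1, h1, hpoly, hpoly, PowerSeries.expand_coe, PowerSeries.expand_coe]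
  have hofinj : Function.Injective (HahnSeries.ofPowerSeries ℤ ℂ) :=
    HahnSeries.ofPowerSeries_injective
  set F : J → LaurentSeries ℂ := fun j => HahnSeries.ofPowerSeries ℤ ℂ (f j) with hF
  choose a b hb0 hab using hf
  have hbF : ∀ j, τ' (F j) = F j + algebraMap (RatFunc ℂ) (LaurentSeries ℂ)
      (-(algebraMap ℂ[X] _ (a j) / algebraMap ℂ[X] _ (b j))) := by
    intro j
    have h1 := congrArg (HahnSeries.ofPowerSeries ℤ ℂ) (hab j)
    rw [map_mul, map_sub, ← LaurentSeries.expandHom_ofPowerSeries] at h1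
    have h2 : HahnSeries.ofPowerSeries ℤ ℂ (b j : PowerSeries ℂ) ≠ 0 := by
      rw [Ne, map_eq_zero_iff _ hofinj, Polynomial.coe_eq_zero_iff]
      exact hb0 j
    rw [map_neg, map_div₀, hpoly, hpoly, ← h1]
    field_simp
    simp only [hF, hτ']
    ring
  have hindep : AlgebraicIndependent (RatFunc ℂ) F := by
    by_contra hdep
    obtain ⟨c, hc0, hc, e, he⟩ := exists_invariant_linear_form hτ hbF hdep
    have hcc : ∀ j, algebraMap (RatFunc ℂ) (LaurentSeries ℂ) (c j) = HahnSeries.C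
        ((algebraMap (RatFunc ℂ) (LaurentSeries ℂ) (c j)).coeff 0) := fun j =>
      LaurentSeries.eq_C_of_expandHom_eq hq (by rw [← hτ', hτ, hc])
    have hee := LaurentSeries.eq_C_of_expandHom_eq hq he
    set y := (algebraMap (RatFunc ℂ) (LaurentSeries ℂ) e +
      ∑ j, algebraMap (RatFunc ℂ) (LaurentSeries ℂ) (c j) * F j).coeff 0
    set cc := fun j => (algebraMap (RatFunc ℂ) (LaurentSeries ℂ) (c j)).coeff 0 with hccdef
    have hsum : HahnSeries.ofPowerSeries ℤ ℂ (∑ j, cc j • f j) = HahnSeries.C y -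
        algebraMap (RatFunc ℂ) (LaurentSeries ℂ) e := by
      rw [eq_sub_iff_add_eq', ← hee, map_sum]
      congr 1
      refine Finset.sum_congr rfl fun j _ => ?_
      rw [hcc j, PowerSeries.smul_eq_C_mul, map_mul, HahnSeries.ofPowerSeries_C]
    have hrat : (∑ j, cc j • f j).IsRat := by
      refine ⟨e.denom * Polynomial.C y - e.num, e.denom, e.denom_ne_zero, hofinj ?_⟩
      rw [map_mul, hsum, ← hpoly, ← hpoly, map_sub, map_sub, map_mul, map_mul,
        hpoly (Polynomial.C y), Polynomial.coe_C, HahnSeries.ofPowerSeries_C, mul_sub]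
      congr 1
      rw [← map_mul]
      congr 1
      nth_rewrite 2 [← RatFunc.num_div_denom e]
      rw [mul_div_cancel₀]
      simpa using e.denom_ne_zero
    have hcc0 := h cc hrat
    apply hc0
    funext j
    apply (algebraMap (RatFunc ℂ) (LaurentSeries ℂ)).injective
    rw [hcc j]
    have := congrFun hcc0 j
    simp only [hccdef, Pi.zero_apply] at this
    simp [this]
  have hX : AlgebraicIndependent ℂ (fun _ : Unit => (RatFunc.X : RatFunc ℂ)) := by
    rw [algebraicIndependent_unique_type_iff]
    refine RatFunc.transcendental_of_ne_C _ fun ⟨c, hc⟩ => ?_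
    rw [← RatFunc.algebraMap_C, ← RatFunc.algebraMap_X] at hc
    exact Polynomial.X_ne_C c (RatFunc.algebraMap_injective ℂ hc)
  have hCX : ∀ r : ℂ, algebraMap ℂ (LaurentSeries ℂ) r =
      algebraMap (RatFunc ℂ) (LaurentSeries ℂ) (algebraMap ℂ (RatFunc ℂ) r) := fun r => by
    have h1 := hpoly (Polynomial.C r)
    rw [RatFunc.algebraMap_C, Polynomial.coe_C] at h1
    rw [RatFunc.algebraMap_eq_C, h1]
    rfl
  have := IsScalarTower.of_algebraMap_eq hCX
  have hall := hX.sumElim_comp hindep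
  rw [algebraicIndependent_equiv' (Equiv.sumComm J Unit)
    (f := Sum.elim (fun _ : Unit => HahnSeries.ofPowerSeries ℤ ℂ PowerSeries.X) F)] at hall
  · refine AlgebraicIndependent.of_comp
      ({ HahnSeries.ofPowerSeries ℤ ℂ with commutes' := fun _ => rfl } :
        PowerSeries ℂ →ₐ[ℂ] LaurentSeries ℂ) ?_
    convert hall using 1
    ext i
    rcases i with i | i <;> rfl
  · ext i
    rcases i with i | i
    · rfl
    · simp [HahnSeries.ofPowerSeries_X]

end Rational

section Regular

open Polynomial

namespace PowerSeries

/-- The power series `g` is rational without pole at `β`. -/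
def RegAt (g : PowerSeries ℂ) (β : ℂ) : Prop :=
  ∃ a b : ℂ[X], b.eval β ≠ 0 ∧ (b : PowerSeries ℂ) * g = a

theorem regAt_coe (a : ℂ[X]) (β : ℂ) : RegAt (a : PowerSeries ℂ) β :=
  ⟨a, 1, by simp, by simp⟩

theorem RegAt.add {g h : PowerSeries ℂ} {β : ℂ} (hg : RegAt g β) (hh : RegAt h β) :
    RegAt (g + h) β := by
  obtain ⟨a, b, hb, hab⟩ := hg
  obtain ⟨a', b', hb', hab'⟩ := hh
  refine ⟨a * b' + a' * b, b * b', by simp [hb, hb'], ?_⟩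
  push_cast
  rw [← hab, ← hab']
  ring

theorem RegAt.smul {g : PowerSeries ℂ} {β : ℂ} (hg : RegAt g β) (c : ℂ) : RegAt (c • g) β := by
  obtain ⟨a, b, hb, hab⟩ := hg
  refine ⟨Polynomial.C c * a, b, hb, ?_⟩
  push_cast
  rw [← hab, smul_eq_C_mul]
  ring

theorem RegAt.neg {g : PowerSeries ℂ} {β : ℂ} (hg : RegAt g β) : RegAt (-g) β := by
  simpa using hg.smul (-1)

theorem RegAt.sub {g h : PowerSeries ℂ} {β : ℂ} (hg : RegAt g β) (hh : RegAt h β) :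
    RegAt (g - h) β := by
  simpa [sub_eq_add_neg] using hg.add hh.neg

theorem RegAt.of_smul {g : PowerSeries ℂ} {β c : ℂ} (hc : c ≠ 0) (hg : RegAt (c • g) β) :
    RegAt g β := by
  simpa [smul_smul, inv_mul_cancel₀ hc] using hg.smul c⁻¹

theorem RegAt.sum {ι : Type*} {s : Finset ι} {g : ι → PowerSeries ℂ} {β : ℂ}
    (hg : ∀ i ∈ s, RegAt (g i) β) : RegAt (∑ i ∈ s, g i) β := by
  classical
  induction s using Finset.induction_on with
  | empty => simpa using regAt_coe 0 β
  | insert i s hi ih =>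
    rw [Finset.sum_insert hi]
    exact (hg i (by simp)).add (ih fun j hj => hg j (by simp [hj]))

theorem RegAt.isRat {g : PowerSeries ℂ} {β : ℂ} (hg : RegAt g β) : g.IsRat := by
  obtain ⟨a, b, hb, hab⟩ := hg
  exact ⟨a, b, fun h => hb (by simp [h]), hab⟩

theorem IsRat.exists_isCoprime {g : PowerSeries ℂ} (hg : g.IsRat) :
    ∃ a b : ℂ[X], IsCoprime a b ∧ b ≠ 0 ∧ (b : PowerSeries ℂ) * g = a := by
  obtain ⟨a, b, hb, hab⟩ := hg
  obtain ⟨a', ha'⟩ := EuclideanDomain.gcd_dvd_left a b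
  obtain ⟨b', hb'⟩ := EuclideanDomain.gcd_dvd_right a b
  set e := EuclideanDomain.gcd a b with he
  have he0 : e ≠ 0 := fun h => hb (by rw [hb', h, zero_mul])
  refine ⟨a', b', ?_, fun h => hb (by rw [hb', h, mul_zero]), ?_⟩
  · refine ⟨EuclideanDomain.gcdA a b, EuclideanDomain.gcdB a b, mul_left_cancel₀ he0 ?_⟩
    have h := EuclideanDomain.gcd_eq_gcd_ab a b
    rw [← he] at h
    calc e * (EuclideanDomain.gcdA a b * a' + EuclideanDomain.gcdB a b * b')
        = (e * a') * EuclideanDomain.gcdA a b + (e * b') * EuclideanDomain.gcdB a b := by ring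
      _ = e * 1 := by rw [← ha', ← hb', ← h, mul_one]
  · have he1 : (e : PowerSeries ℂ) ≠ 0 := by rwa [Ne, Polynomial.coe_eq_zero_iff]
    refine mul_left_cancel₀ he1 ?_
    rw [← mul_assoc, ← Polynomial.coe_mul, ← Polynomial.coe_mul, ← ha', ← hb', hab]

theorem RegAt.eval_ne_zero {g : PowerSeries ℂ} {a b : ℂ[X]} (hco : IsCoprime a b)
    (hab : (b : PowerSeries ℂ) * g = a) {β : ℂ} (hg : RegAt g β) : b.eval β ≠ 0 := by
  obtain ⟨a', b', hb', hab'⟩ := hg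
  intro hb
  have h : b' * a = b * a' := by
    rw [← Polynomial.coe_inj, Polynomial.coe_mul, Polynomial.coe_mul, ← hab, ← hab']
    ring
  have ha : a.eval β = 0 := by
    have := congrArg (Polynomial.eval β) h
    rw [eval_mul, eval_mul, hb, zero_mul] at this
    exact (mul_eq_zero.mp this).resolve_left hb'
  obtain ⟨u, v, huv⟩ := hco
  simpa [ha, hb] using congrArg (Polynomial.eval β) huv

theorem IsRat.finite_not_regAt {g : PowerSeries ℂ} (hg : g.IsRat) :
    {β | ¬ RegAt g β}.Finite := by
  obtain ⟨a, b, hb, hab⟩ := hg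
  refine b.roots.toFinset.finite_toSet.subset fun β hβ => ?_
  by_contra h
  refine hβ ⟨a, b, fun h0 => h ?_, hab⟩
  simpa [hb] using h0

theorem IsRat.regAt_zero {g : PowerSeries ℂ} (hg : g.IsRat) : RegAt g 0 := by
  obtain ⟨a, b, hco, hb, hab⟩ := hg.exists_isCoprime
  refine ⟨a, b, fun h0 => ?_, hab⟩
  have ha : a.eval 0 = 0 := by
    have := congrArg constantCoeff hab
    rw [map_mul, Polynomial.constantCoeff_coe, Polynomial.constantCoeff_coe,
      Polynomial.coeff_zero_eq_eval_zero, Polynomial.coeff_zero_eq_eval_zero, h0, zero_mul] at this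
    exact this.symm
  obtain ⟨u, v, huv⟩ := hco
  simpa [ha, h0] using congrArg (Polynomial.eval 0) huv

theorem IsRat.exists_coe_eq {g : PowerSeries ℂ} (hg : g.IsRat) (h : ∀ β, RegAt g β) :
    ∃ a : ℂ[X], g = a := by
  obtain ⟨a, b, hco, hb, hab⟩ := hg.exists_isCoprime
  have hdeg : b.degree = 0 := by
    by_contra hd
    obtain ⟨β, hβ⟩ := IsAlgClosed.exists_root b hd
    exact (h β).eval_ne_zero hco hab hβ
  obtain ⟨c, hc⟩ : ∃ c, b = Polynomial.C c := ⟨_, Polynomial.eq_C_of_degree_eq_zero hdeg⟩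
  have hc0 : c ≠ 0 := by rintro rfl; simp [hc] at hb
  refine ⟨Polynomial.C c⁻¹ * a, ?_⟩
  rw [Polynomial.coe_mul, ← hab, hc, Polynomial.coe_C, Polynomial.coe_C, ← mul_assoc, ← map_mul,
    inv_mul_cancel₀ hc0, map_one, one_mul]

theorem RegAt.expand {g : PowerSeries ℂ} {d : ℕ} (hd : d ≠ 0) {β : ℂ} (hg : RegAt g (β ^ d)) :
    RegAt (PowerSeries.expand d hd g) β := by
  obtain ⟨a, b, hb, hab⟩ := hg
  refine ⟨Polynomial.expand ℂ d a, Polynomial.expand ℂ d b, by rwa [Polynomial.expand_eval], ?_⟩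
  rw [← PowerSeries.expand_coe d hd, ← PowerSeries.expand_coe d hd, ← map_mul, hab]

theorem IsRat.expand {g : PowerSeries ℂ} (hg : g.IsRat) {d : ℕ} (hd : d ≠ 0) :
    (PowerSeries.expand d hd g).IsRat := by
  have h := hg.regAt_zero
  rw [← zero_pow (M₀ := ℂ) hd] at h
  exact (h.expand hd).isRat

theorem RegAt.of_expand {g : PowerSeries ℂ} (hrat : g.IsRat) {d : ℕ} (hd : d ≠ 0) {β : ℂ}
    (hg : RegAt (PowerSeries.expand d hd g) β) : RegAt g (β ^ d) := by
  obtain ⟨a, b, hco, hb, hab⟩ := hrat.exists_isCoprime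
  refine ⟨a, b, ?_, hab⟩
  rw [← Polynomial.expand_eval]
  refine hg.eval_ne_zero (hco.map (Polynomial.expand ℂ d : ℂ[X] →+* ℂ[X])) ?_
  rw [RingHom.coe_coe, ← PowerSeries.expand_coe d hd, ← PowerSeries.expand_coe d hd, ← map_mul,
    hab]

theorem RegAt.rescale_neg_one {g : PowerSeries ℂ} {β : ℂ} (hg : RegAt g (-β)) :
    RegAt (rescale (-1) g) β := by
  obtain ⟨a, b, hb, hab⟩ := hg
  have hcoe : ∀ p : ℂ[X], rescale (-1 : ℂ) (p : PowerSeries ℂ) =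
      (p.comp (Polynomial.C (-1) * Polynomial.X) : ℂ[X]) := fun p => by
    ext n
    rw [coeff_rescale, Polynomial.coeff_coe, Polynomial.coeff_coe, Polynomial.comp_C_mul_X_coeff,
      mul_comm]
  refine ⟨a.comp (Polynomial.C (-1) * Polynomial.X), b.comp (Polynomial.C (-1) * Polynomial.X),
    by simpa using hb, ?_⟩
  rw [← hcoe, ← hcoe, ← map_mul, hab]

theorem rescale_neg_one_expand {d : ℕ} (hd : d ≠ 0) (heven : Even d) (g : PowerSeries ℂ) :
    rescale (-1) (PowerSeries.expand d hd g) = PowerSeries.expand d hd g := by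
  ext n
  rw [coeff_rescale, coeff_expand]
  split_ifs with h
  · rw [(heven.trans_dvd h).neg_one_pow, one_mul]
  · simp

/-- The expansion of `X / (1 - γ * X ^ 2)`. -/
def oddGeom (γ : ℂ) : PowerSeries ℂ :=
  mk fun n => if Odd n then γ ^ (n / 2) else 0

theorem mul_oddGeom (γ : ℂ) :
    ((1 - Polynomial.C γ * Polynomial.X ^ 2 : ℂ[X]) : PowerSeries ℂ) * oddGeom γ =
      (Polynomial.X : ℂ[X]) := by
  push_cast
  rw [sub_mul, one_mul]
  ext n
  rw [map_sub, mul_assoc, coeff_C_mul, coeff_X_pow_mul']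
  rcases n with _ | _ | n
  · simp [oddGeom]
  · simp [oddGeom]
  · have h1 : Odd (n + 2) ↔ Odd n := by
      rw [Nat.odd_add]; simp
    have h2 : (n + 2) / 2 = n / 2 + 1 := by omega
    simp only [oddGeom, coeff_mk, h1, h2, coeff_X]
    by_cases h : Odd n <;> simp [h, pow_succ']

theorem regAt_oddGeom_iff {γ β : ℂ} : RegAt (oddGeom γ) β ↔ γ * β ^ 2 ≠ 1 := by
  have hco : IsCoprime (Polynomial.X : ℂ[X]) (1 - Polynomial.C γ * Polynomial.X ^ 2) :=
    ⟨Polynomial.C γ * Polynomial.X, 1, by ring⟩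
  constructor
  · intro h
    have := h.eval_ne_zero hco (mul_oddGeom γ)
    contrapose! this
    simp [this]
  · intro h
    refine ⟨_, _, ?_, mul_oddGeom γ⟩
    simpa [sub_eq_zero] using h.symm

theorem rescale_neg_one_oddGeom (γ : ℂ) : rescale (-1) (oddGeom γ) = -oddGeom γ := by
  ext n
  rw [coeff_rescale, oddGeom, map_neg, coeff_mk]
  split_ifs with h
  · rw [h.neg_one_pow]; ring
  · simp

theorem eq_zero_of_regAt_sum_oddGeom {Γ : Finset ℂ} {B : ℂ → ℂ} {δ γ : ℂ} (hγ : γ ∈ Γ)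
    (hδ : γ * δ ^ 2 = 1) (h : RegAt (∑ γ ∈ Γ, B γ • oddGeom γ) δ) : B γ = 0 := by
  classical
  by_contra hB
  rw [← Finset.add_sum_erase _ _ hγ] at h
  have h2 : RegAt (∑ x ∈ Γ.erase γ, B x • oddGeom x) δ := RegAt.sum fun x hx => by
    refine (regAt_oddGeom_iff.mpr fun h1 => Finset.ne_of_mem_erase hx ?_).smul _
    have hδ0 : δ ^ 2 ≠ 0 := right_ne_zero_of_mul (hδ ▸ one_ne_zero)
    exact mul_right_cancel₀ hδ0 (h1.trans hδ.symm)
  have h3 := (h.sub h2)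
  rw [add_sub_cancel_right] at h3
  exact regAt_oddGeom_iff.mp (h3.of_smul hB) hδ

end PowerSeries

end Regular

section PoleArgument

open Polynomial

theorem Set.Finite.eq_empty_of_two_preimages {α : Type*} {P : Set α} (hP : P.Finite) (s : α → α)
    (h : ∀ x ∈ P, ∃ y ∈ P, ∃ z ∈ P, y ≠ z ∧ s y = x ∧ s z = x) : P = ∅ := by
  have := hP.fintype
  choose! y hy z hz hyz hsy hsz using h
  have hinj : Function.Injective (fun p : P × Bool =>
      (if p.2 then ⟨y p.1, hy _ p.1.2⟩ else ⟨z p.1, hz _ p.1.2⟩ : P)) := by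
    rintro ⟨⟨a, ha⟩, i⟩ ⟨⟨b, hb⟩, j⟩ hab
    have hab' : (if i then y a else z a) = if j then y b else z b := by
      have := congrArg Subtype.val hab
      cases i <;> cases j <;> simpa using this
    have hs : a = b := by
      have h1 : s (if i then y a else z a) = a := by cases i; exacts [hsz a ha, hsy a ha]
      have h2 : s (if j then y b else z b) = b := by cases j; exacts [hsz b hb, hsy b hb]
      rw [← h1, hab', h2]
    subst hs
    cases i <;> cases j
    · rfl
    · exact (hyz a ha (by simpa using hab'.symm)).elim
    · exact (hyz a ha (by simpa using hab')).elim
    · rfl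
  have hcard := Fintype.card_le_of_injective _ hinj
  rw [Fintype.card_prod, Fintype.card_bool] at hcard
  have h0 : Fintype.card P = 0 := by omega
  rw [Fintype.card_eq_zero_iff] at h0
  exact Set.isEmpty_coe_sort.mp h0

namespace PowerSeries

/-- A sequence of rational power series, with finitely many poles altogether, linked by
`g n = Q n + ∑ γ ∈ Γ, B n γ • oddGeom γ + g (n + 1)(X ^ d)`. -/
structure RationalTower (d : ℕ) (hd : d ≠ 0) (Γ : Finset ℂ) (Q : ℕ → ℂ[X]) (B : ℕ → ℂ → ℂ)
    (g : ℕ → PowerSeries ℂ) : Prop where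
  eq : ∀ n, g n = Q n + ∑ γ ∈ Γ, B n γ • oddGeom γ + PowerSeries.expand d hd (g (n + 1))
  rat : ∀ n, (g n).IsRat
  per : ∃ M, 0 < M ∧ Function.Periodic g M
  fin : {β | ∃ n, ¬ RegAt (g n) β}.Finite

theorem RationalTower.of_periodic {d : ℕ} {hd : d ≠ 0} {Γ : Finset ℂ} {Q : ℕ → ℂ[X]}
    {B : ℕ → ℂ → ℂ} {g : ℕ → PowerSeries ℂ} {M : ℕ} (hM : 0 < M)
    (hper : Function.Periodic g M)
    (heq : ∀ n, g n = Q n + ∑ γ ∈ Γ, B n γ • oddGeom γ + PowerSeries.expand d hd (g (n + 1)))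
    (hrat : (g 0).IsRat) : RationalTower d hd Γ Q B g := by
  have hodd : ∀ γ, (oddGeom γ).IsRat := fun γ =>
    (regAt_oddGeom_iff (β := 0).mpr (by simp)).isRat
  have hstep : ∀ n, (g (n + 1)).IsRat → (g n).IsRat := fun n hn => by
    rw [heq n]
    exact (((regAt_coe (Q n) 0).add (RegAt.sum fun γ _ =>
      (hodd γ).regAt_zero.smul _)).add (hn.expand hd).regAt_zero).isRat
  have hmul : ∀ m, (g (m * M)).IsRat := fun m => by
    have h0 : g (m * M) = g 0 := by simpa using hper.nat_mul m 0
    rwa [h0]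
  have hall : ∀ n, (g n).IsRat := fun n => by
    have hdown : ∀ k, ∀ m, m + k = (n + 1) * M → (g m).IsRat := by
      intro k
      induction k with
      | zero => intro m hm; rw [show m = (n + 1) * M by omega]; exact hmul _
      | succ k ih => intro m hm; exact hstep m (ih (m + 1) (by omega))
    have hle : n ≤ (n + 1) * M := by nlinarith
    exact hdown ((n + 1) * M - n) n (by omega)
  refine ⟨heq, hall, ⟨M, hM, hper⟩, ((Set.finite_lt_nat M).biUnion
    fun n _ => (hall n).finite_not_regAt).subset ?_⟩
  rintro β ⟨n, hn⟩
  refine Set.mem_biUnion (show n % M ∈ {i | i < M} from Nat.mod_lt _ hM) ?_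
  change ¬ RegAt (g (n % M)) β
  rwa [hper.map_mod_nat]

namespace RationalTower

variable {d : ℕ} {hd : d ≠ 0} {Γ : Finset ℂ} {Q : ℕ → ℂ[X]} {B : ℕ → ℂ → ℂ}
  {g : ℕ → PowerSeries ℂ}

theorem ne_zero_of_not_regAt (T : RationalTower d hd Γ Q B g) {α : ℂ} {n : ℕ}
    (h : ¬ RegAt (g n) α) : α ≠ 0 := by
  rintro rfl
  exact h (T.rat n).regAt_zero

theorem regAt_sum (T : RationalTower d hd Γ Q B g) {β : ℂ} {n : ℕ} (h : RegAt (g n) β)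
    (h' : RegAt (g (n + 1)) (β ^ d)) : RegAt (∑ γ ∈ Γ, B n γ • oddGeom γ) β := by
  have h1 := (h.sub (regAt_coe (Q n) β)).sub (h'.expand hd)
  rw [T.eq n] at h1
  convert h1 using 1
  abel

theorem regAt_succ (T : RationalTower d hd Γ Q B g) {β : ℂ} {n : ℕ} (h : RegAt (g n) β)
    (h' : RegAt (∑ γ ∈ Γ, B n γ • oddGeom γ) β) : RegAt (g (n + 1)) (β ^ d) := by
  refine RegAt.of_expand (T.rat _) hd ?_
  have h1 := (h.sub (regAt_coe (Q n) β)).sub h'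
  rw [T.eq n] at h1
  convert h1 using 1
  abel

theorem regAt_succ_of_even (T : RationalTower d hd Γ Q B g) (heven : Even d) {β : ℂ} {n : ℕ}
    (h : RegAt (g n) β) (h' : RegAt (g n) (-β)) : RegAt (g (n + 1)) (β ^ d) := by
  refine RegAt.of_expand (T.rat _) hd ?_
  have h1 := (h.add h'.rescale_neg_one).sub ((regAt_coe (Q n) β).add
    (regAt_coe (Q n) (-β)).rescale_neg_one)
  have h2 : rescale (-1) (g n) = rescale (-1) (Q n : PowerSeries ℂ) -
      ∑ γ ∈ Γ, B n γ • oddGeom γ + PowerSeries.expand d hd (g (n + 1)) := by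
    rw [T.eq n, map_add, map_add, rescale_neg_one_expand hd heven, map_sum, sub_eq_add_neg,
      ← Finset.sum_neg_distrib]
    congr 3
    funext γ
    have h3 := congrArg (B n γ • ·) (rescale_neg_one_oddGeom γ)
    rw [smul_neg] at h3
    rw [← h3]
    ext m
    simp only [coeff_rescale, coeff_smul, smul_eq_mul]
    ring
  rw [h2] at h1
  nth_rewrite 1 [T.eq n] at h1
  refine RegAt.of_smul (two_ne_zero (α := ℂ)) ?_
  convert h1 using 1
  rw [two_smul]
  abel

theorem regAt_of_two_roots (T : RationalTower d hd Γ Q B g)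
    (h : ∀ n α, ¬ RegAt (g (n + 1)) α → ∃ β β', β ≠ β' ∧ β ^ d = α ∧ β' ^ d = α ∧
      ¬ RegAt (g n) β ∧ ¬ RegAt (g n) β') (n : ℕ) (β : ℂ) : RegAt (g n) β := by
  have hempty : {β | ∃ n, ¬ RegAt (g n) β} = ∅ := by
    refine T.fin.eq_empty_of_two_preimages (fun x => x ^ d) ?_
    rintro α ⟨m, hm⟩
    obtain ⟨M, hM, hper⟩ := T.per
    rw [← hper m, show m + M = m + M - 1 + 1 by omega] at hm
    obtain ⟨β, β', hne, h1, h2, h3, h4⟩ := h _ _ hm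
    exact ⟨β, ⟨_, h3⟩, β', ⟨_, h4⟩, hne, h1, h2⟩
  by_contra hn
  exact (Set.mem_empty_iff_false β).mp (hempty ▸ ⟨n, hn⟩)

theorem poly_eq_zero (T : RationalTower d hd Γ Q B g) (hd2 : 2 ≤ d)
    (hQ : ∀ n, (Q n).natDegree < d ∧ (Q n).coeff 0 = 0)
    (hB : ∀ n, ∀ γ ∈ Γ, B n γ = 0) (n : ℕ) : Q n = 0 := by
  have hsum : ∀ n, ∑ γ ∈ Γ, B n γ • oddGeom γ = 0 := fun n =>
    Finset.sum_eq_zero fun γ hγ => by rw [hB n γ hγ, zero_smul]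
  have heq : ∀ n, g n = Q n + PowerSeries.expand d hd (g (n + 1)) := fun n => by
    have h := T.eq n
    rwa [hsum, add_zero] at h
  have hreg : ∀ n β, RegAt (g n) β := by
    refine T.regAt_of_two_roots fun n α hα => ?_
    obtain ⟨β, rfl⟩ := IsAlgClosed.exists_pow_nat_eq α (Nat.pos_of_ne_zero hd)
    have hβ : β ≠ 0 := by
      rintro rfl
      exact T.ne_zero_of_not_regAt hα (zero_pow hd)
    have hζ := Complex.isPrimitiveRoot_exp d hd
    set ζ := Complex.exp (2 * Real.pi * Complex.I / d)
    have hroot : ∀ β', β' ^ d = β ^ d → ¬ RegAt (g n) β' := fun β' hβ' h => by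
      refine hα (hβ' ▸ T.regAt_succ h ?_)
      rw [hsum]
      simpa using regAt_coe 0 β'
    have hpow : (β * ζ) ^ d = β ^ d := by rw [mul_pow, hζ.pow_eq_one, mul_one]
    refine ⟨β, β * ζ, fun h => ?_, rfl, hpow, hroot _ rfl, hroot _ hpow⟩
    exact hζ.ne_one (by omega) (mul_left_cancel₀ hβ (by rw [← h, mul_one]))
  have hcoeff : ∀ m μ n, μ ≠ 0 → coeff (d ^ m * μ) (g n) = coeff μ (g (n + m)) := by
    intro m
    induction m with
    | zero => intro μ n _; simp
    | succ m ih =>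
      intro μ n hμ
      have h1 : (Q n).coeff (d * (d ^ m * μ)) = 0 := by
        refine Polynomial.coeff_eq_zero_of_natDegree_lt ((hQ n).1.trans_le ?_)
        exact Nat.le_mul_of_pos_right d (Nat.mul_pos (by positivity) (Nat.pos_of_ne_zero hμ))
      rw [pow_succ', mul_assoc, heq n, map_add, Polynomial.coeff_coe, h1, zero_add,
        coeff_expand_mul, ih _ _ hμ]
      congr 2
      ring
  ext μ
  rw [Polynomial.coeff_zero]
  rcases Nat.eq_zero_or_pos μ with rfl | hμ
  · exact (hQ n).2
  rcases le_or_gt d μ with hdμ | hdμ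
  · exact Polynomial.coeff_eq_zero_of_natDegree_lt ((hQ n).1.trans_le hdμ)
  have h1 : coeff μ (g n) = (Q n).coeff μ := by
    rw [heq n, map_add, Polynomial.coeff_coe,
      coeff_expand_of_not_dvd _ _ _ (Nat.not_dvd_of_pos_of_lt hμ hdμ), add_zero]
  obtain ⟨M, hM, hper⟩ := T.per
  obtain ⟨a, ha⟩ := (T.rat n).exists_coe_eq (hreg n)
  have h2 := hcoeff ((a.natDegree + 1) * M) μ n hμ.ne'
  have h3 : g (n + (a.natDegree + 1) * M) = g n := by
    simpa using hper.nat_mul (a.natDegree + 1) n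
  rw [h3, h1, ha, Polynomial.coeff_coe] at h2
  rw [← h2]
  refine Polynomial.coeff_eq_zero_of_natDegree_lt ?_
  calc a.natDegree < (a.natDegree + 1) * M := by nlinarith
    _ < d ^ ((a.natDegree + 1) * M) := Nat.lt_pow_self (by omega)
    _ ≤ _ := Nat.le_mul_of_pos_right _ hμ

/-- If the tower has no poles, then all the coefficients `B n γ` vanish. -/
theorem coeff_eq_zero_of_regAt (T : RationalTower d hd Γ Q B g)
    (hΓ : ∀ γ ∈ Γ, γ ≠ 0) (hreg : ∀ n β, RegAt (g n) β) (n : ℕ) {γ : ℂ} (hγ : γ ∈ Γ) :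
    B n γ = 0 := by
  obtain ⟨δ, hδ⟩ := IsAlgClosed.exists_pow_nat_eq γ⁻¹ (n := 2) (by norm_num)
  refine eq_zero_of_regAt_sum_oddGeom hγ (δ := δ) ?_ (T.regAt_sum (hreg n δ) (hreg _ _))
  rw [hδ, mul_inv_cancel₀ (hΓ γ hγ)]

theorem regAt_of_odd (T : RationalTower d hd Γ Q B g) (hd2 : 2 ≤ d) (hodd : Odd d)
    (hΓ : ∀ γ ∈ Γ, γ ≠ 0 ∧ γ.im = 0) : ∀ n β, RegAt (g n) β := by
  refine T.regAt_of_two_roots fun n α hα => ?_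
  obtain ⟨β, rfl⟩ := IsAlgClosed.exists_pow_nat_eq α (Nat.pos_of_ne_zero hd)
  have hβ : β ≠ 0 := by
    rintro rfl
    exact T.ne_zero_of_not_regAt hα (zero_pow hd)
  have hd3 : 3 ≤ d := by
    rcases hodd with ⟨m, rfl⟩
    omega
  have hζ := Complex.isPrimitiveRoot_exp d hd
  set ζ := Complex.exp (2 * Real.pi * Complex.I / d)
  have hbad : ∀ β', β' ^ d = β ^ d → RegAt (g n) β' → (β' ^ 2).im = 0 := by
    intro β' hβ' h
    by_contra him
    refine hα (hβ' ▸ T.regAt_succ h (RegAt.sum fun γ hγ =>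
      (regAt_oddGeom_iff.mpr fun h1 => him ?_).smul _))
    have h2 : (γ.re : ℂ) = γ := Complex.ext rfl (by simp [(hΓ γ hγ).2])
    rw [eq_inv_of_mul_eq_one_right h1, ← h2, ← Complex.ofReal_inv, Complex.ofReal_im]
  have huniq : ∀ β₁ β₂, β₁ ^ d = β ^ d → β₂ ^ d = β ^ d → (β₁ ^ 2).im = 0 → (β₂ ^ 2).im = 0 →
      β₁ = β₂ := by
    intro β₁ β₂ h1 h2 h3 h4
    have e1 : ((β₁ ^ 2).re : ℂ) = β₁ ^ 2 := Complex.ext rfl (by rw [h3, Complex.ofReal_im])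
    have e2 : ((β₂ ^ 2).re : ℂ) = β₂ ^ 2 := Complex.ext rfl (by rw [h4, Complex.ofReal_im])
    have e3 : (β₁ ^ 2).re = (β₂ ^ 2).re := by
      refine hodd.pow_injective ?_
      have : ((β₁ ^ 2).re : ℂ) ^ d = ((β₂ ^ 2).re : ℂ) ^ d := by
        rw [e1, e2, ← pow_mul, ← pow_mul, mul_comm 2 d, pow_mul, pow_mul, h1, h2]
      exact_mod_cast this
    have e4 : β₁ ^ 2 = β₂ ^ 2 := by rw [← e1, ← e2, e3]
    rcases sq_eq_sq_iff_eq_or_eq_neg.mp e4 with h | h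
    · exact h
    · exfalso
      rw [h, hodd.neg_pow, h2] at h1
      have : β ^ d = 0 := by linear_combination (-1 / 2 : ℂ) * h1
      exact hβ (pow_eq_zero_iff hd |>.mp this)
  have hpow : ∀ i : ℕ, (β * ζ ^ i) ^ d = β ^ d := fun i => by
    rw [mul_pow, ← pow_mul, mul_comm i, pow_mul, hζ.pow_eq_one, one_pow, mul_one]
  have hne : ∀ i j : ℕ, i < 3 → j < 3 → i ≠ j → β * ζ ^ i ≠ β * ζ ^ j := fun i j hi hj hij h =>
    hij (hζ.pow_inj (by omega) (by omega) (mul_left_cancel₀ hβ h))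
  by_cases h0 : RegAt (g n) (β * ζ ^ 0)
  · have hreg : ∀ i : ℕ, 0 < i → i < 3 → ¬ RegAt (g n) (β * ζ ^ i) := fun i hi hi3 h =>
      hne i 0 hi3 (by omega) (by omega)
        (huniq _ _ (hpow _) (hpow _) (hbad _ (hpow _) h) (hbad _ (hpow _) h0))
    exact ⟨_, _, hne 1 2 (by omega) (by omega) (by omega), hpow _, hpow _,
      hreg 1 (by omega) (by omega), hreg 2 (by omega) (by omega)⟩
  · by_cases h1 : RegAt (g n) (β * ζ ^ 1)
    · refine ⟨_, _, hne 0 2 (by omega) (by omega) (by omega), hpow _, hpow _, h0, fun h => ?_⟩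
      exact hne 2 1 (by omega) (by omega) (by omega)
        (huniq _ _ (hpow _) (hpow _) (hbad _ (hpow _) h) (hbad _ (hpow _) h1))
    · exact ⟨_, _, hne 0 1 (by omega) (by omega) (by omega), hpow _, hpow _, h0, h1⟩

theorem exists_not_regAt_of_even (T : RationalTower d hd Γ Q B g) (heven : Even d) {n : ℕ}
    {β : ℂ} (h : ¬ RegAt (g (n + 1)) (β ^ d)) :
    ∃ β', (β' = β ∨ β' = -β) ∧ ¬ RegAt (g n) β' := by
  by_contra! h'
  exact h (T.regAt_succ_of_even heven (h' _ (Or.inl rfl)) (h' _ (Or.inr rfl)))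

theorem regAt_of_even (T : RationalTower d hd Γ Q B g) (hd2 : 2 < d) (heven : Even d) :
    ∀ n β, RegAt (g n) β := by
  refine T.regAt_of_two_roots fun n α hα => ?_
  obtain ⟨β, rfl⟩ := IsAlgClosed.exists_pow_nat_eq α (Nat.pos_of_ne_zero hd)
  have hβ : β ≠ 0 := by
    rintro rfl
    exact T.ne_zero_of_not_regAt hα (zero_pow hd)
  have hζ := Complex.isPrimitiveRoot_exp d hd
  set ζ := Complex.exp (2 * Real.pi * Complex.I / d)
  have hpow : (β * ζ) ^ d = β ^ d := by rw [mul_pow, hζ.pow_eq_one, mul_one]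
  obtain ⟨β₁, hβ₁, h1⟩ := T.exists_not_regAt_of_even heven hα
  obtain ⟨β₂, hβ₂, h2⟩ := T.exists_not_regAt_of_even heven (hpow ▸ hα)
  refine ⟨β₁, β₂, fun h => ?_, ?_, ?_, h1, h2⟩
  · have hsq : ζ ^ 2 = 1 := by
      have e1 : β₁ ^ 2 = β ^ 2 := by rcases hβ₁ with h | h <;> rw [h]; ring
      have e2 : β₂ ^ 2 = (β * ζ) ^ 2 := by rcases hβ₂ with h | h <;> rw [h]; ring
      rw [← h, e1, mul_pow] at e2
      exact mul_left_cancel₀ (pow_ne_zero 2 hβ) (by rw [← e2, mul_one])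
    exact hζ.pow_ne_one_of_pos_of_lt (by norm_num) hd2 hsq
  · rcases hβ₁ with h | h <;> rw [h]
    rw [heven.neg_pow]
  · rcases hβ₂ with h | h <;> rw [h]
    · exact hpow
    · rw [heven.neg_pow, hpow]

end RationalTower

end PowerSeries

end PoleArgument

section BaseTwo

open Polynomial

theorem Set.Finite.mapsTo_injOn_of_surjOn {α : Type*} {P : Set α} (hP : P.Finite) {f : α → α}
    (h : Set.SurjOn f P P) : Set.MapsTo f P P ∧ Set.InjOn f P := by
  have h1 : f '' P = P :=
    (Set.eq_of_subset_of_ncard_le h (Set.ncard_image_le hP) (hP.image f)).symm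
  exact ⟨Set.image_subset_iff.mp h1.le, Set.injOn_of_ncard_image_eq (by rw [h1]) hP⟩

namespace PowerSeries

/-- The expansion of `X / (1 - X)`. -/
def geomTail : PowerSeries ℂ := mk fun n => if n = 0 then 0 else 1

theorem mul_geomTail :
    ((1 - Polynomial.X : ℂ[X]) : PowerSeries ℂ) * geomTail = (Polynomial.X : ℂ[X]) := by
  push_cast
  rw [sub_mul, one_mul]
  ext n
  rw [map_sub]
  rcases n with _ | n
  · simp [geomTail]
  · rw [coeff_succ_X_mul]
    rcases n with _ | n <;> simp [geomTail, coeff_X]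

theorem geomTail_isRat : geomTail.IsRat :=
  ⟨_, _, fun h => by simpa using congrArg (Polynomial.eval 0) h, mul_geomTail⟩

theorem geomTail_eq : geomTail = oddGeom 1 + PowerSeries.expand 2 two_ne_zero geomTail := by
  ext n
  rw [map_add, coeff_expand]
  simp only [geomTail, oddGeom, coeff_mk, one_pow]
  rcases Nat.even_or_odd' n with ⟨m, rfl | rfl⟩
  · simp
  · simp [show ¬ 2 ∣ 2 * m + 1 by omega]

namespace RationalTower

variable {Γ : Finset ℂ} {Q : ℕ → ℂ[X]} {B : ℕ → ℂ → ℂ} {g : ℕ → PowerSeries ℂ}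

theorem exists_neg_of_sq (T : RationalTower 2 two_ne_zero Γ Q B g) {β : ℂ}
    (h : ∃ n, ¬ RegAt (g n) (β ^ 2)) :
    ∃ β', (β' = β ∨ β' = -β) ∧ ∃ n, ¬ RegAt (g n) β' := by
  obtain ⟨m, hm⟩ := h
  obtain ⟨M, hM, hper⟩ := T.per
  rw [← hper m, show m + M = m + M - 1 + 1 by omega] at hm
  obtain ⟨β', h1, h2⟩ := T.exists_not_regAt_of_even even_two hm
  exact ⟨β', h1, _, h2⟩

theorem sq_mapsTo_injOn (T : RationalTower 2 two_ne_zero Γ Q B g) :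
    Set.MapsTo (· ^ 2) {β | ∃ n, ¬ RegAt (g n) β} {β | ∃ n, ¬ RegAt (g n) β} ∧
      Set.InjOn (· ^ 2) {β | ∃ n, ¬ RegAt (g n) β} := by
  refine T.fin.mapsTo_injOn_of_surjOn fun α hα => ?_
  obtain ⟨β, rfl⟩ := IsAlgClosed.exists_pow_nat_eq α two_pos
  obtain ⟨β', h1, h2⟩ := T.exists_neg_of_sq hα
  refine ⟨β', h2, ?_⟩
  rcases h1 with rfl | rfl <;> simp

theorem not_neg (T : RationalTower 2 two_ne_zero Γ Q B g) {β : ℂ}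
    (h : ∃ n, ¬ RegAt (g n) β) (h' : ∃ n, ¬ RegAt (g n) (-β)) : False := by
  have h1 : β = -β := T.sq_mapsTo_injOn.2 h h' (by simp)
  obtain ⟨n, hn⟩ := h
  exact T.ne_zero_of_not_regAt hn (self_eq_neg.mp h1)

theorem regAt_neg_one (T : RationalTower 2 two_ne_zero Γ Q B g) (n : ℕ) : RegAt (g n) (-1) := by
  by_contra h
  have h1 := T.sq_mapsTo_injOn.1 ⟨n, h⟩
  refine T.not_neg h1 ⟨n, ?_⟩
  simpa using h

theorem norm_eq_one (T : RationalTower 2 two_ne_zero Γ Q B g) {β : ℂ}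
    (h : ∃ n, ¬ RegAt (g n) β) : ‖β‖ = 1 := by
  have hmem : ∀ i : ℕ, β ^ 2 ^ i ∈ {β | ∃ n, ¬ RegAt (g n) β} := by
    intro i
    induction i with
    | zero => simpa using h
    | succ i ih =>
      rw [pow_succ, pow_mul]
      exact T.sq_mapsTo_injOn.1 ih
  obtain ⟨i, j, hij, h1⟩ : ∃ i j : ℕ, i ≠ j ∧ β ^ 2 ^ i = β ^ 2 ^ j := by
    by_contra! hcon
    exact Set.infinite_of_injective_forall_mem (fun i j h1 => by_contra fun h2 => hcon i j h2 h1)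
      hmem T.fin
  obtain ⟨n, hn⟩ := h
  by_contra hne
  have h2 := congrArg norm h1
  rw [norm_pow, norm_pow] at h2
  exact hij (Nat.pow_right_injective le_rfl
    (pow_right_injective₀ (norm_pos_iff.mpr (T.ne_zero_of_not_regAt hn)) hne h2))

theorem coeff_eq_zero_of_ne_one (T : RationalTower 2 two_ne_zero Γ Q B g)
    (hΓ : ∀ γ ∈ Γ, γ ≠ 0 ∧ γ.im = 0) (n : ℕ) {γ : ℂ} (hγ : γ ∈ Γ) (hγ1 : γ ≠ 1) : B n γ = 0 := by
  obtain ⟨δ, hδ⟩ := IsAlgClosed.exists_pow_nat_eq γ⁻¹ (n := 2) (by norm_num)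
  have hγδ : γ * δ ^ 2 = 1 := by rw [hδ, mul_inv_cancel₀ (hΓ γ hγ).1]
  by_contra hB
  have hpole : ∃ n, ¬ RegAt (g n) (δ ^ 2) := by
    by_contra! hcon
    refine hB (eq_zero_of_regAt_sum_oddGeom hγ hγδ (T.regAt_sum ?_ (hcon _)))
    by_contra h1
    exact T.sq_mapsTo_injOn.1 ⟨n, h1⟩ |>.elim fun m hm => hm (hcon m)
  have hnorm := T.norm_eq_one hpole
  rw [hδ, norm_inv, inv_eq_one] at hnorm
  have hre : (γ.re : ℂ) = γ := Complex.ext rfl (by simp [(hΓ γ hγ).2])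
  rw [← hre, Complex.norm_real, Real.norm_eq_abs] at hnorm
  rcases eq_or_eq_neg_of_abs_eq hnorm with h | h
  · exact hγ1 (by rw [← hre, h, Complex.ofReal_one])
  · obtain ⟨m, hm⟩ := hpole
    refine hm ?_
    rw [hδ, ← hre, h]
    have := T.regAt_neg_one m
    norm_num
    exact this

theorem sub_geomTail (T : RationalTower 2 two_ne_zero Γ Q B g) (h1 : 1 ∈ Γ) (c : ℂ) :
    RationalTower 2 two_ne_zero Γ Q (fun n γ => B n γ - if γ = 1 then c else 0)
      fun n => g n - c • geomTail := by
  obtain ⟨M, hM, hper⟩ := T.per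
  refine RationalTower.of_periodic hM (fun n => by simp only [hper n]) (fun n => ?_) ?_
  · have h2 : ∑ γ ∈ Γ, (B n γ - if γ = 1 then c else 0) • oddGeom γ =
        ∑ γ ∈ Γ, B n γ • oddGeom γ - c • oddGeom 1 := by
      simp only [sub_smul, Finset.sum_sub_distrib, ite_smul, zero_smul, Finset.sum_ite_eq', h1,
        if_true]
    have h3 : PowerSeries.expand 2 two_ne_zero (c • geomTail) =
        c • PowerSeries.expand 2 two_ne_zero geomTail := map_smul _ _ _
    rw [h2, map_sub, h3, T.eq n]
    nth_rewrite 1 [geomTail_eq]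
    rw [smul_add]
    abel
  · exact ((T.rat 0).regAt_zero.sub (geomTail_isRat.regAt_zero.smul c)).isRat

theorem coeff_one_eq_zero (T : RationalTower 2 two_ne_zero Γ Q B g) (h1 : 1 ∈ Γ)
    (hB : ∀ n, ∀ γ ∈ Γ, γ ≠ 1 → B n γ = 0) (h0 : B 0 1 = 0) (n : ℕ) : B n 1 = 0 := by
  have hsum : ∀ n, ∑ γ ∈ Γ, B n γ • oddGeom γ = B n 1 • oddGeom 1 := fun n =>
    Finset.sum_eq_single_of_mem 1 h1 fun γ hγ hne => by rw [hB n γ hγ hne, zero_smul]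
  have hnext : ∀ n, B n 1 = 0 → RegAt (g (n + 1)) 1 := by
    intro n hn
    have h2 := T.regAt_succ (T.regAt_neg_one n) (by rw [hsum, hn, zero_smul]; exact regAt_coe 0 _)
    simpa using h2
  induction n with
  | zero => exact h0
  | succ n ih =>
    have h2 := hnext n ih
    have h3 := T.regAt_succ_of_even even_two h2 (T.regAt_neg_one _)
    exact eq_zero_of_regAt_sum_oddGeom h1 (by norm_num) (T.regAt_sum h2 h3)

end RationalTower

/-- The coefficients of a tower of rational power series vanish, except that for `d = 2` the
coefficient of `X / (1 - X ^ 2)` may be a nonzero constant. -/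
theorem RationalTower.coeff_eq_zero {d : ℕ} {hd : d ≠ 0} {Γ : Finset ℂ} {Q : ℕ → ℂ[X]}
    {B : ℕ → ℂ → ℂ} {g : ℕ → PowerSeries ℂ} (T : RationalTower d hd Γ Q B g) (hd2 : 2 ≤ d)
    (hQ : ∀ n, (Q n).natDegree < d ∧ (Q n).coeff 0 = 0) (hΓ : ∀ γ ∈ Γ, γ ≠ 0 ∧ γ.im = 0)
    (h1 : 1 ∈ Γ) :
    (∀ n, Q n = 0) ∧ (∀ n, ∀ γ ∈ Γ, d ≠ 2 ∨ γ ≠ 1 → B n γ = 0) ∧ ∀ n, B n 1 = B 0 1 := by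
  rcases eq_or_ne d 2 with rfl | hne
  · have hB := fun n γ hγ hγ1 => T.coeff_eq_zero_of_ne_one hΓ n (γ := γ) hγ hγ1
    have T' := T.sub_geomTail h1 (B 0 1)
    have hB' : ∀ n, ∀ γ ∈ Γ, γ ≠ 1 → (B n γ - if γ = 1 then B 0 1 else 0) = 0 :=
      fun n γ hγ hγ1 => by rw [if_neg hγ1, sub_zero, hB n γ hγ hγ1]
    have hB1 := T'.coeff_one_eq_zero h1 hB' (by simp)
    refine ⟨T'.poly_eq_zero le_rfl hQ fun n γ hγ => ?_, fun n γ hγ h => ?_, fun n => ?_⟩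
    · by_cases hγ1 : γ = 1
      · rw [hγ1]
        exact hB1 n
      · exact hB' n γ hγ hγ1
    · exact hB n γ hγ (h.resolve_left (by simp))
    · simpa [sub_eq_zero] using hB1 n
  · have hreg : ∀ n β, RegAt (g n) β := by
      rcases Nat.even_or_odd d with he | ho
      · exact T.regAt_of_even (by omega) he
      · exact T.regAt_of_odd hd2 ho hΓ
    have hB := fun n γ hγ => T.coeff_eq_zero_of_regAt (fun γ hγ => (hΓ γ hγ).1) hreg n (γ := γ) hγ
    exact ⟨T.poly_eq_zero hd2 hQ hB, fun n γ hγ _ => hB n γ hγ, fun n => by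
      rw [hB n 1 h1, hB 0 1 h1]⟩

end PowerSeries

end BaseTwo

section Lacunary

open Finset

namespace PowerSeries

variable {R : Type*} [CommRing R]

/-- The power series `∑ n, v n * U (X ^ d ^ n)`, for `U` without constant coefficient. -/
def lacunary (d : ℕ) (v : ℕ → R) (U : PowerSeries R) : PowerSeries R :=
  mk fun N => ∑ n ∈ range (N + 1), if d ^ n ∣ N then v n * coeff (N / d ^ n) U else 0

theorem coeff_lacunary {d : ℕ} (hd : 2 ≤ d) (v : ℕ → R) (U : PowerSeries R)
    (hU : constantCoeff U = 0) {N K : ℕ} (hK : N ≤ K) :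
    coeff N (lacunary d v U) =
      ∑ n ∈ range K, if d ^ n ∣ N then v n * coeff (N / d ^ n) U else 0 := by
  have key : ∀ n, N ≤ n → (if d ^ n ∣ N then v n * coeff (N / d ^ n) U else 0) = 0 := by
    intro n hn
    split_ifs with h
    · rcases Nat.eq_zero_or_pos N with rfl | hN
      · simp [hU]
      · exact absurd (Nat.le_of_dvd hN h) (not_le.mpr (hn.trans_lt (Nat.lt_pow_self (by omega))))
    · rfl
  rw [lacunary, coeff_mk, sum_range_succ, key N le_rfl, add_zero]
  refine sum_subset (range_subset_range.mpr hK) fun n _ hn => key n ?_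
  simpa using hn

theorem lacunary_eq {d : ℕ} (hd : 2 ≤ d) (v : ℕ → R) (U : PowerSeries R)
    (hU : constantCoeff U = 0) :
    lacunary d v U = v 0 • U +
      PowerSeries.expand d (by omega) (lacunary d (fun n => v (n + 1)) U) := by
  ext N
  rw [coeff_lacunary hd v U hU (Nat.le_succ N), sum_range_succ', map_add, coeff_smul, add_comm]
  congr 1
  · simp
  · rw [coeff_expand]
    split_ifs with h
    · rw [coeff_lacunary hd _ U hU (Nat.div_le_self N d)]
      refine sum_congr rfl fun n _ => ?_
      obtain ⟨m, rfl⟩ := h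
      simp only [Nat.mul_div_cancel_left m (show 0 < d by omega), pow_succ',
        Nat.mul_dvd_mul_iff_left (show 0 < d by omega),
        Nat.mul_div_mul_left _ _ (show 0 < d by omega)]
    · refine sum_eq_zero fun n _ => if_neg fun h' => h (dvd_trans ?_ h')
      exact dvd_pow_self d (Nat.succ_ne_zero n)

theorem lacunary_pow {d : ℕ} (hd : 2 ≤ d) {e : ℕ} (he : 0 < e) (u : ℕ → R) (U : PowerSeries R)
    (hU : constantCoeff U = 0) :
    lacunary (d ^ e) u U = lacunary d (fun n => if e ∣ n then u (n / e) else 0) U := by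
  ext N
  rw [coeff_lacunary (hd.trans (Nat.le_self_pow he.ne' d)) u U hU le_rfl,
    coeff_lacunary hd _ U hU (Nat.le_mul_of_pos_left N he)]
  refine sum_of_injOn (e * ·) ?_ ?_ ?_ ?_
  · exact fun a _ b _ h => Nat.eq_of_mul_eq_mul_left he h
  · intro h hh
    simpa [he] using hh
  · intro n hn hne
    split_ifs with h1 h2
    · obtain ⟨m, rfl⟩ := h2
      exact absurd ⟨m, by simpa [he] using hn, rfl⟩ hne
    · rw [zero_mul]
    · rfl
  · intro h _
    simp only [← pow_mul, dvd_mul_right, if_true, Nat.mul_div_cancel_left h he]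

theorem lacunary_sub_expand_isRat {d : ℕ} (hd : 2 ≤ d) (v : ℕ → ℂ) {U : PowerSeries ℂ}
    (hU : constantCoeff U = 0) (hrat : U.IsRat) (m : ℕ) :
    (lacunary d v U - PowerSeries.expand (d ^ m) (by positivity)
      (lacunary d (fun n => v (n + m)) U)).IsRat := by
  induction m with
  | zero =>
    simp only [pow_zero, add_zero, expand_one_apply, sub_self]
    exact (by simpa using regAt_coe 0 0 : RegAt (0 : PowerSeries ℂ) 0).isRat
  | succ m ih =>
    have h1 := lacunary_eq hd (fun n => v (n + m)) U hU
    rw [h1, map_add, zero_add, expand_smul, ← expand_mul] at ih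
    have h2 := (ih.regAt_zero.add
      ((hrat.expand (d := d ^ m) (by positivity)).regAt_zero.smul (v m))).isRat
    convert h2 using 1
    simp only [pow_succ, add_assoc, add_comm 1 m]
    ring

theorem constantCoeff_oddGeom (γ : ℂ) : constantCoeff (oddGeom γ) = 0 := by
  rw [← coeff_zero_eq_constantCoeff_apply, oddGeom, coeff_mk]
  simp

/-- A Dirichlet convolution with a nonzero sequence is injective on finitely supported data. -/
theorem eq_zero_of_sum_dilate_eq_zero {J : Type*} {S : Finset J} {e : J → ℕ}
    (he : ∀ i ∈ S, 0 < e i) (hinj : Set.InjOn e S) {u : ℕ → ℂ} (hu : ∃ n, 0 < n ∧ u n ≠ 0)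
    {c : J → ℂ}
    (h : ∀ n, 0 < n → ∑ i ∈ S, c i * (if e i ∣ n then u (n / e i) else 0) = 0) :
    ∀ i ∈ S, c i = 0 := by
  classical
  by_contra! hcon
  obtain ⟨i₁, hi₁, hc₁⟩ := hcon
  obtain ⟨i₀, hi₀, hmin⟩ := (S.filter (c · ≠ 0)).exists_min_image e ⟨i₁, by simp [hi₁, hc₁]⟩
  rw [mem_filter] at hi₀
  set n₀ := Nat.find hu
  obtain ⟨hn₀, hun₀⟩ := Nat.find_spec hu
  have h1 := h (e i₀ * n₀) (Nat.mul_pos (he i₀ hi₀.1) hn₀)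
  rw [sum_eq_single_of_mem i₀ hi₀.1, if_pos (dvd_mul_right _ _),
    Nat.mul_div_cancel_left _ (he i₀ hi₀.1)] at h1
  · exact (mul_ne_zero hi₀.2 hun₀) h1
  · intro i hi hne
    by_cases hc : c i = 0
    · rw [hc, zero_mul]
    split_ifs with hdvd
    · have hle := hmin i (by simp [hi, hc])
      have hlt : e i₀ < e i := lt_of_le_of_ne hle fun heq => hne (hinj hi hi₀.1 heq.symm)
      have hu0 : u (e i₀ * n₀ / e i) = 0 := by
        by_contra hne0
        obtain ⟨m, hm⟩ := hdvd
        rw [hm, Nat.mul_div_cancel_left _ (he i hi)] at hne0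
        have hm0 : 0 < m := by
          rcases Nat.eq_zero_or_pos m with rfl | h0
          · rw [mul_zero] at hm
            exact absurd hm (Nat.mul_pos (he i₀ hi₀.1) hn₀).ne'
          · exact h0
        have hge : n₀ ≤ m := Nat.find_min' hu ⟨hm0, hne0⟩
        nlinarith
      rw [hu0, mul_zero]
    · rw [mul_zero]

/-- Algebraic independence over `ℂ(X)` of lacunary sums `∑ h, u h * U (X ^ d ^ (e * h))` attached
to the monomials `X ^ μ` and to the series `X / (1 - γ * X ^ 2)`. -/
theorem algebraicIndependent_lacunary {J : Type*} [Fintype J] {d : ℕ} (hd : 2 ≤ d) {e : J → ℕ}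
    (he : ∀ i, 0 < e i) {u : J → ℕ → ℂ} (hper : ∀ i, ∃ p, 0 < p ∧ Function.Periodic (u i) p)
    (hne : ∀ i, u i ≠ 0) {shape : J → ℕ ⊕ ℂ} (hμ : ∀ i μ, shape i = Sum.inl μ → 0 < μ ∧ μ < d)
    (hγ : ∀ i γ, shape i = Sum.inr γ → γ ≠ 0 ∧ γ.im = 0)
    (hu : ∀ i i', shape i = shape i' → u i = u i')
    (hinj : ∀ i i', shape i = shape i' → e i = e i' → i = i')
    (hexc : ∀ i, d = 2 → shape i = Sum.inr 1 → 2 ≤ e i) {t : J → ℂ} (ht : ∀ i, t i ≠ 0)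
    {U : J → PowerSeries ℂ}
    (hU : ∀ i, U i = t i • Sum.elim (fun μ => (X : PowerSeries ℂ) ^ μ) oddGeom (shape i)) :
    AlgebraicIndependent ℂ
      (Sum.elim (fun _ : Unit => X) fun i => lacunary (d ^ e i) (u i) (U i)) := by
  classical
  have hd0 : d ≠ 0 := by omega
  have hXrat : ∀ μ : ℕ, ((X : PowerSeries ℂ) ^ μ).IsRat := fun μ => by
    have h := regAt_coe (Polynomial.X ^ μ) 0
    push_cast at h
    exact h.isRat
  have hUrat : ∀ i, (U i).IsRat := fun i => by
    rw [hU i]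
    rcases shape i with μ | γ
    · exact ((hXrat μ).regAt_zero.smul _).isRat
    · exact ((regAt_oddGeom_iff (β := 0).mpr (by simp)).smul _).isRat
  have hU0 : ∀ i, constantCoeff (U i) = 0 := fun i => by
    rw [hU i, smul_eq_C_mul, map_mul]
    rcases hs : shape i with μ | γ
    · simp [(hμ i μ hs).1.ne']
    · rw [Sum.elim_inr, constantCoeff_oddGeom, mul_zero]
  choose p hp hper using hper
  set v : J → ℕ → ℂ := fun i n => if e i ∣ n then u i (n / e i) else 0 with hv
  have hfv : ∀ i, lacunary (d ^ e i) (u i) (U i) = lacunary d (v i) (U i) := fun i =>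
    lacunary_pow hd (he i) _ _ (hU0 i)
  simp only [hfv]
  set M := ∏ i, e i * p i with hMdef
  have hM : 0 < M := prod_pos fun i _ => Nat.mul_pos (he i) (hp i)
  have hvper : ∀ i n, v i (n + M) = v i n := by
    intro i n
    obtain ⟨m, hm⟩ : e i * p i ∣ M := dvd_prod_of_mem (fun i => e i * p i) (mem_univ i)
    have h1 : n + M = n + e i * (m * p i) := by rw [hm]; ring
    simp only [hv, h1, Nat.dvd_add_left (dvd_mul_right (e i) _), Nat.add_mul_div_left _ _ (he i)]
    congr 1
    simpa using (hper i).nat_mul m (n / e i)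
  have hq : 2 ≤ d ^ M := hd.trans (Nat.le_self_pow hM.ne' d)
  refine algebraicIndependent_of_isRat hq _ (fun i => ?_) fun c hc => ?_
  · have := lacunary_sub_expand_isRat hd (v i) (hU0 i) (hUrat i) M
    simpa only [hvper] using this
  set g : ℕ → PowerSeries ℂ := fun n => ∑ i, c i • lacunary d (fun m => v i (m + n)) (U i) with hg
  set A : ℕ ⊕ ℂ → ℕ → ℂ := fun s n => ∑ i, if shape i = s then c i * t i * v i n else 0 with hA
  set Γ : Finset ℂ := insert 1
    ((univ.image shape).preimage Sum.inr Sum.inr_injective.injOn) with hΓdef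
  set Q : ℕ → Polynomial ℂ := fun n => ∑ μ ∈ Ioo 0 d, Polynomial.monomial μ (A (Sum.inl μ) n)
    with hQ
  have T : RationalTower d hd0 Γ Q (fun n γ => A (Sum.inr γ) n) g := by
    refine RationalTower.of_periodic hM (fun n => ?_) (fun n => ?_) ?_
    · simp only [hg, ← add_assoc, hvper]
    · have h1 : ∀ i, (c i * v i n) • U i =
          ∑ μ ∈ Ioo 0 d, (if shape i = Sum.inl μ then c i * t i * v i n else 0) •
            (X : PowerSeries ℂ) ^ μ +
          ∑ γ ∈ Γ, (if shape i = Sum.inr γ then c i * t i * v i n else 0) • oddGeom γ := by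
        intro i
        rw [hU i, smul_smul]
        rcases hs : shape i with μ | γ
        · rw [sum_eq_single_of_mem μ (by simpa using hμ i μ hs)
              (fun μ' _ hne => by simp [hne.symm]),
            sum_eq_zero (fun γ _ => by simp), if_pos rfl, add_zero, Sum.elim_inl]
          congr 1
          ring
        · have hmem : γ ∈ Γ := by
            rw [hΓdef, mem_insert, mem_preimage]
            exact Or.inr (mem_image.mpr ⟨i, mem_univ _, hs⟩)
          rw [sum_eq_single_of_mem γ hmem (fun γ' _ hne => by simp [hne.symm]),
            sum_eq_zero (fun γ _ => by simp), if_pos rfl, zero_add, Sum.elim_inr]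
          congr 1
          ring
      have h2 : (Q n : PowerSeries ℂ) = ∑ μ ∈ Ioo 0 d, ∑ i,
          (if shape i = Sum.inl μ then c i * t i * v i n else 0) • (X : PowerSeries ℂ) ^ μ := by
        rw [hQ, ← Polynomial.coeToPowerSeries.ringHom_apply, map_sum]
        refine sum_congr rfl fun μ _ => ?_
        rw [Polynomial.coeToPowerSeries.ringHom_apply, Polynomial.coe_monomial,
          ← sum_smul]
        ext m
        rw [coeff_monomial, coeff_smul, coeff_X_pow, smul_eq_mul, mul_ite, mul_one, mul_zero]
      have h3 : ∑ γ ∈ Γ, A (Sum.inr γ) n • oddGeom γ = ∑ γ ∈ Γ, ∑ i,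
          (if shape i = Sum.inr γ then c i * t i * v i n else 0) • oddGeom γ := by
        simp only [hA, sum_smul]
      rw [h2, h3, sum_comm, sum_comm (s := Γ), ← sum_add_distrib]
      simp only [← h1, hg, map_sum, expand_smul, ← sum_add_distrib]
      refine sum_congr rfl fun i _ => ?_
      rw [lacunary_eq hd _ _ (hU0 i), smul_add, smul_smul, zero_add]
      simp only [add_assoc, add_comm 1 n]
    · simpa only [hg, add_zero] using hc
  have hcoeff : ∀ n μ, (Q n).coeff μ = if μ ∈ Ioo 0 d then A (Sum.inl μ) n else 0 := by
    intro n μ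
    simp only [hQ, Polynomial.finsetSum_coeff, Polynomial.coeff_monomial, sum_ite_eq']
  have hΓ : ∀ γ ∈ Γ, γ ≠ 0 ∧ γ.im = 0 := by
    intro γ h
    rw [hΓdef, mem_insert, mem_preimage, mem_image] at h
    rcases h with rfl | ⟨i, _, hi⟩
    · simp
    · exact hγ i γ hi
  have hdeg : ∀ n, (Q n).natDegree < d := by
    intro n
    have : (Q n).natDegree ≤ d - 1 := Polynomial.natDegree_sum_le_of_forall_le _ _ fun μ h =>
      (Polynomial.natDegree_monomial_le _).trans (by rw [mem_Ioo] at h; omega)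
    omega
  obtain ⟨hQ0, hB0, hB1⟩ := T.coeff_eq_zero hd (fun n => ⟨hdeg n, by simp [hcoeff]⟩) hΓ
    (mem_insert_self _ _)
  funext i
  have hA0 : ∀ n, A (shape i) n = 0 := by
    intro n
    rcases hs : shape i with μ | γ
    · have h1 := hcoeff n μ
      rwa [hQ0, Polynomial.coeff_zero, if_pos (by simpa using hμ i μ hs), eq_comm] at h1
    · by_cases h1 : d ≠ 2 ∨ γ ≠ 1
      · refine hB0 n γ ?_ h1
        rw [hΓdef, mem_insert, mem_preimage]
        exact Or.inr (mem_image.mpr ⟨i, mem_univ _, hs⟩)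
      · push Not at h1
        obtain ⟨hd2, rfl⟩ := h1
        have h2 : A (Sum.inr 1) 1 = 0 := sum_eq_zero fun j _ => by
          split_ifs with hj
          · have h3 := hexc j hd2 hj
            have h4 : ¬ e j ∣ 1 := fun h => by
              have := Nat.le_of_dvd one_pos h
              omega
            simp only [hv, h4, if_false, mul_zero]
          · rfl
        exact (hB1 n).trans ((hB1 1).symm.trans h2)
  have hS := eq_zero_of_sum_dilate_eq_zero (S := univ.filter (shape · = shape i)) (e := e)
    (u := u i) (c := fun j => c j * t j) (fun j _ => he j) (fun j hj j' hj' h => ?_) ?_ ?_ i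
    (by simp)
  · exact (mul_eq_zero.mp hS).resolve_right (ht i)
  · simp only [coe_filter, mem_univ, true_and, Set.mem_ofPred_eq] at hj hj'
    exact hinj j j' (hj.trans hj'.symm) h
  · obtain ⟨n, hn⟩ := Function.ne_iff.mp (hne i)
    exact ⟨n + p i, by have := hp i; omega, by rwa [hper i n]⟩
  · intro n _
    rw [sum_filter]
    refine Eq.trans ?_ (hA0 n)
    refine sum_congr rfl fun j _ => ?_
    by_cases h1 : shape j = shape i
    · simp only [hv, hu j i h1, if_pos h1]
    · simp only [if_neg h1]

end PowerSeries

end Lacunary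

section LacunaryValues

open Filter Topology Asymptotics

open PowerSeries (lacunary oddGeom)

theorem HasAsymp.const_mul {F : ℂ → ℂ} {f : PowerSeries ℂ} (h : HasAsymp F f) (t : ℂ) :
    HasAsymp (fun x => t * F x) (t • f) := by
  intro s
  obtain ⟨p, hp, hO⟩ := h s
  refine ⟨t • p, fun n hn => by simp [hp n hn], (hO.const_mul_left t).congr_left fun x => ?_⟩
  rw [Polynomial.eval_smul, smul_eq_mul, mul_sub]

theorem hasAsymp_pow (μ : ℕ) : HasAsymp (fun x => x ^ μ) (PowerSeries.X ^ μ) := by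
  refine fun s => ⟨Polynomial.X ^ μ, fun n _ => ?_, ?_⟩
  · rw [Polynomial.coeff_X_pow, PowerSeries.coeff_X_pow]
  · simpa using isBigO_zero _ _

theorem hasAsymp_oddGeom (γ : ℂ) : HasAsymp (fun x => x / (1 - γ * x ^ 2)) (oddGeom γ) := by
  intro s
  have hcont : ContinuousAt (fun x : ℂ => 1 - γ * x ^ 2) 0 := by fun_prop
  have hev : ∀ᶠ x : ℂ in 𝓝 0, 1 - γ * x ^ 2 ≠ 0 := hcont.eventually_ne (by simp)
  induction s with
  | zero =>
    refine ⟨0, by simp, ?_⟩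
    have h : ContinuousAt (fun x : ℂ => x / (1 - γ * x ^ 2)) 0 :=
      continuousAt_id.div hcont (by simp)
    simpa using h.isBigO_one ℝ
  | succ s ih =>
    obtain ⟨p, hp, hO⟩ := ih
    refine ⟨Polynomial.X + Polynomial.C γ * Polynomial.X ^ 2 * p, fun n hn => ?_, ?_⟩
    · have h := congrArg (PowerSeries.coeff n) (PowerSeries.mul_oddGeom γ)
      push_cast at h
      rw [sub_mul, one_mul, map_sub, sub_eq_iff_eq_add] at h
      rw [h, Polynomial.coeff_add, Polynomial.coeff_X, PowerSeries.coeff_X, mul_assoc, mul_assoc,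
        Polynomial.coeff_C_mul, PowerSeries.coeff_C_mul, Polynomial.coeff_X_pow_mul',
        PowerSeries.coeff_X_pow_mul']
      congr 2
      · exact propext eq_comm
      · split_ifs with h2
        · exact hp _ (by omega)
        · rfl
    · have h1 : (fun x : ℂ => γ * x ^ 2 * (x / (1 - γ * x ^ 2) - p.eval x)) =O[𝓝 0]
          fun x => ‖x‖ ^ (s + 1) := by
        have h2 : (fun x : ℂ => γ * x ^ 2) =O[𝓝 0] fun x => ‖x‖ := by
          have h3 : (fun x : ℂ => x * (γ * x)) =O[𝓝 0] fun x => ‖x‖ * (1 : ℝ) := by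
            refine (isBigO_refl _ _).norm_right.mul ?_
            have h4 : ContinuousAt (fun x : ℂ => γ * x) 0 := by fun_prop
            exact h4.isBigO_one ℝ
          simpa using h3.congr_left fun x => by ring
        exact (h2.mul hO).congr_right fun x => by ring
      refine h1.congr' ?_ EventuallyEq.rfl
      filter_upwards [hev] with x hx
      simp only [Polynomial.eval_add, Polynomial.eval_X, Polynomial.eval_mul, Polynomial.eval_C,
        Polynomial.eval_pow]
      field_simp
      ring

theorem HasAsymp.isBigO {F : ℂ → ℂ} {f : PowerSeries ℂ} (h : HasAsymp F f)
    (hf : PowerSeries.constantCoeff f = 0) : F =O[𝓝 0] fun x => ‖x‖ := by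
  obtain ⟨p, hp, hO⟩ := h 1
  obtain ⟨p', rfl⟩ := Polynomial.X_dvd_iff.mpr ((hp 0 one_pos).trans (by simpa using hf))
  have h1 : (fun x : ℂ => (Polynomial.X * p').eval x) =O[𝓝 0] fun x => ‖x‖ := by
    have h2 : (fun x : ℂ => x * p'.eval x) =O[𝓝 0] fun x => ‖x‖ * (1 : ℝ) :=
      (isBigO_refl _ _).norm_right.mul (p'.continuous.continuousAt.isBigO_one ℝ)
    simpa using h2
  simpa using (hO.add (h1.congr_right fun x => (pow_one _).symm))

theorem HasAsymp.exists_bound {F : ℂ → ℂ} {f : PowerSeries ℂ} (h : HasAsymp F f)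
    (hf : PowerSeries.constantCoeff f = 0) :
    ∃ C δ : ℝ, 0 ≤ C ∧ 0 < δ ∧ δ ≤ 1 / 2 ∧ ∀ x, ‖x‖ ≤ δ → ‖F x‖ ≤ C * ‖x‖ := by
  obtain ⟨C, hC, hb⟩ := (h.isBigO hf).exists_nonneg
  obtain ⟨ε, hε, hε'⟩ := Metric.eventually_nhds_iff.mp hb.bound
  refine ⟨C, min (ε / 2) (1 / 2), hC, by positivity, min_le_right _ _, fun x hx => ?_⟩
  have := hε' (y := x) (by
    rw [dist_zero_right]
    exact (hx.trans (min_le_left _ _)).trans_lt (half_lt_self hε))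
  simpa using this

theorem HasAsymp.lacunary {F : ℂ → ℂ} {f : PowerSeries ℂ} (h : HasAsymp F f)
    (hf : PowerSeries.constantCoeff f = 0) {r : ℕ} (hr : 2 ≤ r) {u : ℕ → ℂ} {B : ℝ}
    (hB : ∀ n, ‖u n‖ ≤ B) :
    HasAsymp (fun x => ∑' n, u n * F (x ^ r ^ n)) (lacunary r u f) := by
  intro s
  obtain ⟨C, δ, hC, hδ, hδ2, hF⟩ := h.exists_bound hf
  have hB0 : 0 ≤ B := (norm_nonneg _).trans (hB 0)
  have hterm : ∀ x : ℂ, ‖x‖ ≤ δ → ∀ n, ‖u n * F (x ^ r ^ n)‖ ≤ B * C * ‖x‖ ^ n := by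
    intro x hx n
    have hx1 : ‖x‖ ≤ 1 := by linarith
    have h1 : ‖x ^ r ^ n‖ ≤ ‖x‖ ^ n := by
      rw [norm_pow]
      exact pow_le_pow_of_le_one (norm_nonneg _) hx1 (Nat.lt_pow_self (by omega)).le
    have h2 : ‖x ^ r ^ n‖ ≤ δ := by
      rw [norm_pow]
      exact (pow_le_of_le_one (norm_nonneg _) hx1 (by positivity)).trans hx
    rw [norm_mul, mul_assoc]
    exact mul_le_mul (hB n) ((hF _ h2).trans (by gcongr)) (norm_nonneg _) hB0
  obtain ⟨p, hp, hO⟩ := h s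
  refine ⟨∑ n ∈ Finset.range s, Polynomial.C (u n) * Polynomial.expand ℂ (r ^ n) p,
    fun m hm => ?_, ?_⟩
  · rw [PowerSeries.coeff_lacunary hr u f hf hm.le, Polynomial.finsetSum_coeff]
    refine Finset.sum_congr rfl fun n _ => ?_
    rw [Polynomial.coeff_C_mul, Polynomial.coeff_expand (by positivity), mul_ite, mul_zero]
    split_ifs with h1
    · rw [hp _ ((Nat.div_le_self _ _).trans_lt hm)]
    · rfl
  · have h1 : (fun x : ℂ => ∑ n ∈ Finset.range s,
        u n * (F (x ^ r ^ n) - p.eval (x ^ r ^ n))) =O[𝓝 0] fun x => ‖x‖ ^ s := by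
      refine IsBigO.fun_sum fun n _ => IsBigO.const_mul_left ?_ _
      have hne : r ^ n ≠ 0 := by positivity
      have h2 : Tendsto (fun x : ℂ => x ^ r ^ n) (𝓝 0) (𝓝 0) := by
        have : ContinuousAt (fun x : ℂ => x ^ r ^ n) 0 := by fun_prop
        simpa [ContinuousAt, zero_pow hne] using this
      refine (hO.comp_tendsto h2).trans (IsBigO.of_bound 1 ?_)
      filter_upwards [Metric.closedBall_mem_nhds (0 : ℂ) one_pos] with x hx
      rw [mem_closedBall_zero_iff] at hx
      simp only [Function.comp_apply, norm_pow, norm_norm, one_mul, ← pow_mul]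
      exact pow_le_pow_of_le_one (norm_nonneg _) hx
        (Nat.le_mul_of_pos_left _ (by positivity))
    have h2 : (fun x : ℂ => ∑' n, u (n + s) * F (x ^ r ^ (n + s))) =O[𝓝 0]
        fun x => ‖x‖ ^ s := by
      refine IsBigO.of_bound (B * C * 2) ?_
      filter_upwards [Metric.closedBall_mem_nhds (0 : ℂ) hδ] with x hx
      rw [mem_closedBall_zero_iff] at hx
      have hx1 : ‖x‖ < 1 := by linarith
      have h3 : HasSum (fun n => B * C * ‖x‖ ^ s * ‖x‖ ^ n) (B * C * ‖x‖ ^ s * (1 - ‖x‖)⁻¹) :=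
        (hasSum_geometric_of_lt_one (norm_nonneg _) hx1).mul_left _
      refine (tsum_of_norm_bounded h3 fun n => ?_).trans ?_
      · exact (hterm x hx (n + s)).trans_eq (by rw [pow_add]; ring)
      · rw [norm_pow, norm_norm, mul_right_comm (B * C)]
        gcongr
        rw [inv_le_comm₀ (by linarith) two_pos]
        linarith
    refine (h1.add h2).congr' ?_ EventuallyEq.rfl
    filter_upwards [Metric.closedBall_mem_nhds (0 : ℂ) hδ] with x hx
    rw [mem_closedBall_zero_iff] at hx
    have hx1 : ‖x‖ < 1 := by linarith
    have hsum : Summable fun n => u n * F (x ^ r ^ n) :=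
      Summable.of_norm_bounded ((summable_geometric_of_lt_one (norm_nonneg _) hx1).mul_left _)
        (hterm x hx)
    rw [← hsum.sum_add_tsum_nat_add s, Polynomial.eval_finsetSum]
    simp only [Polynomial.eval_mul, Polynomial.eval_C, Polynomial.expand_eval, mul_sub,
      Finset.sum_sub_distrib]
    ring

theorem HasAsymp.summable {F : ℂ → ℂ} {f : PowerSeries ℂ} (h : HasAsymp F f)
    (hf : PowerSeries.constantCoeff f = 0) {r : ℕ} (hr : 2 ≤ r) {u : ℕ → ℂ} {B : ℝ}
    (hB : ∀ n, ‖u n‖ ≤ B) {x : ℂ} (hx : ‖x‖ < 1) : Summable fun n => u n * F (x ^ r ^ n) := by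
  obtain ⟨C, δ, hC, hδ, -, hF⟩ := h.exists_bound hf
  have hB0 : 0 ≤ B := (norm_nonneg _).trans (hB 0)
  refine Summable.of_norm_bounded_eventually_nat
    ((summable_geometric_of_lt_one (norm_nonneg _) hx).mul_left (B * C)) ?_
  have h1 : ∀ n, ‖x ^ r ^ n‖ ≤ ‖x‖ ^ n := fun n => by
    rw [norm_pow]
    exact pow_le_pow_of_le_one (norm_nonneg _) hx.le (Nat.lt_pow_self (by omega)).le
  filter_upwards [(tendsto_pow_atTop_nhds_zero_of_lt_one (norm_nonneg x) hx).eventually_le_const hδ]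
    with n hn
  rw [norm_mul, mul_assoc]
  exact mul_le_mul (hB n) ((hF _ ((h1 n).trans hn)).trans (by gcongr; exact h1 n))
    (norm_nonneg _) hB0

end LacunaryValues

section HeightArithmetic

variable {K : Type*} [Field K] [Algebra ℚ K]

theorem HeightLE.zero : HeightLE (0 : K) 1 :=
  ⟨1, one_pos, by simp, by simpa using isIntegral_zero, fun σ => by simp⟩

theorem HeightLE.mul {x y : K} {B B' : ℝ} (hx : HeightLE x B) (hy : HeightLE y B') :
    HeightLE (x * y) (B * B') := by
  have hB : 0 ≤ B := zero_le_one.trans hx.one_le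
  obtain ⟨D, hD, hDB, hint, hconj⟩ := hx
  obtain ⟨D', hD', hDB', hint', hconj'⟩ := hy
  refine ⟨D * D', Nat.mul_pos hD hD', ?_, ?_, fun σ => ?_⟩
  · push_cast
    gcongr
  · have h : ((D * D' : ℕ) : K) * (x * y) = (D * x) * (D' * y) := by push_cast; ring
    rw [h]
    exact hint.mul hint'
  · rw [map_mul, norm_mul]
    exact mul_le_mul (hconj σ) (hconj' σ) (norm_nonneg _) ((norm_nonneg _).trans (hconj σ))

theorem HeightLE.add {x y : K} {B B' : ℝ} (hx : HeightLE x B) (hy : HeightLE y B') :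
    HeightLE (x + y) (2 * (B * B')) := by
  have h1 := hx.one_le
  have h2 := hy.one_le
  obtain ⟨D, hD, hDB, hint, hconj⟩ := hx
  obtain ⟨D', hD', hDB', hint', hconj'⟩ := hy
  refine ⟨D * D', Nat.mul_pos hD hD', ?_, ?_, fun σ => ?_⟩
  · have : (D : ℝ) * D' ≤ B * B' := by gcongr
    push_cast
    nlinarith
  · have h : ((D * D' : ℕ) : K) * (x + y) = D' * (D * x) + D * (D' * y) := by push_cast; ring
    rw [h]
    exact ((isIntegral_natCast _).mul hint).add ((isIntegral_natCast _).mul hint')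
  · rw [map_add]
    refine (norm_add_le _ _).trans ?_
    nlinarith [hconj σ, hconj' σ]

theorem HeightLE.inv_natCast {n : ℕ} (hn : 0 < n) : HeightLE ((n : K)⁻¹) n := by
  have : CharZero K := algebraRat.charZero K
  have hn1 : (1 : ℝ) ≤ n := by exact_mod_cast hn
  refine ⟨n, hn, le_rfl, ?_, fun σ => ?_⟩
  · rw [mul_inv_cancel₀ (by exact_mod_cast hn.ne')]
    exact isIntegral_one
  · rw [map_inv₀, map_natCast, norm_inv, Complex.norm_natCast]
    exact (inv_le_one_of_one_le₀ hn1).trans hn1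

theorem exists_heightLE [FiniteDimensional ℚ K] (x : K) : ∃ B, HeightLE x B := by
  have : CharZero K := algebraRat.charZero K
  obtain ⟨m, hm, hint⟩ := exists_integral_multiples ℤ ℚ {x}
  refine ⟨m.natAbs + ∑ σ : K →ₐ[ℚ] ℂ, ‖σ x‖, m.natAbs, Int.natAbs_pos.mpr hm,
    le_add_of_nonneg_right (by positivity), ?_, fun σ => ?_⟩
  · have h := hint x (Finset.mem_singleton_self x)
    rw [zsmul_eq_mul] at h
    rcases Int.natAbs_eq m with h1 | h1
    · rw [h1] at h
      simpa using h
    · rw [h1] at h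
      simpa using h.neg
  · refine le_add_of_nonneg_of_le (by positivity) ?_
    exact Finset.single_le_sum (f := fun σ : K →ₐ[ℚ] ℂ => ‖σ x‖)
      (fun _ _ => norm_nonneg _) (Finset.mem_univ σ)

theorem HeightLE.exp_one_le {x : K} {c : ℝ} (h : HeightLE x (Real.exp c)) : 0 ≤ c :=
  Real.one_le_exp_iff.mp h.one_le

/-- Partial sums of a sequence whose heights grow at most exponentially in `r ^ h`. -/
theorem exists_heightLE_sum {y : ℕ → K} {r : ℕ} (hr : 2 ≤ r) {c : ℝ}
    (hy : ∀ h, HeightLE (y h) (Real.exp (c * (r : ℝ) ^ h))) (H : ℕ) :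
    HeightLE (∑ h ∈ Finset.range H, y h) (Real.exp ((c + Real.log 2) * (r : ℝ) ^ H)) := by
  have hc : 0 ≤ c := by simpa using (hy 0).exp_one_le
  have h2 : 0 ≤ Real.log 2 := Real.log_nonneg one_le_two
  have hr' : (2 : ℝ) ≤ r := by exact_mod_cast hr
  induction H with
  | zero => exact HeightLE.zero.mono (by rw [Real.one_le_exp_iff]; positivity)
  | succ H ih =>
    rw [Finset.sum_range_succ]
    refine (ih.add (hy H)).mono ?_
    rw [← Real.exp_add, ← Real.exp_log two_pos, ← Real.exp_add, Real.exp_le_exp,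
      Real.exp_log two_pos, pow_succ]
    have h3 : (1 : ℝ) ≤ (r : ℝ) ^ H := one_le_pow₀ (by linarith)
    nlinarith [mul_nonneg (add_nonneg hc h2) (sub_nonneg.mpr h3),
      mul_nonneg h2 (sub_nonneg.mpr h3),
      mul_nonneg (mul_nonneg (add_nonneg hc h2) (sub_nonneg.mpr hr')) (zero_le_one.trans h3)]

end HeightArithmetic

section LacunaryIndependence

open Filter Topology

open PowerSeries (lacunary oddGeom)

theorem NotPerfectPower.eq_of_pow_eq {d d' : ℕ} (hd : NotPerfectPower d) (hd' : NotPerfectPower d')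
    {a b : ℕ} (ha : 0 < a) (hb : 0 < b) (h : d ^ a = d' ^ b) : d = d' := by
  obtain ⟨g, m, n, hg, hmn, rfl, rfl⟩ := Nat.exists_coprime' (Nat.gcd_pos_of_pos_left b ha)
  have h1 : d ^ m = d' ^ n := by
    rw [pow_mul, pow_mul] at h
    exact Nat.pow_left_injective hg.ne' h
  obtain ⟨c, hc, hc'⟩ := Nat.exists_eq_pow_of_exponent_coprime_of_pow_eq_pow hmn h1
  have hm := Nat.pos_of_mul_pos_right ha
  have hn := Nat.pos_of_mul_pos_right hb
  have hn1 : n = 1 := by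
    by_contra hne
    exact hd.2 c n (by omega) hc
  have hm1 : m = 1 := by
    by_contra hne
    exact hd'.2 c m (by omega) hc'
  rw [hc, hc', hn1, hm1]

theorem Function.Periodic.exists_norm_le {u : ℕ → ℂ} {p : ℕ} (hp : 0 < p)
    (hu : Function.Periodic u p) : ∃ B, ∀ n, ‖u n‖ ≤ B := by
  refine ⟨∑ i ∈ Finset.range p, ‖u i‖, fun n => ?_⟩
  rw [← hu.map_mod_nat n]
  exact Finset.single_le_sum (f := fun i => ‖u i‖) (fun _ _ => norm_nonneg _)
    (Finset.mem_range.mpr (Nat.mod_lt n hp))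

theorem exists_map_eq_of_coeff_mem (K : IntermediateField ℚ ℂ) {F : PowerSeries ℂ}
    (hF : ∀ n, PowerSeries.coeff n F ∈ K) :
    ∃ f : PowerSeries K, PowerSeries.map (algebraMap K ℂ) f = F :=
  ⟨PowerSeries.mk fun n => ⟨_, hF n⟩, by ext n; simp⟩

theorem coeff_lacunary_mem {K : IntermediateField ℚ ℂ} {r : ℕ} {u : ℕ → ℂ} (hu : ∀ h, u h ∈ K)
    {U : PowerSeries ℂ} (hU : ∀ n, PowerSeries.coeff n U ∈ K) (n : ℕ) :
    PowerSeries.coeff n (lacunary r u U) ∈ K := by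
  rw [lacunary, PowerSeries.coeff_mk]
  refine sum_mem fun h _ => ?_
  split_ifs
  · exact mul_mem (hu h) (hU _)
  · exact zero_mem K

theorem algebraicIndependent_tsum_lacunary {J : Type*} [Finite J] {α : ℝ} (hα0 : 0 < α)
    (hα1 : α < 1) (K : IntermediateField ℚ ℂ) [FiniteDimensional ℚ K] {αK : K}
    (hαK : (αK : ℂ) = α) (hint : IsIntegral ℤ αK) {d e : J → ℕ}
    (hd : ∀ j, NotPerfectPower (d j)) (he : ∀ j, 0 < e j) {u : J → ℕ → ℂ}
    (hper : ∀ j, ∃ p, 0 < p ∧ Function.Periodic (u j) p) (hne : ∀ j, u j ≠ 0)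
    {shape : J → ℕ ⊕ ℂ} (hμ : ∀ j μ, shape j = Sum.inl μ → 0 < μ ∧ μ < d j)
    (hγ : ∀ j γ, shape j = Sum.inr γ → γ ≠ 0 ∧ γ.im = 0)
    (hu : ∀ j j', d j = d j' → shape j = shape j' → u j = u j')
    (hinj : ∀ j j', d j = d j' → shape j = shape j' → e j = e j' → j = j')
    (hexc : ∀ j, d j = 2 → shape j = Sum.inr 1 → 2 ≤ e j) {t : J → ℂ} (ht : ∀ j, t j ≠ 0)
    (huK : ∀ j h, u j h ∈ K) (htK : ∀ j, t j ∈ K) (hγK : ∀ j γ, shape j = Sum.inr γ → γ ∈ K)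
    (y : J → ℕ → K)
    (hy : ∀ j, ∀ᶠ h in atTop, (y j h : ℂ) = u j h * (t j * Sum.elim
      (fun μ => ((α : ℂ) ^ (d j ^ e j) ^ h) ^ μ)
      (fun γ => (α : ℂ) ^ (d j ^ e j) ^ h / (1 - γ * ((α : ℂ) ^ (d j ^ e j) ^ h) ^ 2)) (shape j)))
    (hheight : ∀ j, ∃ c : ℝ, ∀ h, HeightLE (y j h) (Real.exp (c * ((d j ^ e j : ℕ) : ℝ) ^ h))) :
    AlgebraicIndependent ℚ fun j => ∑' h, (y j h : ℂ) := by
  classical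
  cases nonempty_fintype J
  rcases isEmpty_or_nonempty J with hJ | hJ
  · exact algebraicIndependent_empty_type_iff.mpr (algebraMap ℚ ℂ).injective
  choose p hp hper using hper
  choose B hB using fun j => (hper j).exists_norm_le (hp j)
  set U : J → PowerSeries ℂ :=
    fun j => t j • Sum.elim (fun μ => (PowerSeries.X : PowerSeries ℂ) ^ μ) oddGeom (shape j) with hU
  set G : J → ℂ → ℂ := fun j x =>
    t j * Sum.elim (fun μ => x ^ μ) (fun γ => x / (1 - γ * x ^ 2)) (shape j) with hG
  have hGU : ∀ j, HasAsymp (G j) (U j) := by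
    intro j
    simp only [hG, hU]
    rcases shape j with μ | γ
    · exact (hasAsymp_pow μ).const_mul _
    · exact (hasAsymp_oddGeom γ).const_mul _
  have hU0 : ∀ j, PowerSeries.constantCoeff (U j) = 0 := by
    intro j
    simp only [hU, PowerSeries.smul_eq_C_mul, map_mul]
    rcases hs : shape j with μ | γ
    · simp [(hμ j μ hs).1.ne']
    · rw [Sum.elim_inr, PowerSeries.constantCoeff_oddGeom, mul_zero]
  have hUK : ∀ j n, PowerSeries.coeff n (U j) ∈ K := by
    intro j n
    simp only [hU, map_smul, smul_eq_mul]
    refine mul_mem (htK j) ?_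
    rcases hs : shape j with μ | γ
    · rw [Sum.elim_inl, PowerSeries.coeff_X_pow]
      split_ifs
      · exact one_mem K
      · exact zero_mem K
    · rw [Sum.elim_inr, oddGeom, PowerSeries.coeff_mk]
      split_ifs
      · exact pow_mem (hγK j γ hs) _
      · exact zero_mem K
  choose f hf using fun j => exists_map_eq_of_coeff_mem K
    (coeff_lacunary_mem (r := d j ^ e j) (huK j) (hUK j))
  have hr : ∀ j, 2 ≤ d j ^ e j := fun j => (hd j).1.trans (Nat.le_self_pow (he j).ne' _)
  set M := ∏ j, e j * p j with hMdef
  have hM : 0 < M := Finset.prod_pos fun j _ => Nat.mul_pos (he j) (hp j)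
  have hdvd : ∀ j, ∃ m, M = e j * (p j * m) := fun j => by
    obtain ⟨m, hm⟩ : e j * p j ∣ M :=
      Finset.dvd_prod_of_mem (fun j => e j * p j) (Finset.mem_univ j)
    exact ⟨m, by rw [hm, mul_assoc]⟩
  choose m hm using hdvd
  have hpm : ∀ j, 0 < p j * m j := fun j => by
    rw [hm j] at hM
    exact Nat.pos_of_mul_pos_left hM
  have hpow : ∀ j n, (d j ^ e j) ^ (p j * m j * n) = (d j ^ M) ^ n := fun j n => by
    rw [hm j, ← pow_mul, ← pow_mul]
    ring_nf
  have : Nonempty {i // i ∈ Finset.univ.image d} :=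
    hJ.map fun j => ⟨d j, Finset.mem_image_of_mem d (Finset.mem_univ j)⟩
  have key := algebraicIndependent_of_hasAsymp (ι := {i // i ∈ Finset.univ.image d})
    (q := fun i => (i : ℕ) ^ M) ?_ ?_ hα0 hα1 hαK hint
    (fun j => ⟨d j, Finset.mem_image_of_mem d (Finset.mem_univ j)⟩) f
    (fun j x => ∑' h, u j h * G j (x ^ (d j ^ e j) ^ h)) (fun j => ?_) ?_
    (fun j => ∑' h, (y j h : ℂ)) (fun j n => ∑ h ∈ Finset.range (p j * m j * n), y j h) ?_ ?_
  · exact key.restrictScalars (algebraMap ℚ K).injective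
  · rintro ⟨i, hi⟩
    obtain ⟨j, -, rfl⟩ := Finset.mem_image.mp hi
    exact (hd j).1.trans (Nat.le_self_pow hM.ne' _)
  · rintro ⟨i, hi⟩ ⟨i', hi'⟩ hii' a b ha hb h
    obtain ⟨j, -, rfl⟩ := Finset.mem_image.mp hi
    obtain ⟨j', -, rfl⟩ := Finset.mem_image.mp hi'
    rw [← pow_mul, ← pow_mul] at h
    exact hii' (Subtype.ext ((hd j).eq_of_pow_eq (hd j') (Nat.mul_pos hM ha)
      (Nat.mul_pos hM hb) h))
  · rw [hf j]
    exact (hGU j).lacunary (hU0 j) (hr j) (hB j)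
  · rintro ⟨i, hi⟩
    have hdi : ∀ j : {j // (⟨d j, Finset.mem_image_of_mem d (Finset.mem_univ j)⟩ :
        {i // i ∈ Finset.univ.image d}) = ⟨i, hi⟩}, d j.1 = i := fun j => congrArg Subtype.val j.2
    have hi2 : 2 ≤ i := by
      obtain ⟨j, -, rfl⟩ := Finset.mem_image.mp hi
      exact (hd j).1
    have h := PowerSeries.algebraicIndependent_lacunary hi2 (J := {j // (⟨d j,
      Finset.mem_image_of_mem d (Finset.mem_univ j)⟩ : {i // i ∈ Finset.univ.image d}) = ⟨i, hi⟩})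
      (e := fun j => e j.1) (fun j => he j) (u := fun j => u j.1)
      (fun j => ⟨p j, hp j, hper j⟩) (fun j => hne j) (shape := fun j => shape j.1)
      (fun j μ hs => hdi j ▸ hμ j μ hs) (fun j => hγ j)
      (fun j j' hs => hu j j' ((hdi j).trans (hdi j').symm) hs)
      (fun j j' hs h' => Subtype.ext (hinj j j' ((hdi j).trans (hdi j').symm) hs h'))
      (fun j h2 => hexc j ((hdi j).trans h2)) (t := fun j => t j.1) (fun j => ht j)
      (U := fun j => U j.1) (fun j => rfl)
    convert h using 3 with j
    rw [hf j, hdi j]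
  · intro j
    obtain ⟨N, hN⟩ := eventually_atTop.mp (hy j)
    have hα : ‖(α : ℂ)‖ < 1 := by
      rwa [Complex.norm_real, Real.norm_of_nonneg hα0.le]
    have hsum : Summable fun h => (y j h : ℂ) := by
      rw [← summable_nat_add_iff N]
      refine ((summable_nat_add_iff N).mpr
        ((hGU j).summable (hU0 j) (hr j) (hB j) hα)).congr fun h => ?_
      exact (hN _ (Nat.le_add_left _ _)).symm
    filter_upwards [eventually_ge_atTop N] with n hn
    rw [← hsum.sum_add_tsum_nat_add (p j * m j * n)]
    congr 1
    · exact (map_sum (algebraMap K ℂ) _ _).symm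
    · refine tsum_congr fun h => ?_
      rw [hN _ ((hn.trans (Nat.le_mul_of_pos_left n (hpm j))).trans (Nat.le_add_left _ _))]
      have h1 : u j (h + p j * m j * n) = u j h := by
        rw [show h + p j * m j * n = h + (m j * n) * p j by ring]
        simpa using (hper j).nat_mul (m j * n) h
      rw [h1, pow_add, hpow, mul_comm ((d j ^ e j) ^ h), pow_mul]
  · intro j
    obtain ⟨c, hc⟩ := hheight j
    refine ⟨c + Real.log 2, Eventually.of_forall fun n => ?_⟩
    have h := exists_heightLE_sum (hr j) hc (p j * m j * n)
    have h1 : ((d j ^ e j : ℕ) : ℝ) ^ (p j * m j * n) = ((d j ^ M : ℕ) : ℝ) ^ n := by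
      exact_mod_cast hpow j n
    rwa [h1] at h

end LacunaryIndependence

section GoldenRatio

open Real (goldenRatio goldenConj)

theorem goldenRatioC_eq : goldenRatioC = (goldenRatio : ℂ) := by
  simp [goldenRatioC, goldenRatio]

theorem goldenRatioC_ne_zero : goldenRatioC ≠ 0 := by
  rw [goldenRatioC_eq]
  exact_mod_cast Real.goldenRatio_ne_zero

theorem norm_goldenRatioC_zpow (n : ℤ) : ‖goldenRatioC ^ n‖ = goldenRatio ^ n := by
  rw [goldenRatioC_eq, norm_zpow, Complex.norm_real, Real.norm_of_nonneg Real.goldenRatio_pos.le]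

theorem goldenConj_pow_eq (m : ℕ) : goldenConj ^ m = (-1) ^ m * (goldenRatio ^ m)⁻¹ := by
  rw [← inv_pow, ← mul_pow, Real.inv_goldenRatio]
  simp

theorem lucasNum_eq (m : ℕ) : (lucasNum m : ℝ) = goldenRatio ^ m + goldenConj ^ m := by
  induction m using Nat.twoStepInduction with
  | zero => norm_num [lucasNum]
  | one => simp [lucasNum]
  | more m h1 h2 =>
    rw [lucasNum, Nat.cast_add, h1, h2, pow_add goldenRatio m 2, pow_add goldenConj m 2,
      Real.goldenRatio_sq, Real.goldenConj_sq]
    ring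

theorem inv_fib_eq (m : ℕ) : (Nat.fib m : ℂ)⁻¹ = (Real.sqrt 5 : ℂ) *
    ((goldenRatioC ^ m)⁻¹ / (1 - (-1) ^ m * ((goldenRatioC ^ m)⁻¹) ^ 2)) := by
  have h1 := Real.coe_fib_eq m
  rw [goldenConj_pow_eq] at h1
  have h2 : (Nat.fib m : ℂ) =
      (goldenRatioC ^ m - (-1) ^ m * (goldenRatioC ^ m)⁻¹) / (Real.sqrt 5 : ℂ) := by
    rw [goldenRatioC_eq]
    exact_mod_cast congrArg (fun x : ℝ => (x : ℂ)) h1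
  have h3 : goldenRatioC ^ m ≠ 0 := pow_ne_zero _ goldenRatioC_ne_zero
  have h4 : goldenRatioC ^ m - (-1) ^ m * (goldenRatioC ^ m)⁻¹ =
      goldenRatioC ^ m * (1 - (-1) ^ m * ((goldenRatioC ^ m)⁻¹) ^ 2) := by
    rw [mul_sub, mul_one, sq, mul_left_comm, mul_inv_cancel_left₀ h3]
  rw [h2, h4, inv_div, mul_comm (goldenRatioC ^ m), div_mul_eq_div_div, div_eq_mul_inv,
    div_eq_mul_inv, div_eq_mul_inv]
  ring

theorem inv_lucasNum_eq (m : ℕ) : (lucasNum m : ℂ)⁻¹ =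
    (goldenRatioC ^ m)⁻¹ / (1 + (-1) ^ m * ((goldenRatioC ^ m)⁻¹) ^ 2) := by
  have h1 := lucasNum_eq m
  rw [goldenConj_pow_eq] at h1
  have h2 : (lucasNum m : ℂ) = goldenRatioC ^ m + (-1) ^ m * (goldenRatioC ^ m)⁻¹ := by
    rw [goldenRatioC_eq]
    exact_mod_cast congrArg (fun x : ℝ => (x : ℂ)) h1
  have h3 : goldenRatioC ^ m ≠ 0 := pow_ne_zero _ goldenRatioC_ne_zero
  have h4 : goldenRatioC ^ m + (-1) ^ m * (goldenRatioC ^ m)⁻¹ =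
      goldenRatioC ^ m * (1 + (-1) ^ m * ((goldenRatioC ^ m)⁻¹) ^ 2) := by
    rw [mul_add, mul_one, sq, mul_left_comm, mul_inv_cancel_left₀ h3]
  rw [h2, h4, mul_inv, div_eq_mul_inv]

theorem fib_le_two_pow (m : ℕ) : Nat.fib m ≤ 2 ^ m := by
  induction m using Nat.twoStepInduction with
  | zero => simp
  | one => simp
  | more m h1 h2 =>
    rw [Nat.fib_add_two]
    have := pow_pos (two_pos : 0 < 2) m
    rw [pow_succ] at *
    omega

theorem lucasNum_le_two_pow (m : ℕ) : lucasNum m ≤ 2 ^ (m + 1) := by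
  induction m using Nat.twoStepInduction with
  | zero => simp [lucasNum]
  | one => simp [lucasNum]
  | more m h1 h2 =>
    rw [lucasNum]
    have := pow_pos (two_pos : 0 < 2) m
    simp only [pow_succ] at *
    omega

theorem goldenRatioC_pow_toNat_inv {k r h : ℕ} {l : ℤ} (hm : 0 ≤ (k * r ^ h + l : ℤ)) :
    (goldenRatioC ^ (k * r ^ h + l : ℤ).toNat)⁻¹ =
      goldenRatioC ^ (-l) * ((goldenRatioC ^ k)⁻¹) ^ r ^ h := by
  rw [← zpow_natCast goldenRatioC (k * r ^ h + l : ℤ).toNat, Int.toNat_of_nonneg hm,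
    zpow_add₀ goldenRatioC_ne_zero, mul_inv, ← zpow_neg, mul_comm, inv_pow, ← pow_mul]
  norm_cast
  rw [zpow_neg, zpow_neg, zpow_natCast]

theorem neg_one_pow_toNat {k r d e h : ℕ} {l : ℤ} (hr : r = d ^ e) (he : 0 < e) (hh : 0 < h)
    (hm : 0 ≤ (k * r ^ h + l : ℤ)) :
    (-1 : ℂ) ^ (k * r ^ h + l : ℤ).toNat = (-1) ^ (k * d + l : ℤ) := by
  subst hr
  have h0 : (-1 : ℂ) ≠ 0 := by norm_num
  have h1 : (-1 : ℂ) ^ ((d ^ e) ^ h) = (-1) ^ d := by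
    rw [← pow_mul]
    have hne : e * h ≠ 0 := (Nat.mul_pos he hh).ne'
    rcases Nat.even_or_odd d with hd | hd
    · rw [hd.neg_one_pow, (hd.pow_of_ne_zero hne).neg_one_pow]
    · rw [hd.neg_one_pow, hd.pow.neg_one_pow]
  rw [← zpow_natCast (-1 : ℂ) (k * (d ^ e : ℕ) ^ h + l : ℤ).toNat, Int.toNat_of_nonneg hm,
    zpow_add₀ h0, zpow_add₀ h0]
  congr 1
  have h2 : (-1 : ℂ) ^ (k * (d ^ e) ^ h) = (-1) ^ (k * d) := by
    rw [mul_comm k, mul_comm k, pow_mul, pow_mul, h1]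
  exact_mod_cast h2

theorem exists_notPerfectPower_pow {r : ℕ} (hr : 2 ≤ r) :
    ∃ d e, NotPerfectPower d ∧ 0 < e ∧ r = d ^ e := by
  induction r using Nat.strong_induction_on with
  | _ r ih =>
    by_cases h : NotPerfectPower r
    · exact ⟨r, 1, h, one_pos, (pow_one r).symm⟩
    · simp only [NotPerfectPower, not_and, not_forall, not_not] at h
      obtain ⟨a, n, hn, rfl⟩ := h hr
      have ha : 2 ≤ a := by
        by_contra hlt
        interval_cases a
        · rw [zero_pow (by omega)] at hr
          omega
        · rw [one_pow] at hr
          omega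
      obtain ⟨d, e, hd, he, rfl⟩ := ih a (lt_self_pow₀ (by omega) (by omega)) ha
      exact ⟨d, e * n, hd, Nat.mul_pos he (by omega), (pow_mul _ _ _).symm⟩

end GoldenRatio

section FibonacciValues

open Filter

open Real (goldenRatio)

theorem goldenRatioC_sq : goldenRatioC ^ 2 = goldenRatioC + 1 := by
  rw [goldenRatioC_eq]
  exact_mod_cast congrArg (fun x : ℝ => (x : ℂ)) Real.goldenRatio_sq

theorem isIntegral_goldenRatioC : IsIntegral ℤ goldenRatioC := by
  refine ⟨Polynomial.X ^ 2 - Polynomial.X - 1, by monicity!, ?_⟩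
  simp [goldenRatioC_sq]

theorem isIntegral_goldenRatioC_inv : IsIntegral ℤ goldenRatioC⁻¹ := by
  have h : goldenRatioC⁻¹ = goldenRatioC - 1 := by
    rw [inv_eq_iff_eq_inv, eq_comm]
    refine inv_eq_of_mul_eq_one_right ?_
    linear_combination goldenRatioC_sq
  rw [h]
  exact isIntegral_goldenRatioC.sub isIntegral_one

theorem isAlgebraic_sqrt_five : IsAlgebraic ℚ (Real.sqrt 5 : ℂ) := by
  refine IsAlgebraic.of_pow two_pos ?_
  have h : (Real.sqrt 5 : ℂ) ^ 2 = ((5 : ℕ) : ℂ) := by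
    exact_mod_cast congrArg (fun x : ℝ => (x : ℂ)) (Real.sq_sqrt (show (0 : ℝ) ≤ 5 by norm_num))
  rw [h]
  exact isAlgebraic_natCast 5

theorem isAlgebraic_goldenRatioC : IsAlgebraic ℚ goldenRatioC :=
  (isIntegral_goldenRatioC.tower_top (A := ℚ)).isAlgebraic

theorem goldenRatio_pow_inv_lt_one {k : ℕ} (hk : 1 ≤ k) : (goldenRatio ^ k)⁻¹ < 1 :=
  inv_lt_one_of_one_lt₀ (one_lt_pow₀ Real.one_lt_goldenRatio (by omega))

theorem coe_goldenRatio_pow_inv (k : ℕ) :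
    (((goldenRatio ^ k)⁻¹ : ℝ) : ℂ) = (goldenRatioC ^ k)⁻¹ := by
  rw [goldenRatioC_eq]
  push_cast
  rfl

/-- The sum of the reciprocals of the `F_{k * 2 ^ h}` telescopes. -/
theorem isAlgebraic_tsum_fib {k : ℕ} (hk : 1 ≤ k) {b : ℂ} (hb : IsAlgebraic ℚ b) :
    IsAlgebraic ℚ (∑' h : ℕ, b / (Nat.fib (k * 2 ^ h) : ℂ)) := by
  set x : ℂ := (goldenRatioC ^ k)⁻¹ with hx
  have hx1 : ‖x‖ < 1 := by
    rw [hx, ← coe_goldenRatio_pow_inv, Complex.norm_real, Real.norm_of_nonneg (by positivity)]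
    exact goldenRatio_pow_inv_lt_one hk
  have hpow1 : ∀ n, 0 < n → x ^ n ≠ 1 := fun n hn h => by
    have h1 := pow_lt_one₀ (norm_nonneg x) hx1 hn.ne'
    rw [← norm_pow, h, norm_one] at h1
    exact lt_irrefl _ h1
  have hterm : ∀ h : ℕ, b / (Nat.fib (k * 2 ^ (h + 1)) : ℂ) =
      b * (Real.sqrt 5 : ℂ) * (x ^ 2 ^ (h + 1) / (1 - (x ^ 2 ^ (h + 1)) ^ 2)) := by
    intro h
    have heven : Even (k * 2 ^ (h + 1)) := (even_two.pow_of_ne_zero h.succ_ne_zero).mul_left k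
    rw [div_eq_mul_inv, inv_fib_eq, heven.neg_one_pow, one_mul, pow_mul, ← inv_pow, mul_assoc]
  have hdiff : ∀ h : ℕ, x ^ 2 ^ (h + 1) / (1 - (x ^ 2 ^ (h + 1)) ^ 2) =
      (1 - x ^ 2 ^ (h + 1))⁻¹ - (1 - x ^ 2 ^ (h + 2))⁻¹ := by
    intro h
    have h1 : x ^ 2 ^ (h + 2) = (x ^ 2 ^ (h + 1)) ^ 2 := by rw [← pow_mul, ← pow_succ]
    have h2 : 1 - x ^ 2 ^ (h + 1) ≠ 0 := sub_ne_zero.mpr (hpow1 _ (by positivity)).symm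
    have h3 : 1 - (x ^ 2 ^ (h + 1)) ^ 2 ≠ 0 := by
      rw [← h1]
      exact sub_ne_zero.mpr (hpow1 _ (by positivity)).symm
    rw [h1]
    set z := x ^ 2 ^ (h + 1)
    field_simp
    ring
  have hsum : Summable fun h : ℕ => x ^ 2 ^ h / (1 - (x ^ 2 ^ h) ^ 2) := by
    have := (hasAsymp_oddGeom 1).summable (PowerSeries.constantCoeff_oddGeom 1) le_rfl
      (u := fun _ => 1) (B := 1) (by simp) hx1
    simpa using this
  have htends : Tendsto (fun n => ∑ h ∈ Finset.range n,
      x ^ 2 ^ (h + 1) / (1 - (x ^ 2 ^ (h + 1)) ^ 2)) atTop (nhds ((1 - x ^ 2)⁻¹ - 1)) := by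
    have h1 : ∀ n, ∑ h ∈ Finset.range n, x ^ 2 ^ (h + 1) / (1 - (x ^ 2 ^ (h + 1)) ^ 2) =
        (1 - x ^ 2)⁻¹ - (1 - x ^ 2 ^ (n + 1))⁻¹ := by
      intro n
      simp only [hdiff]
      rw [Finset.sum_range_sub' (fun h => (1 - x ^ 2 ^ (h + 1))⁻¹) n, zero_add, pow_one]
    simp only [h1]
    have h2 : Tendsto (fun n : ℕ => x ^ 2 ^ (n + 1)) atTop (nhds 0) :=
      (tendsto_pow_atTop_nhds_zero_of_norm_lt_one hx1).comp
        ((tendsto_pow_atTop_atTop_of_one_lt one_lt_two).comp (tendsto_add_atTop_nat 1))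
    have h3 := ((tendsto_const_nhds (x := (1 : ℂ))).sub h2).inv₀ (by simp)
    simpa using (tendsto_const_nhds (x := (1 - x ^ 2)⁻¹)).sub h3
  have hsum1 := (summable_nat_add_iff 1).mpr hsum
  have hval := tendsto_nhds_unique hsum1.hasSum.tendsto_sum_nat htends
  have hsumb : Summable fun h : ℕ => b / (Nat.fib (k * 2 ^ h) : ℂ) := by
    rw [← summable_nat_add_iff 1]
    simp only [hterm]
    exact hsum1.mul_left _
  have htotal : ∑' h : ℕ, b / (Nat.fib (k * 2 ^ h) : ℂ) =
      b / (Nat.fib k : ℂ) + b * (Real.sqrt 5 : ℂ) * ((1 - x ^ 2)⁻¹ - 1) := by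
    rw [hsumb.tsum_eq_zero_add, ← hval, ← tsum_mul_left]
    simp only [hterm, pow_zero, mul_one]
  have hxalg : IsAlgebraic ℚ x := (isAlgebraic_goldenRatioC.pow k).inv
  rw [htotal, div_eq_mul_inv]
  exact (hb.mul (isAlgebraic_natCast _).inv).add ((hb.mul isAlgebraic_sqrt_five).mul
    (((isAlgebraic_one.sub (hxalg.pow 2)).inv).sub isAlgebraic_one))

end FibonacciValues

section Assembly

open Filter

open Real (goldenRatio)

theorem HeightLE.exists_mul {K : Type*} [Field K] [Algebra ℚ K] {x z : ℕ → K} {B c : ℝ} {r : ℕ}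
    (hr : 1 ≤ r) (hx : ∀ h, HeightLE (x h) B)
    (hz : ∀ h, HeightLE (z h) (Real.exp (c * (r : ℝ) ^ h))) :
    ∃ c' : ℝ, ∀ h, HeightLE (x h * z h) (Real.exp (c' * (r : ℝ) ^ h)) := by
  have hB : 1 ≤ B := (hx 0).one_le
  refine ⟨Real.log B + c, fun h => ((hx h).mul (hz h)).mono ?_⟩
  have h1 : (1 : ℝ) ≤ (r : ℝ) ^ h := one_le_pow₀ (by exact_mod_cast hr)
  rw [add_mul, Real.exp_add]
  gcongr
  calc B = Real.exp (Real.log B) := (Real.exp_log (zero_lt_one.trans_le hB)).symm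
    _ ≤ _ := Real.exp_le_exp.mpr (le_mul_of_one_le_right (Real.log_nonneg hB) h1)

theorem exists_heightLE_inv_natCast {K : Type*} [Field K] [Algebra ℚ K] {N : ℕ → ℕ} {A r : ℕ}
    (hN : ∀ h, N h ≤ 2 ^ (A * r ^ h)) :
    ∃ c : ℝ, ∀ h, HeightLE ((N h : K)⁻¹) (Real.exp (c * (r : ℝ) ^ h)) := by
  refine ⟨Real.log 2 * A, fun h => ?_⟩
  have h1 : Real.exp (Real.log 2 * A * (r : ℝ) ^ h) = ((2 ^ (A * r ^ h) : ℕ) : ℝ) := by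
    rw [mul_assoc, mul_comm, ← Nat.cast_pow, ← Nat.cast_mul, Real.exp_nat_mul,
      Real.exp_log two_pos]
    push_cast
    rfl
  rw [h1]
  rcases Nat.eq_zero_or_pos (N h) with h0 | h0
  · rw [h0, Nat.cast_zero, inv_zero]
    exact HeightLE.zero.mono (by exact_mod_cast Nat.one_le_two_pow)
  · exact (HeightLE.inv_natCast h0).mono (by exact_mod_cast hN h)

theorem Function.Periodic.exists_heightLE {K : Type*} [Field K] [Algebra ℚ K]
    [FiniteDimensional ℚ K] {u : ℕ → K} {p : ℕ} (hp : 0 < p) (hu : Function.Periodic u p) :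
    ∃ B, ∀ n, HeightLE (u n) B := by
  choose B hB using fun n => _root_.exists_heightLE (u n)
  refine ⟨∑ i ∈ Finset.range p, B i, fun n => ?_⟩
  rw [← hu.map_mod_nat n]
  exact (hB _).mono (Finset.single_le_sum (f := B)
    (fun i _ => zero_le_one.trans (hB i).one_le) (Finset.mem_range.mpr (Nat.mod_lt n hp)))

theorem Function.Periodic.finite_range {α : Type*} {u : ℕ → α} {p : ℕ} (hp : 0 < p)
    (hu : Function.Periodic u p) : (Set.range u).Finite := by
  refine ((Set.finite_Iio p).image u).subset ?_
  rintro _ ⟨n, rfl⟩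
  exact ⟨n % p, Nat.mod_lt n hp, hu.map_mod_nat n⟩

theorem toNat_le_mul_pow (k r h : ℕ) (l : ℤ) (hr : 1 ≤ r) :
    (k * r ^ h + l : ℤ).toNat ≤ (k + l.natAbs) * r ^ h := by
  have h1 : 1 ≤ r ^ h := Nat.one_le_pow _ _ hr
  have h2 : l ≤ (l.natAbs * r ^ h : ℕ) :=
    Int.le_natAbs.trans (by exact_mod_cast Nat.le_mul_of_pos_right _ h1)
  rw [Int.toNat_le]
  push_cast at h2 ⊢
  rw [add_mul]
  linarith

theorem eventually_nonneg_mul_pow_add {k r : ℕ} (hk : 1 ≤ k) (hr : 2 ≤ r) (l : ℤ) :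
    ∀ᶠ h in atTop, 0 < h ∧ (0 : ℤ) < k * (r : ℤ) ^ h + l := by
  filter_upwards [eventually_gt_atTop l.natAbs] with h hh
  refine ⟨by omega, ?_⟩
  have h1 : h < r ^ h := Nat.lt_pow_self (by omega)
  have h2 : r ^ h ≤ k * r ^ h := Nat.le_mul_of_pos_left _ hk
  have h3 : (h : ℤ) < (k * r ^ h : ℕ) := by exact_mod_cast h1.trans_le h2
  push_cast at h3
  omega

/-- The coefficient `γ` such that `1 / F_{k r ^ h + l}` is proportional to `x / (1 - γ x ^ 2)`
with `x = φ ^ (-k r ^ h)`, where `r` is a power of `d`. -/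
def fibPole (k d : ℕ) (l : ℤ) : ℂ :=
  (-1) ^ (k * d + l : ℤ) * (goldenRatioC ^ (-l)) ^ 2

theorem norm_fibPole (k d : ℕ) (l : ℤ) : ‖fibPole k d l‖ = goldenRatio ^ (-l * 2) := by
  rw [fibPole, norm_mul, norm_zpow, norm_neg, norm_one, one_zpow, one_mul, norm_pow,
    norm_goldenRatioC_zpow, zpow_mul]
  norm_cast

theorem fibPole_ne_zero (k d : ℕ) (l : ℤ) : fibPole k d l ≠ 0 := by
  rw [← norm_ne_zero_iff, norm_fibPole]
  exact zpow_ne_zero _ Real.goldenRatio_ne_zero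

theorem eq_of_norm_fibPole_eq {k d k' d' : ℕ} {l l' : ℤ}
    (h : ‖fibPole k d l‖ = ‖fibPole k' d' l'‖) : l = l' := by
  rw [norm_fibPole, norm_fibPole] at h
  have := zpow_right_injective₀ Real.goldenRatio_pos Real.one_lt_goldenRatio.ne' h
  omega

theorem fibPole_im (k d : ℕ) (l : ℤ) : (fibPole k d l).im = 0 := by
  have h : fibPole k d l = (((-1) ^ (k * d + l : ℤ) * (goldenRatio ^ (-l)) ^ 2 : ℝ) : ℂ) := by
    rw [fibPole, goldenRatioC_eq]
    push_cast
    rfl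
  rw [h, Complex.ofReal_im]

theorem fibPole_zero_two (k : ℕ) : fibPole k 2 0 = 1 := by
  have h : (-1 : ℂ) ^ (k * 2) = 1 := by rw [pow_mul']; simp
  simp only [fibPole, add_zero, neg_zero, zpow_zero, one_pow, mul_one]
  exact_mod_cast h

theorem eq_zero_of_norm_fibPole {k d : ℕ} {l : ℤ} (h : ‖fibPole k d l‖ = 1) : l = 0 :=
  eq_of_norm_fibPole_eq (k' := k) (d' := 2) (by rw [h, fibPole_zero_two, norm_one])

theorem inv_fib_toNat_eq {k r d e h : ℕ} {l : ℤ} (hr : r = d ^ e) (he : 0 < e) (hh : 0 < h)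
    (hm : 0 ≤ (k * r ^ h + l : ℤ)) :
    (Nat.fib (k * r ^ h + l : ℤ).toNat : ℂ)⁻¹ = (Real.sqrt 5 : ℂ) * goldenRatioC ^ (-l) *
      (((goldenRatioC ^ k)⁻¹) ^ r ^ h /
        (1 - fibPole k d l * (((goldenRatioC ^ k)⁻¹) ^ r ^ h) ^ 2)) := by
  rw [inv_fib_eq, neg_one_pow_toNat hr he hh hm, goldenRatioC_pow_toNat_inv hm, fibPole]
  ring

theorem inv_lucasNum_toNat_eq {k r d e h : ℕ} {l : ℤ} (hr : r = d ^ e) (he : 0 < e) (hh : 0 < h)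
    (hm : 0 ≤ (k * r ^ h + l : ℤ)) :
    (lucasNum (k * r ^ h + l : ℤ).toNat : ℂ)⁻¹ = goldenRatioC ^ (-l) *
      (((goldenRatioC ^ k)⁻¹) ^ r ^ h /
        (1 - -fibPole k d l * (((goldenRatioC ^ k)⁻¹) ^ r ^ h) ^ 2)) := by
  rw [inv_lucasNum_eq, neg_one_pow_toNat hr he hh hm, goldenRatioC_pow_toNat_inv hm, fibPole]
  ring

end Assembly

section Family

open Filter

open Real (goldenRatio)

/-- The index set of the whole family of series. -/
abbrev SeriesIdx : Type := QIdx ⊕ (FIdx' ⊕ FLIdx)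

namespace SeriesIdx

/-- The growth rate `r` of the exponents `k * r ^ h`. -/
def rate : SeriesIdx → ℕ :=
  Sum.elim (fun i => i.1.2) (Sum.elim (fun i => i.1.2) (fun i => i.1.2))

theorem two_le_rate (i : SeriesIdx) : 2 ≤ i.rate := by
  rcases i with ⟨⟨μ, s⟩, d, j, hd, hj, hs, hμ⟩ | i | i
  · have h1 : s = d ^ j := hs
    exact (hd.1.trans (Nat.le_self_pow (by omega) d)).trans_eq h1.symm
  · exact i.2.1
  · exact i.2

/-- The periodic coefficients, up to a constant factor. -/
def coeff (a c : ℕ → ℂ) : SeriesIdx → ℕ → ℂ :=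
  Sum.elim (fun _ => a) (Sum.elim (fun _ _ => 1) fun _ => c)

/-- The constant factor. -/
def scale (b : ℂ) : SeriesIdx → ℂ :=
  Sum.elim (fun _ => 1) (Sum.elim
    (fun i => b * ((Real.sqrt 5 : ℂ) * goldenRatioC ^ (-i.1.1)))
    (fun i => goldenRatioC ^ (-i.1.1)))

/-- The shape of the summand as a function of `x = φ ^ (-k r ^ h)`: `Sum.inl μ` for `x ^ μ` and
`Sum.inr γ` for `x / (1 - γ x ^ 2)`; here `D r` is the base of which `r` is a power. -/
def shape (k : ℕ) (D : ℕ → ℕ) : SeriesIdx → ℕ ⊕ ℂ :=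
  Sum.elim (fun i => Sum.inl i.1.1) (Sum.elim
    (fun i => Sum.inr (fibPole k (D i.1.2) i.1.1))
    (fun i => Sum.inr (-fibPole k (D i.1.2) i.1.1)))

/-- The summands, computed in a field `K` containing the inverse golden ratio `g`. -/
def term {K : Type*} [Field K] (k : ℕ) (g : K) (a c : ℕ → K) (b : K) : SeriesIdx → ℕ → K :=
  Sum.elim (fun i h => a h * (g ^ (i.1.1 * k)) ^ i.1.2 ^ h) (Sum.elim
    (fun i h => b * (((if 0 < (k * i.1.2 ^ h + i.1.1 : ℤ) then
      Nat.fib (k * i.1.2 ^ h + i.1.1 : ℤ).toNat else 0 : ℕ) : K))⁻¹)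
    (fun i h => c h * (((if 0 ≤ (k * i.1.2 ^ h + i.1.1 : ℤ) then
      lucasNum (k * i.1.2 ^ h + i.1.1 : ℤ).toNat else 0 : ℕ) : K))⁻¹))

end SeriesIdx

theorem fibPole_ne_neg (k d : ℕ) (l l' : ℤ) : fibPole k d l ≠ -fibPole k d l' := by
  intro h
  have h1 : l = l' := eq_of_norm_fibPole_eq (k := k) (d := d) (k' := k) (d' := d)
    (by rw [h, norm_neg])
  rw [h1] at h
  exact fibPole_ne_zero k d l' (self_eq_neg.mp h)

theorem exists_notPerfectPower_pow_choice : ∃ D E : ℕ → ℕ,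
    ∀ r, 2 ≤ r → NotPerfectPower (D r) ∧ 0 < E r ∧ r = D r ^ E r := by
  have : ∀ r : ℕ, ∃ d e : ℕ, 2 ≤ r → NotPerfectPower d ∧ 0 < e ∧ r = d ^ e := fun r => by
    by_cases hr : 2 ≤ r
    · obtain ⟨d, e, h⟩ := exists_notPerfectPower_pow hr
      exact ⟨d, e, fun _ => h⟩
    · exact ⟨0, 0, fun h => absurd h hr⟩
  choose D E hDE using this
  exact ⟨D, E, hDE⟩

theorem SeriesIdx.algebraicIndependent_tsum_term_subtype {k : ℕ} (hk : 1 ≤ k)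
    (K : IntermediateField ℚ ℂ) [FiniteDimensional ℚ K] {gK bK : K} {aK cK : ℕ → K} {pa pc : ℕ}
    (hgK : (gK : ℂ) = goldenRatioC) (h5K : (Real.sqrt 5 : ℂ) ∈ K) (hb : bK ≠ 0) (hpa : 0 < pa)
    (ha_per : Function.Periodic aK pa) (hpc : 0 < pc) (hc_per : Function.Periodic cK pc)
    (ha_ne : aK ≠ 0) (hc_ne : cK ≠ 0)
    {T : Set SeriesIdx} (hT : T.Finite) :
    AlgebraicIndependent ℚ fun i : T => ∑' h, ((term k gK⁻¹ aK cK bK i.1 h : K) : ℂ) := by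
  obtain ⟨D, E, hDE⟩ := exists_notPerfectPower_pow_choice
  have hgmem : goldenRatioC ∈ K := hgK ▸ gK.2
  have hpoleK : ∀ d l, fibPole k d l ∈ K := fun d l =>
    mul_mem (zpow_mem (neg_mem (one_mem K)) _) (pow_mem (zpow_mem hgmem _) _)
  have hgint : IsIntegral ℤ gK⁻¹ := by
    rw [← isIntegral_algebraMap_iff (algebraMap K ℂ).injective (B := ℂ), map_inv₀]
    rw [show algebraMap K ℂ gK = goldenRatioC from hgK]
    exact isIntegral_goldenRatioC_inv
  obtain ⟨Ba, hBa⟩ := ha_per.exists_heightLE hpa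
  obtain ⟨Bc, hBc⟩ := hc_per.exists_heightLE hpc
  obtain ⟨Bb, hBb⟩ := exists_heightLE bK
  have hD := fun i : SeriesIdx => (hDE i.rate i.two_le_rate).1
  have hE := fun i : SeriesIdx => (hDE i.rate i.two_le_rate).2.1
  have hrDE := fun i : SeriesIdx => (hDE i.rate i.two_le_rate).2.2
  have := hT.to_subtype
  refine algebraicIndependent_tsum_lacunary (J := T) (inv_pos.mpr (pow_pos Real.goldenRatio_pos k))
    (goldenRatio_pow_inv_lt_one hk) K (αK := gK⁻¹ ^ k) ?_ (hgint.pow k)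
    (d := fun i => D i.1.rate) (e := fun i => E i.1.rate) (fun i => hD i) (fun i => hE i)
    (u := fun i => coeff (fun h => aK h) (fun h => cK h) i.1) ?_ ?_
    (shape := fun i => SeriesIdx.shape k D i.1) ?_ ?_ ?_ ?_ ?_
    (t := fun i => scale bK i.1) ?_ ?_ ?_ ?_ (fun i => term k gK⁻¹ aK cK bK i.1) ?_ ?_
  · rw [coe_goldenRatio_pow_inv, inv_pow]
    push_cast
    rw [hgK]
  · rintro ⟨i | i | i, _⟩
    · exact ⟨pa, hpa, fun n => congrArg Subtype.val (ha_per n)⟩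
    · exact ⟨1, one_pos, fun _ => rfl⟩
    · exact ⟨pc, hpc, fun n => congrArg Subtype.val (hc_per n)⟩
  · rintro ⟨i | i | i, _⟩
    · exact fun h => ha_ne (funext fun n => Subtype.ext (congrFun h n))
    · exact fun h => one_ne_zero (congrFun h 0)
    · exact fun h => hc_ne (funext fun n => Subtype.ext (congrFun h n))
  · rintro ⟨i | i | i, _⟩ μ hμ
    · have hμ' : i.1.1 = μ := Sum.inl_injective hμ
      subst hμ'
      have hDi := hD (Sum.inl i)
      have hEi := hE (Sum.inl i)
      have hri := hrDE (Sum.inl i)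
      obtain ⟨d, j, hd, hj, hs, h1, h2⟩ := i.2
      have hdD : d = D (rate (Sum.inl i)) := by
        exact hd.eq_of_pow_eq hDi hj hEi (hs.symm.trans hri)
      have := hd.1
      refine ⟨h1, ?_⟩
      show i.1.1 < D (rate (Sum.inl i))
      omega
    · exact absurd hμ Sum.inr_ne_inl
    · exact absurd hμ Sum.inr_ne_inl
  · rintro ⟨i | i | i, _⟩ γ hγ
    · exact absurd hγ Sum.inl_ne_inr
    · have hγ' : fibPole k (D i.1.2) i.1.1 = γ := Sum.inr_injective hγ
      subst hγ'
      exact ⟨fibPole_ne_zero _ _ _, fibPole_im _ _ _⟩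
    · have hγ' : -fibPole k (D i.1.2) i.1.1 = γ := Sum.inr_injective hγ
      subst hγ'
      exact ⟨neg_ne_zero.mpr (fibPole_ne_zero _ _ _), by rw [Complex.neg_im, fibPole_im, neg_zero]⟩
  · rintro ⟨i | i | i, _⟩ ⟨i' | i' | i', _⟩ hd h
    · rfl
    · exact absurd h Sum.inl_ne_inr
    · exact absurd h Sum.inl_ne_inr
    · exact absurd h Sum.inr_ne_inl
    · rfl
    · have h1 := Sum.inr_injective h
      rw [show D i.1.2 = D i'.1.2 from hd] at h1
      exact absurd h1 (fibPole_ne_neg _ _ _ _)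
    · exact absurd h Sum.inr_ne_inl
    · have h1 := Sum.inr_injective h
      rw [show D i.1.2 = D i'.1.2 from hd] at h1
      exact absurd h1.symm (fibPole_ne_neg _ _ _ _)
    · rfl
  · rintro ⟨i, hi⟩ ⟨i', hi'⟩ hd h he
    have hrr : i.rate = i'.rate := by
      rw [hrDE i, hrDE i']
      exact congrArg₂ (· ^ ·) hd he
    rcases i with i | i | i <;> rcases i' with i' | i' | i'
    · have h1 : i.1.1 = i'.1.1 := Sum.inl_injective h
      obtain rfl : i = i' := Subtype.ext (Prod.ext h1 hrr)
      rfl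
    · exact absurd h Sum.inl_ne_inr
    · exact absurd h Sum.inl_ne_inr
    · exact absurd h Sum.inr_ne_inl
    · have h1 := eq_of_norm_fibPole_eq (congrArg norm (Sum.inr_injective h))
      obtain rfl : i = i' := Subtype.ext (Prod.ext h1 hrr)
      rfl
    · have h1 := Sum.inr_injective h
      rw [show D i.1.2 = D i'.1.2 from hd] at h1
      exact absurd h1 (fibPole_ne_neg _ _ _ _)
    · exact absurd h Sum.inr_ne_inl
    · have h1 := Sum.inr_injective h
      rw [show D i.1.2 = D i'.1.2 from hd] at h1
      exact absurd h1.symm (fibPole_ne_neg _ _ _ _)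
    · have h1 := eq_of_norm_fibPole_eq (congrArg norm (neg_injective (Sum.inr_injective h)))
      obtain rfl : i = i' := Subtype.ext (Prod.ext h1 hrr)
      rfl
  · rintro ⟨i | i | i, _⟩ hd h
    · exact absurd h Sum.inl_ne_inr
    · have h1 : i.1.1 = 0 := eq_zero_of_norm_fibPole
        (by rw [show fibPole k (D i.1.2) i.1.1 = 1 from Sum.inr_injective h, norm_one])
      by_contra hlt
      have h2 : E (rate (Sum.inr (Sum.inl i))) = 1 := by
        have := hE (Sum.inr (Sum.inl i))
        simp only at hlt
        omega
      have h3 := hrDE (Sum.inr (Sum.inl i))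
      rw [h2, pow_one, show D (rate (Sum.inr (Sum.inl i))) = 2 from hd] at h3
      exact i.2.2 (Prod.ext h1 h3)
    · have h0 : -fibPole k (D i.1.2) i.1.1 = 1 := Sum.inr_injective h
      have h1 : i.1.1 = 0 := eq_zero_of_norm_fibPole (by rw [← norm_neg, h0, norm_one])
      rw [h1, show D i.1.2 = 2 from hd, fibPole_zero_two] at h0
      norm_num at h0
  · rintro ⟨i | i | i, _⟩
    · exact one_ne_zero
    · exact mul_ne_zero (by exact_mod_cast hb)
        (mul_ne_zero (by simp) (zpow_ne_zero _ goldenRatioC_ne_zero))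
    · exact zpow_ne_zero _ goldenRatioC_ne_zero
  · rintro ⟨i | i | i, _⟩ h
    · exact (aK h).2
    · exact one_mem K
    · exact (cK h).2
  · rintro ⟨i | i | i, _⟩
    · exact one_mem K
    · exact mul_mem bK.2 (mul_mem h5K (zpow_mem hgmem _))
    · exact zpow_mem hgmem _
  · rintro ⟨i | i | i, _⟩ γ hγ
    · exact absurd hγ Sum.inl_ne_inr
    · have hγ' : fibPole k (D i.1.2) i.1.1 = γ := Sum.inr_injective hγ
      subst hγ'
      exact hpoleK _ _
    · have hγ' : -fibPole k (D i.1.2) i.1.1 = γ := Sum.inr_injective hγ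
      subst hγ'
      exact neg_mem (hpoleK _ _)
  · rintro ⟨i, -⟩
    simp only [← hrDE i, coe_goldenRatio_pow_inv]
    filter_upwards [eventually_nonneg_mul_pow_add hk (i.two_le_rate) (Sum.elim (fun _ => 0)
      (Sum.elim (fun i => i.1.1) (fun i => i.1.1)) i)] with h hh
    have hri := hrDE i
    have hEi := hE i
    rcases i with i | i | i
    · show (aK h : ℂ) * (((gK : ℂ)⁻¹) ^ (i.1.1 * k)) ^ i.1.2 ^ h =
        aK h * (1 * (((goldenRatioC ^ k)⁻¹) ^ i.1.2 ^ h) ^ i.1.1)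
      rw [hgK, one_mul, ← inv_pow, ← pow_mul, ← pow_mul, ← pow_mul]
      ring_nf
    · have hpos : 0 < (k * i.1.2 ^ h + i.1.1 : ℤ) := hh.2
      simp only [term, coeff, scale, SeriesIdx.shape, Sum.elim_inr, Sum.elim_inl, if_pos hpos]
      rw [one_mul, mul_assoc (bK : ℂ)]
      refine Eq.trans ?_ (congrArg ((bK : ℂ) * ·) (inv_fib_toNat_eq hri hEi hh.1 hpos.le))
      push_cast
      rfl
    · have hpos : 0 ≤ (k * i.1.2 ^ h + i.1.1 : ℤ) := hh.2.le
      simp only [term, coeff, scale, SeriesIdx.shape, Sum.elim_inr, if_pos hpos]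
      refine Eq.trans ?_ (congrArg ((cK h : ℂ) * ·) (inv_lucasNum_toNat_eq hri hEi hh.1 hpos))
      push_cast
      rfl
  · rintro ⟨i, -⟩
    simp only [← hrDE i]
    have hr1 : 1 ≤ i.rate := one_le_two.trans (i.two_le_rate)
    rcases i with i | i | i
    · obtain ⟨c₁, -, hc₁⟩ := (hgint.pow (i.1.1 * k)).exists_heightLE_pow
      exact HeightLE.exists_mul hr1 hBa (c := c₁) fun h => by exact_mod_cast hc₁ (i.1.2 ^ h)
    · obtain ⟨c₁, hc₁⟩ := exists_heightLE_inv_natCast (K := K) (r := i.1.2)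
        (A := k + i.1.1.natAbs) (N := fun h => if 0 < (k * i.1.2 ^ h + i.1.1 : ℤ) then
          Nat.fib (k * i.1.2 ^ h + i.1.1 : ℤ).toNat else 0) fun h => by
        split_ifs
        · exact (fib_le_two_pow _).trans
            (Nat.pow_le_pow_right two_pos (toNat_le_mul_pow k _ h _ hr1))
        · exact Nat.zero_le _
      exact HeightLE.exists_mul hr1 (fun _ => hBb) hc₁
    · obtain ⟨c₁, hc₁⟩ := exists_heightLE_inv_natCast (K := K) (r := i.1.2)
        (A := k + i.1.1.natAbs + 1) (N := fun h => if 0 ≤ (k * i.1.2 ^ h + i.1.1 : ℤ) then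
          lucasNum (k * i.1.2 ^ h + i.1.1 : ℤ).toNat else 0) fun h => by
        split_ifs
        · refine (lucasNum_le_two_pow _).trans (Nat.pow_le_pow_right two_pos ?_)
          rw [add_mul _ 1, one_mul]
          exact add_le_add (toNat_le_mul_pow k _ h _ hr1) (Nat.one_le_pow _ _ hr1)
        · exact Nat.zero_le _
      exact HeightLE.exists_mul hr1 hBc hc₁

theorem SeriesIdx.algebraicIndependent_tsum_term {k : ℕ} (hk : 1 ≤ k) (K : IntermediateField ℚ ℂ)
    [FiniteDimensional ℚ K] {gK bK : K} {aK cK : ℕ → K} {pa pc : ℕ}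
    (hgK : (gK : ℂ) = goldenRatioC) (h5K : (Real.sqrt 5 : ℂ) ∈ K) (hb : bK ≠ 0) (hpa : 0 < pa)
    (ha_per : Function.Periodic aK pa) (hpc : 0 < pc) (hc_per : Function.Periodic cK pc)
    (ha_ne : aK ≠ 0) (hc_ne : cK ≠ 0) :
    AlgebraicIndependent ℚ fun i : SeriesIdx =>
      ∑' h, ((term k gK⁻¹ aK cK bK i h : K) : ℂ) :=
  algebraicIndependent_of_finite_type fun _ hT =>
    algebraicIndependent_tsum_term_subtype hk K hgK h5K hb hpa ha_per hpc hc_per ha_ne hc_ne hT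

theorem algebraicIndependent_reciprocal_sums
    (k : ℕ) (hk : 1 ≤ k) (a c : ℕ → ℂ) (b : ℂ) (hb : b ≠ 0)
    (ha_per : ∃ p : ℕ, 0 < p ∧ Function.Periodic a p)
    (hc_per : ∃ p : ℕ, 0 < p ∧ Function.Periodic c p)
    (ha_ne : a ≠ 0) (hc_ne : c ≠ 0)
    (ha_alg : ∀ h, IsAlgebraic ℚ (a h))
    (hb_alg : IsAlgebraic ℚ b)
    (hc_alg : ∀ h, IsAlgebraic ℚ (c h)) :
    AlgebraicIndependent ℚ
      (Sum.elim
        (fun i : QIdx =>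
          ∑' h : ℕ, a h / goldenRatioC ^ (i.1.1 * k * i.1.2 ^ h))
        (Sum.elim
          (fun i : FIdx' =>
            ∑' h : ℕ,
              if 0 < (k * i.1.2 ^ h + i.1.1 : ℤ) then
                b / (Nat.fib (k * i.1.2 ^ h + i.1.1 : ℤ).toNat : ℂ)
              else 0)
          (fun i : FLIdx =>
            ∑' h : ℕ,
              if 0 ≤ (k * i.1.2 ^ h + i.1.1 : ℤ) then
                c h / (lucasNum (k * i.1.2 ^ h + i.1.1 : ℤ).toNat : ℂ)
              else 0))) := by
  obtain ⟨pa, hpa, ha_per⟩ := ha_per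
  obtain ⟨pc, hpc, hc_per⟩ := hc_per
  let S : Set ℂ := {goldenRatioC, (Real.sqrt 5 : ℂ), b} ∪ (Set.range a ∪ Set.range c)
  have hSfin : S.Finite := (Set.toFinite _).union
    ((ha_per.finite_range hpa).union (hc_per.finite_range hpc))
  have hSalg : ∀ x ∈ S, IsIntegral ℚ x := by
    rintro x ((rfl | rfl | rfl) | ⟨h, rfl⟩ | ⟨h, rfl⟩)
    · exact isAlgebraic_goldenRatioC.isIntegral
    · exact isAlgebraic_sqrt_five.isIntegral
    · exact hb_alg.isIntegral
    · exact (ha_alg h).isIntegral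
    · exact (hc_alg h).isIntegral
  have : Finite S := hSfin
  obtain ⟨K, hK, hSK⟩ : ∃ K : IntermediateField ℚ ℂ, FiniteDimensional ℚ K ∧ ∀ x ∈ S, x ∈ K :=
    ⟨IntermediateField.adjoin ℚ S, IntermediateField.finiteDimensional_adjoin hSalg,
      fun x hx => IntermediateField.subset_adjoin ℚ S hx⟩
  have hgK : goldenRatioC ∈ K := hSK _ (by simp [S])
  have h5K : (Real.sqrt 5 : ℂ) ∈ K := hSK _ (by simp [S])
  have hbK : b ∈ K := hSK _ (by simp [S])
  have haK : ∀ h, a h ∈ K := fun h => hSK _ (by simp [S])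
  have hcK : ∀ h, c h ∈ K := fun h => hSK _ (by simp [S])
  have key :=
    SeriesIdx.algebraicIndependent_tsum_term hk K (gK := ⟨_, hgK⟩) (bK := ⟨b, hbK⟩)
      (aK := fun h => ⟨a h, haK h⟩) (cK := fun h => ⟨c h, hcK h⟩) rfl h5K
      (fun h => hb (congrArg Subtype.val h)) hpa (fun n => Subtype.ext (ha_per n)) hpc
      (fun n => Subtype.ext (hc_per n))
      (fun h => ha_ne (funext fun n => congrArg Subtype.val (congrFun h n)))
      (fun h => hc_ne (funext fun n => congrArg Subtype.val (congrFun h n)))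
  convert key using 1
  funext i
  rcases i with i | i | i
  · refine tsum_congr fun h => ?_
    show _ = a h * ((goldenRatioC⁻¹) ^ (i.1.1 * k)) ^ i.1.2 ^ h
    rw [← pow_mul, inv_pow, div_eq_mul_inv]
  · refine tsum_congr fun h => ?_
    simp only [SeriesIdx.term, Sum.elim_inr, Sum.elim_inl]
    split_ifs
    · push_cast
      exact div_eq_mul_inv _ _
    · simp
  · refine tsum_congr fun h => ?_
    simp only [SeriesIdx.term, Sum.elim_inr]
    split_ifs
    · push_cast
      exact div_eq_mul_inv _ _
    · simp

end Family

theorem fibonacci_lucas_sums_constant_case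
    (k : ℕ) (hk : 1 ≤ k) (a c : ℕ → ℂ) (b : ℂ) (hb : b ≠ 0)
    (ha_per : ∃ p : ℕ, 0 < p ∧ Function.Periodic a p)
    (hc_per : ∃ p : ℕ, 0 < p ∧ Function.Periodic c p)
    (ha_ne : a ≠ 0) (hc_ne : c ≠ 0)
    (ha_alg : ∀ h, IsAlgebraic ℚ (a h))
    (hb_alg : IsAlgebraic ℚ b)
    (hc_alg : ∀ h, IsAlgebraic ℚ (c h)) :
    IsAlgebraic ℚ (∑' h : ℕ, b / (Nat.fib (k * 2 ^ h) : ℂ)) ∧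
    AlgebraicIndependent ℚ
      (Sum.elim
        (fun i : QIdx =>
          ∑' h : ℕ, a h / goldenRatioC ^ (i.1.1 * k * i.1.2 ^ h))
        (Sum.elim
          (fun i : FIdx' =>
            ∑' h : ℕ,
              if 0 < (k * i.1.2 ^ h + i.1.1 : ℤ) then
                b / (Nat.fib (k * i.1.2 ^ h + i.1.1 : ℤ).toNat : ℂ)
              else 0)
          (fun i : FLIdx =>
            ∑' h : ℕ,
              if 0 ≤ (k * i.1.2 ^ h + i.1.1 : ℤ) then
                c h / (lucasNum (k * i.1.2 ^ h + i.1.1 : ℤ).toNat : ℂ)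
              else 0))) := by
  exact ⟨isAlgebraic_tsum_fib hk hb_alg, algebraicIndependent_reciprocal_sums k hk a c b hb ha_per
    hc_per ha_ne hc_ne ha_alg hb_alg hc_alg⟩
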